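/- There exist absolute constants C, c > 0 such that the following holds. Let q ≤ N be positive integers and δ > 0. Suppose that A ⊆ [N] satisfies |A| ≥ δN and contains no configuration of the form x, x+y, x+q y² with y a nonzero integer. Then either N ≤ C (q/δ)^C, or there exist a positive integer q' ≤ exp(C δ^{-C}) and a positive integer N' ≥ c q^{-C} exp(-C δ^{-C}) N^{1/2} such that, for some a ∈ ℤ, |A ∩ (a + qq'·[N'])| ≥ (1+c) δ N'. -/

import Mathlib

open Finset
open scoped BigOperators ComplexConjugate

namespace NR

section basics
variable {α β γ : Type} [Fintype α] [Fintype β] [Fintype γ]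

lemma nE_le (f : α → ℂ) : ‖𝔼 x, f x‖ ≤ 𝔼 x, ‖f x‖ := by
  rw [Fintype.expect_eq_sum_div_card, Fintype.expect_eq_sum_div_card, norm_div]
  simp only [Complex.norm_natCast]
  gcongr
  exact norm_sum_le _ _

lemma E_mono {f g : α → ℝ} (h : ∀ x, f x ≤ g x) : 𝔼 x, f x ≤ 𝔼 x, g x :=
  expect_le_expect fun x _ => h x

lemma E_nonneg {f : α → ℝ} (h : ∀ x, 0 ≤ f x) : 0 ≤ 𝔼 x, f x :=
  expect_nonneg fun x _ => h x

lemma E_le_const {f : α → ℝ} {c : ℝ} (hc : 0 ≤ c) (h : ∀ x, f x ≤ c) : 𝔼 x, f x ≤ c := by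
  cases isEmpty_or_nonempty α
  · simpa using hc
  · exact expect_le univ_nonempty fun x _ => h x

lemma nE_le_one {f : α → ℂ} (h : ∀ x, ‖f x‖ ≤ 1) : ‖𝔼 x, f x‖ ≤ 1 :=
  (nE_le f).trans (E_le_const zero_le_one h)

lemma E_sq_le (f : α → ℝ) : (𝔼 x, f x) ^ 2 ≤ 𝔼 x, f x ^ 2 := by
  cases isEmpty_or_nonempty α
  · simp
  have := expect_mul_sq_le_sq_mul_sq univ (fun _ : α => (1:ℝ)) f
  simpa using this

lemma E_pow_le (k : ℕ) {f : α → ℝ} (hf : ∀ x, 0 ≤ f x) :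
    (𝔼 x, f x) ^ (2 ^ k) ≤ 𝔼 x, f x ^ (2 ^ k) := by
  induction k with
  | zero => simp
  | succ k ih =>
    rw [pow_succ, pow_mul]
    calc ((𝔼 x, f x) ^ 2 ^ k) ^ 2 ≤ (𝔼 x, f x ^ 2 ^ k) ^ 2 := by
          have := E_nonneg hf
          gcongr
      _ ≤ 𝔼 x, (f x ^ 2 ^ k) ^ 2 := E_sq_le _
      _ = _ := by simp only [← pow_mul]

lemma cs_kill (b F : α → ℂ) (hb : ∀ z, ‖b z‖ ≤ 1) :
    ‖𝔼 z, b z * F z‖ ^ 2 ≤ 𝔼 z, ‖F z‖ ^ 2 := by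
  calc ‖𝔼 z, b z * F z‖ ^ 2 ≤ (𝔼 z, ‖F z‖) ^ 2 := by
        gcongr
        refine (nE_le _).trans (E_mono fun z => ?_)
        rw [norm_mul]
        exact mul_le_of_le_one_left (norm_nonneg _) (hb z)
    _ ≤ _ := E_sq_le _

lemma sq_expect (g : α → ℂ) : ((‖𝔼 a, g a‖ ^ 2 : ℝ) : ℂ) = 𝔼 a, 𝔼 a', g a * conj (g a') := by
  rw [Complex.ofReal_pow, ← Complex.mul_conj', map_expect, expect_mul_expect]

lemma ofReal_E (f : α → ℝ) : ((𝔼 x, f x : ℝ) : ℂ) = 𝔼 x, (f x : ℂ) := by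
  exact map_expect Complex.ofRealHom _ _

lemma E_prod (f : α × β → ℂ) : 𝔼 p, f p = 𝔼 a, 𝔼 b, f (a, b) := by
  rw [← univ_product_univ, expect_product]

lemma E_prodR (f : α × β → ℝ) : 𝔼 p, f p = 𝔼 a, 𝔼 b, f (a, b) := by
  rw [← univ_product_univ, expect_product]

lemma E_comm (f : α → β → ℂ) : 𝔼 a, 𝔼 b, f a b = 𝔼 b, 𝔼 a, f a b := expect_comm _ _ _
lemma E_commR (f : α → β → ℝ) : 𝔼 a, 𝔼 b, f a b = 𝔼 b, 𝔼 a, f a b := expect_comm _ _ _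

lemma E_cong {f g : α → ℂ} (h : ∀ x, f x = g x) : 𝔼 x, f x = 𝔼 x, g x := by simp only [h]
lemma E_congR {f g : α → ℝ} (h : ∀ x, f x = g x) : 𝔼 x, f x = 𝔼 x, g x := by simp only [h]

lemma cs_dup (b : α → ℂ) (F : α → β → ℂ) (hb : ∀ z, ‖b z‖ ≤ 1) :
    ‖𝔼 z, b z * 𝔼 a, F z a‖ ^ 2 ≤ ‖𝔼 z, 𝔼 a, 𝔼 a', F z a * conj (F z a')‖ := by
  refine (cs_kill _ _ hb).trans ?_
  rw [E_cong (fun z => (sq_expect (F z)).symm), ← ofReal_E, Complex.norm_real]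
  exact le_abs_self _

lemma E_cons {k : ℕ} (f : (Fin (k+1) → α) → ℂ) :
    𝔼 h, f h = 𝔼 a, 𝔼 t, f (Fin.cons a t) := by
  rw [← E_prod (fun p : α × (Fin k → α) => f (Fin.cons p.1 p.2))]
  exact (Fintype.expect_equiv (Fin.consEquiv (fun _ => α)) _ _ (fun p => rfl)).symm

lemma E_consR {k : ℕ} (f : (Fin (k+1) → α) → ℝ) :
    𝔼 h, f h = 𝔼 a, 𝔼 t, f (Fin.cons a t) := by
  rw [← E_prodR (fun p : α × (Fin k → α) => f (Fin.cons p.1 p.2))]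
  exact (Fintype.expect_equiv (Fin.consEquiv (fun _ => α)) _ _ (fun p => rfl)).symm

lemma E_const [Nonempty α] (c : ℂ) : 𝔼 _x : α, c = c := Fintype.expect_const _
lemma E_constR [Nonempty α] (c : ℝ) : 𝔼 _x : α, c = c := Fintype.expect_const _

variable {G : Type} [AddCommGroup G] [Fintype G]
lemma E_shift (f : G → ℂ) (c : G) : 𝔼 x, f (x + c) = 𝔼 x, f x :=
  Fintype.expect_equiv (Equiv.addRight c) _ _ (fun _ => rfl)
lemma E_shiftR (f : G → ℝ) (c : G) : 𝔼 x, f (x + c) = 𝔼 x, f x :=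
  Fintype.expect_equiv (Equiv.addRight c) _ _ (fun _ => rfl)

lemma exists_large {f : α → ℝ} {d : ℝ} (h : d ≤ 𝔼 x, f x) (hd : 0 < d) : ∃ x, d ≤ f x := by
  cases isEmpty_or_nonempty α
  · simp at h; linarith
  · rw [Fintype.expect_eq_sum_div_card, le_div_iff₀ (by positivity)] at h
    obtain ⟨x, -, hx⟩ := exists_le_of_sum_le (s := (univ : Finset α)) (f := fun _ => d) (g := f) univ_nonempty
      (by simpa [mul_comm] using h)
    exact ⟨x, hx⟩

lemma E_impl {f g : α → ℝ} {d e : ℝ} (he : 0 ≤ e) (h : d ≤ 𝔼 x, f x) (f1 : ∀ x, f x ≤ 1)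
    (hd : 0 ≤ d) (hg0 : ∀ x, 0 ≤ g x) (hg : ∀ x, d / 2 ≤ f x → e ≤ g x) :
    d / 2 * e ≤ 𝔼 x, g x := by
  cases isEmpty_or_nonempty α
  · simp at h ⊢; nlinarith
  have key : ∀ x, e * f x ≤ g x + e * (d/2) := by
    intro x
    by_cases hx : d / 2 ≤ f x
    · have := hg x hx
      nlinarith [f1 x]
    · have := hg0 x
      push Not at hx
      nlinarith
  have := E_mono key
  rw [← mul_expect, expect_add_distrib, E_constR] at this
  nlinarith

end basics

lemma E_uniq {α : Type} [Fintype α] [Unique α] (f : α → ℂ) : 𝔼 x, f x = f default := by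
  rw [Fintype.expect_eq_sum_div_card]; simp

section box
variable {Z H : Type} [Fintype Z] [Fintype H]

def cube {H : Type} : (k : ℕ) → ((Fin k → H) → ℂ) → (Fin k → H) → (Fin k → H) → ℂ
  | 0, Ψ, h, _ => Ψ h
  | k+1, Ψ, h, h' => cube k (fun t => Ψ (Fin.cons (h 0) t) * conj (Ψ (Fin.cons (h' 0) t)))
      (Fin.tail h) (Fin.tail h')

lemma box_cs [Nonempty H] (k : ℕ) : ∀ {Z : Type} [Fintype Z] (Ψ : Z → (Fin k → H) → ℂ)
    (b : Fin k → Z → (Fin k → H) → ℂ)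
    (_ : ∀ i z h, ‖b i z h‖ ≤ 1) (_ : ∀ i z h a, b i z (Function.update h i a) = b i z h),
    ‖𝔼 z, 𝔼 h, Ψ z h * ∏ i, b i z h‖ ^ (2 ^ k) ≤ ‖𝔼 z, 𝔼 h, 𝔼 h', cube k (Ψ z) h h'‖ := by
  induction k with
  | zero =>
    intro Z _ Ψ b hb hi
    simp [cube]
  | succ k ih =>
    intro Z _ Ψ b hb hi
    obtain ⟨a0⟩ := ‹Nonempty H›
    have e1 : 𝔼 z, 𝔼 h, Ψ z h * ∏ i, b i z h = 𝔼 p : Z × (Fin k → H),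
        b 0 p.1 (Fin.cons a0 p.2) * 𝔼 a, Ψ p.1 (Fin.cons a p.2) *
          ∏ i : Fin k, b i.succ p.1 (Fin.cons a p.2) := by
      rw [E_prod]
      refine E_cong fun z => ?_
      rw [E_cons, E_comm]
      refine E_cong fun t => ?_
      rw [mul_expect]
      refine E_cong fun a => ?_
      rw [Fin.prod_univ_succ]
      have : b 0 z (Fin.cons a t) = b 0 z (Fin.cons a0 t) := by
        rw [← hi 0 z (Fin.cons a0 t) a, Fin.update_cons_zero]
      rw [this]; ring
    have e2 := cs_dup (fun p : Z × (Fin k → H) => b 0 p.1 (Fin.cons a0 p.2))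
      (fun p a => Ψ p.1 (Fin.cons a p.2) * ∏ i : Fin k, b i.succ p.1 (Fin.cons a p.2))
      (fun p => hb _ _ _)
    rw [← e1] at e2
    have e3 := ih (Z := Z × H × H) (fun p t => Ψ p.1 (Fin.cons p.2.1 t) *
        conj (Ψ p.1 (Fin.cons p.2.2 t)))
      (fun i p t => b i.succ p.1 (Fin.cons p.2.1 t) * conj (b i.succ p.1 (Fin.cons p.2.2 t)))
      (fun i p t => by
        rw [norm_mul, RCLike.norm_conj]
        exact mul_le_one₀ (hb _ _ _) (norm_nonneg _) (hb _ _ _))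
      (fun i p t a => by
        simp only [Fin.cons_update, hi])
    rw [pow_succ', pow_mul]
    refine (pow_le_pow_left₀ (by positivity) e2 _).trans ?_
    refine (le_of_eq ?_).trans (e3.trans (le_of_eq ?_))
    · congr 2
      rw [E_prod, E_prod]
      refine E_cong fun z => ?_
      rw [E_prod, E_comm]
      refine E_cong fun a => ?_
      rw [E_comm]
      refine E_cong fun a' => ?_
      refine E_cong fun t => ?_
      simp only [prod_mul_distrib, map_mul, map_prod]
      ring
    · congr 1
      rw [E_prod]
      refine E_cong fun z => ?_
      rw [E_prod, E_cons]
      refine E_cong fun a => ?_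
      rw [E_comm]
      refine E_cong fun t => ?_
      rw [E_cons]
      refine E_cong fun a' => ?_
      refine E_cong fun t' => ?_
      simp [cube]

end box

section bxsec
variable {G J : Type} [AddCommGroup G] [Fintype G] [Fintype J]

noncomputable def bx : (k : ℕ) → (Fin (k+1) → J → G) → (G → ℂ) → ℝ
  | 0, σ, g => 𝔼 x, ‖𝔼 a, g (x + σ 0 a)‖ ^ 2
  | k+1, σ, g => 𝔼 a, 𝔼 a', bx k (Fin.tail σ) (fun x => g (x + σ 0 a) * conj (g (x + σ 0 a')))

lemma bx_nonneg (k : ℕ) (σ : Fin (k+1) → J → G) (g : G → ℂ) : 0 ≤ bx k σ g := by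
  induction k generalizing g with
  | zero => exact E_nonneg fun x => by positivity
  | succ k ih => exact E_nonneg fun a => E_nonneg fun a' => ih _ _

lemma norm_mul_conj_le {a b : ℂ} (ha : ‖a‖ ≤ 1) (hb : ‖b‖ ≤ 1) : ‖a * conj b‖ ≤ 1 := by
  rw [norm_mul, RCLike.norm_conj]
  exact mul_le_one₀ ha (norm_nonneg _) hb

lemma bx_le_one (k : ℕ) (σ : Fin (k+1) → J → G) (g : G → ℂ) (hg : ∀ x, ‖g x‖ ≤ 1) :
    bx k σ g ≤ 1 := by
  induction k generalizing g with
  | zero => exact E_le_const zero_le_one fun x => pow_le_one₀ (norm_nonneg _) (nE_le_one fun a => hg _)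
  | succ k ih =>
    exact E_le_const zero_le_one fun a =>
      E_le_const zero_le_one fun a' => ih _ _ (fun x => norm_mul_conj_le (hg _) (hg _))

lemma bx_shift (k : ℕ) (σ : Fin (k+1) → J → G) (g : G → ℂ) (c : G) :
    bx k σ (fun x => g (x + c)) = bx k σ g := by
  induction k generalizing g with
  | zero =>
    simp only [bx]
    rw [← E_shiftR (fun x => ‖𝔼 a, g (x + σ 0 a)‖ ^ 2) c]
    simp only [add_right_comm]
  | succ k ih =>
    simp only [bx]
    refine E_congR fun a => E_congR fun a' => ?_
    rw [← ih (Fin.tail σ) (fun x => g (x + σ 0 a) * conj (g (x + σ 0 a')))]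
    simp only [add_right_comm]

lemma bx_conj (k : ℕ) (σ : Fin (k+1) → J → G) (g : G → ℂ) :
    bx k σ (fun x => conj (g x)) = bx k σ g := by
  induction k generalizing g with
  | zero =>
    simp only [bx]
    refine E_congR fun x => ?_
    rw [← map_expect, RCLike.norm_conj]
  | succ k ih =>
    simp only [bx]
    refine E_congR fun a => E_congR fun a' => ?_
    rw [← ih (Fin.tail σ) (fun x => g (x + σ 0 a) * conj (g (x + σ 0 a')))]
    simp only [map_mul, Complex.conj_conj]

lemma bx_cube (k : ℕ) (σ : Fin (k+1) → J → G) (g : G → ℂ) :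
    ((bx k σ g : ℝ) : ℂ) = 𝔼 x, 𝔼 h, 𝔼 h', cube (k+1) (fun t => g (x + ∑ i, σ i (t i))) h h' := by
  induction k generalizing g with
  | zero =>
    simp only [bx]
    rw [ofReal_E]
    refine E_cong fun x => ?_
    rw [sq_expect, E_cons]
    refine E_cong fun a => ?_
    rw [E_uniq (α := Fin 0 → J), E_cons]
    refine E_cong fun a' => ?_
    rw [E_uniq (α := Fin 0 → J)]
    simp [cube]
  | succ k ih =>
    simp only [bx]
    rw [ofReal_E, E_comm]
    rw [E_cons]
    refine E_cong fun a => ?_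
    have : ∀ f : (Fin (k+1) → J) → G → ℂ,
        𝔼 t, 𝔼 x, f t x = 𝔼 x, 𝔼 t, f t x := fun f => E_comm _
    rw [ofReal_E, this]
    have e : ∀ x : G, 𝔼 t : Fin (k+1) → J, 𝔼 h' : Fin (k+2) → J,
        cube (k+1+1) (fun t => g (x + ∑ i, σ i (t i))) (Fin.cons a t) h' =
        𝔼 a', 𝔼 t : Fin (k+1) → J, 𝔼 t' : Fin (k+1) → J,
        cube (k+1) (fun t => g (x + σ 0 a + ∑ i, Fin.tail σ i (t i)) *
          conj (g (x + σ 0 a' + ∑ i, Fin.tail σ i (t i)))) t t' := by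
      intro x
      rw [E_comm (α := J)]
      refine E_cong fun t => ?_
      rw [E_cons]
      refine E_cong fun a' => E_cong fun t' => ?_
      rw [cube]
      simp only [Fin.cons_zero, Fin.tail_cons]
      congr 1
      funext s
      simp only [Fin.sum_univ_succ (n := k+1), Fin.cons_zero, Fin.cons_succ, Fin.tail, add_assoc]
    rw [E_cong e, E_comm]
    refine E_cong fun a' => ?_
    rw [ih]
    refine E_cong fun x => ?_
    simp only [add_right_comm]

lemma boxG [Nonempty J] {P : Type} [Fintype P] (k : ℕ) (σ : P → Fin (k+1) → J → G)
    (g : P → G → ℂ) (b : Fin (k+1) → P → G → (Fin (k+1) → J) → ℂ)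
    (hb : ∀ i p x h, ‖b i p x h‖ ≤ 1)
    (hi : ∀ i p x h a, b i p x (Function.update h i a) = b i p x h) :
    ‖𝔼 p, 𝔼 x, 𝔼 h, g p (x + ∑ i, σ p i (h i)) * ∏ i, b i p x h‖ ^ (2 ^ (k+1)) ≤
      𝔼 p, bx k (σ p) (g p) := by
  have := box_cs (H := J) (k+1) (Z := P × G) (fun z h => g z.1 (z.2 + ∑ i, σ z.1 i (h i)))
    (fun i z h => b i z.1 z.2 h) (fun i z h => hb _ _ _ _) (fun i z h a => hi _ _ _ _ _)
  rw [E_prod, E_prod] at this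
  refine this.trans (le_of_eq ?_)
  simp only [← bx_cube]
  rw [← ofReal_E, Complex.norm_real]
  exact abs_of_nonneg (E_nonneg fun p => bx_nonneg _ _ _)

end bxsec

section Vsec
variable {G H : Type} [AddCommGroup G] [Fintype G] [AddCommGroup H] [Fintype H]

noncomputable def V (ι : H →+ G) (s : ℕ) (g : G → ℂ) : ℝ := bx s (fun _ => (ι : H → G)) g

lemma V_nonneg (ι : H →+ G) (s : ℕ) (g : G → ℂ) : 0 ≤ V ι s g := bx_nonneg _ _ _
lemma V_le_one (ι : H →+ G) (s : ℕ) (g : G → ℂ) (hg : ∀ x, ‖g x‖ ≤ 1) : V ι s g ≤ 1 :=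
  bx_le_one _ _ _ hg
lemma V_shift (ι : H →+ G) (s : ℕ) (g : G → ℂ) (c : G) :
    V ι s (fun x => g (x + c)) = V ι s g := bx_shift _ _ _ _
lemma V_conj (ι : H →+ G) (s : ℕ) (g : G → ℂ) :
    V ι s (fun x => conj (g x)) = V ι s g := bx_conj _ _ _

lemma V_zero (ι : H →+ G) (g : G → ℂ) : V ι 0 g = 𝔼 x, ‖𝔼 n, g (x + ι n)‖ ^ 2 := rfl

lemma V_succ (ι : H →+ G) (s : ℕ) (g : G → ℂ) :
    V ι (s+1) g = 𝔼 m : H, V ι s (fun x => g (x + ι m) * conj (g x)) := by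
  have : Nonempty H := ⟨0⟩
  have e : ∀ a a' : H, V ι s (fun x => g (x + ι a) * conj (g (x + ι a'))) =
      V ι s (fun x => g (x + ι (a + -a')) * conj (g x)) := by
    intro a a'
    rw [← V_shift ι s (fun x => g (x + ι (a + -a')) * conj (g x)) (ι a')]
    congr 1; funext x
    rw [add_assoc x, ← map_add]; congr 3; abel_nf
  change 𝔼 a, 𝔼 a', V ι s _ = _
  simp only [e]
  rw [E_commR]
  have : ∀ a' : H, 𝔼 a, V ι s (fun x => g (x + ι (a + -a')) * conj (g x)) =
      𝔼 m : H, V ι s (fun x => g (x + ι m) * conj (g x)) := fun a' =>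
    E_shiftR (fun m => V ι s (fun x => g (x + ι m) * conj (g x))) (-a')
  rw [E_congR this, E_constR]

end Vsec

section PET
variable {G : Type} [AddCommGroup G] [Fintype G]

abbrev Y (M : ℕ) : Type := Fin M × Fin M × (Fin 3 → Fin M)

def yy {M : ℕ} (y : Y M) : ℤ := 1 + (y.1 : ℤ) + (y.2.1 : ℤ) + ∑ i, ((y.2.2 i : ℕ) : ℤ)

noncomputable def Lam (κ lam : ℤ →+ G) (M : ℕ) (f0 f1 f2 : G → ℂ) : ℂ :=
  𝔼 x, 𝔼 y : Y M, f0 x * f1 (x + κ (yy y)) * f2 (x + lam (yy y ^ 2))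

def dsh (lam : ℤ →+ G) (M : ℕ) (α : ℤ) (a : Fin M) : G := lam (2 * α * (a : ℤ))

lemma pet (κ lam : ℤ →+ G) (M : ℕ) [NeZero M] (f0 f1 f2 : G → ℂ)
    (h0 : ∀ x, ‖f0 x‖ ≤ 1) (h1 : ∀ x, ‖f1 x‖ ≤ 1) (h2 : ∀ x, ‖f2 x‖ ≤ 1) :
    ‖Lam κ lam M f0 f1 f2‖ ^ 32 ≤ 𝔼 ω : Fin M × Fin M × Fin M × Fin M,
      bx 2 (fun i => dsh lam M (![((ω.1 : ℤ) - ω.2.1) + ((ω.2.2.1 : ℤ) - ω.2.2.2),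
        ((ω.2.2.1 : ℤ) - ω.2.2.2), ((ω.1 : ℤ) - ω.2.1)] i)) f2 := by
  let w : Fin M → (Fin 3 → Fin M) → ℤ := fun u z => 1 + (u : ℤ) + ∑ i, ((z i : ℕ) : ℤ)
  have s1 : ‖Lam κ lam M f0 f1 f2‖ ^ 2 ≤ ‖𝔼 p : G × Fin M × (Fin 3 → Fin M), 𝔼 a : Fin M, 𝔼 a' : Fin M,
      (f1 (p.1 + κ (a + w p.2.1 p.2.2)) * f2 (p.1 + lam ((a + w p.2.1 p.2.2)^2))) *
      conj (f1 (p.1 + κ (a' + w p.2.1 p.2.2)) * f2 (p.1 + lam ((a' + w p.2.1 p.2.2)^2)))‖ := by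
    refine le_trans (le_of_eq ?_) (cs_dup (fun p : G × Fin M × (Fin 3 → Fin M) => f0 p.1)
      (fun p (a : Fin M) => f1 (p.1 + κ (a + w p.2.1 p.2.2)) * f2 (p.1 + lam ((a + w p.2.1 p.2.2)^2)))
      (fun p => h0 _))
    congr 2
    rw [Lam, E_prod]
    refine E_cong fun x => ?_
    rw [E_prod, E_comm]
    refine E_cong fun p => ?_
    rw [mul_expect]
    refine E_cong fun a => ?_
    have : yy (a, p) = a + w p.1 p.2 := by simp only [yy, w]; ring
    rw [this]; ring
  let F2 : G × Fin M × Fin M × (Fin 3 → Fin M) → Fin M → ℂ := fun q u =>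
    f2 (q.1 - κ (w u q.2.2.2) + lam ((q.2.1 + w u q.2.2.2)^2)) *
      conj (f2 (q.1 - κ (w u q.2.2.2) + lam ((q.2.2.1 + w u q.2.2.2)^2)))
  have s2 : (‖Lam κ lam M f0 f1 f2‖ ^ 2) ^ 2 ≤ ‖𝔼 q, 𝔼 u, 𝔼 u', F2 q u * conj (F2 q u')‖ := by
    refine (pow_le_pow_left₀ (by positivity) s1 2).trans ?_
    refine le_trans (le_of_eq ?_) (cs_dup (fun q : G × Fin M × Fin M × (Fin 3 → Fin M) =>
      f1 (q.1 + κ q.2.1) * conj (f1 (q.1 + κ q.2.2.1))) F2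
      (fun q => norm_mul_conj_le (h1 _) (h1 _)))
    congr 2
    simp only [mul_expect]
    trans 𝔼 t : (G × Fin M × (Fin 3 → Fin M)) × Fin M × Fin M,
      (f1 (t.1.1 + κ (t.2.1 + w t.1.2.1 t.1.2.2)) * f2 (t.1.1 + lam ((t.2.1 + w t.1.2.1 t.1.2.2)^2))) *
      conj (f1 (t.1.1 + κ (t.2.2 + w t.1.2.1 t.1.2.2)) * f2 (t.1.1 + lam ((t.2.2 + w t.1.2.1 t.1.2.2)^2)))
    · rw [E_prod (α := G × Fin M × (Fin 3 → Fin M)) (β := Fin M × Fin M)]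
      refine E_cong fun p => ?_
      exact (E_prod (fun r : Fin M × Fin M => (f1 (p.1 + κ (r.1 + w p.2.1 p.2.2)) * f2 (p.1 + lam ((r.1 + w p.2.1 p.2.2)^2))) *
        conj (f1 (p.1 + κ (r.2 + w p.2.1 p.2.2)) * f2 (p.1 + lam ((r.2 + w p.2.1 p.2.2)^2))))).symm
    · rw [← E_prod (fun s : (G × Fin M × Fin M × (Fin 3 → Fin M)) × Fin M =>
        f1 (s.1.1 + κ s.1.2.1) * conj (f1 (s.1.1 + κ s.1.2.2.1)) * F2 s.1 s.2)]
      refine Fintype.expect_equiv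
        { toFun := fun t => ((t.1.1 + κ (w t.1.2.1 t.1.2.2), t.2.1, t.2.2, t.1.2.2), t.1.2.1)
          invFun := fun s => ((s.1.1 - κ (w s.2 s.1.2.2.2), s.2, s.1.2.2.2), s.1.2.1, s.1.2.2.1)
          left_inv := fun t => by simp
          right_inv := fun s => by simp } _ _ ?_
      rintro ⟨⟨x, u, z⟩, a, a'⟩
      simp only [F2, Equiv.coe_fn_mk, map_add, map_mul, add_sub_cancel_right]
      have : ∀ a : G, x + κ (w u z) + a = x + (a + κ (w u z)) := fun a => by abel
      simp only [this]
      ring_nf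
  have s3 : ‖𝔼 q, 𝔼 u, 𝔼 u', F2 q u * conj (F2 q u')‖ ≤
      𝔼 ω : Fin M × Fin M × Fin M × Fin M, ‖𝔼 x, 𝔼 z,
        F2 (x, ω.1, ω.2.1, z) ω.2.2.1 * conj (F2 (x, ω.1, ω.2.1, z) ω.2.2.2)‖ := by
    refine le_trans (le_of_eq ?_) (nE_le _)
    congr 1
    simp only [E_prod]
    rw [E_comm]; refine E_cong fun a => ?_
    rw [E_comm]; refine E_cong fun a' => ?_
    trans 𝔼 x : G, 𝔼 u : Fin M, 𝔼 u' : Fin M, 𝔼 z : Fin 3 → Fin M,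
      F2 (x, a, a', z) u * conj (F2 (x, a, a', z) u')
    · refine E_cong fun x => ?_
      rw [E_comm]; refine E_cong fun u => ?_
      rw [E_comm]
    rw [E_comm]; refine E_cong fun u => ?_
    rw [E_comm]
  have s4 : ∀ ω : Fin M × Fin M × Fin M × Fin M, ‖𝔼 x, 𝔼 z,
        F2 (x, ω.1, ω.2.1, z) ω.2.2.1 * conj (F2 (x, ω.1, ω.2.1, z) ω.2.2.2)‖ ^ (2 ^ 3) ≤
      bx 2 (fun i => dsh lam M (![((ω.1 : ℤ) - ω.2.1) + ((ω.2.2.1 : ℤ) - ω.2.2.2),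
        ((ω.2.2.1 : ℤ) - ω.2.2.2), ((ω.1 : ℤ) - ω.2.1)] i)) f2 := by
    rintro ⟨a, a', u, u'⟩
    dsimp only
    set p : ℤ := 1 + (u : ℤ) with hp
    set p' : ℤ := 1 + (u' : ℤ) with hp'
    set S1 : ℤ := a + p with hS1
    set S2 : ℤ := a' + p with hS2
    set S3 : ℤ := a + p' with hS3
    set S4 : ℤ := a' + p' with hS4
    let Ls : (Fin 3 → Fin M) → ℤ := fun z => 2 * (S4 * (z 0 : ℤ) + S3 * (z 1 : ℤ) + S2 * (z 2 : ℤ))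
    let Zs : (Fin 3 → Fin M) → ℤ := fun z => (z 0 : ℤ) + (z 1 : ℤ) + (z 2 : ℤ)
    let bf : Fin 3 → G → (Fin 3 → Fin M) → ℂ := fun i x z =>
      ![f2 (x - κ p' + lam (S4^2 + 2 * S4 * Zs z - Ls z)),
        conj (f2 (x - κ p' + lam (S3^2 + 2 * S3 * Zs z - Ls z))),
        conj (f2 (x - κ p + lam (S2^2 + 2 * S2 * Zs z - Ls z)))] i
    have key := boxG (J := Fin M) (P := Unit) 2
      (fun _ i => dsh lam M (![((a : ℤ) - a') + ((u : ℤ) - u'), ((u : ℤ) - u'), ((a : ℤ) - a')] i))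
      (fun _ x => f2 (x + (lam (S1^2) - κ p)))
      (fun i _ x z => bf i x z)
      (by
        intro i _ x h
        fin_cases i <;> simp [bf, h2])
      (by
        intro i _ x h c
        fin_cases i
        · simp only [bf, Zs, Ls]
          simp [-map_sub, -map_add]
          congr 2
          ring_nf
        · simp only [bf, Zs, Ls]
          simp [-map_sub, -map_add]
          congr 2
          ring_nf
        · simp only [bf, Zs, Ls]
          simp [-map_sub, -map_add]
          congr 3
          ring)
    simp only [bx_shift] at key
    refine le_trans (le_of_eq ?_) (key.trans (le_of_eq ?_))
    · congr 2
      rw [E_uniq (α := Unit), E_comm, E_comm (α := G)]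
      refine E_cong fun z => ?_
      rw [← E_shift (fun x => F2 (x, a, a', z) u * conj (F2 (x, a, a', z) u'))
        (κ (Zs z) - lam ((Zs z)^2) - lam (Ls z))]
      refine E_cong fun x => ?_
      have hw : w u z = p + Zs z := by simp only [w, Zs, hp, Fin.sum_univ_three]
      have hw' : w u' z = p' + Zs z := by simp only [w, Zs, hp', Fin.sum_univ_three]
      rw [show (∏ i : Fin (2+1), bf i x z) = _ from Fin.prod_univ_three _, show (∑ i : Fin (2+1), _) = _ from Fin.sum_univ_three _]
      simp only [F2, hw, hw', bf, dsh]
      simp only [Matrix.cons_val_zero, Matrix.cons_val_one, Matrix.cons_val]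
      have l1 : lam ((a + (p + Zs z))^2) = lam ((Zs z)^2) + lam (Ls z) +
          (lam (2 * (((a : ℤ) - a') + ((u : ℤ) - u')) * (z 0 : ℤ)) + lam (2 * ((u : ℤ) - u') * (z 1 : ℤ))
            + lam (2 * ((a : ℤ) - a') * (z 2 : ℤ))) + lam (S1^2) := by
        simp only [← map_add]
        congr 1
        simp only [hS1, hS2, hS3, hS4, hp, hp', Ls, Zs]
        ring
      have l2 : lam ((a' + (p + Zs z))^2) = lam ((Zs z)^2) + lam (Ls z) +
          lam (S2^2 + 2 * S2 * Zs z - Ls z) := by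
        simp only [← map_add]
        congr 1
        simp only [hS2]
        ring
      have l3 : lam ((a + (p' + Zs z))^2) = lam ((Zs z)^2) + lam (Ls z) +
          lam (S3^2 + 2 * S3 * Zs z - Ls z) := by
        simp only [← map_add]
        congr 1
        simp only [hS3]
        ring
      have l4 : lam ((a' + (p' + Zs z))^2) = lam ((Zs z)^2) + lam (Ls z) +
          lam (S4^2 + 2 * S4 * Zs z - Ls z) := by
        simp only [← map_add]
        congr 1
        simp only [hS4]
        ring
      rw [l1, l2, l3, l4, map_add κ p (Zs z), map_add κ p' (Zs z), map_mul (starRingEnd ℂ), Complex.conj_conj]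
      clear_value Zs Ls
      have e1 : ∀ (q T : G), x + (κ (Zs z) - lam (Zs z ^ 2) - lam (Ls z)) - (q + κ (Zs z)) +
          (lam (Zs z ^ 2) + lam (Ls z) + T) = x - q + T := fun q T => by abel
      rw [add_assoc (lam (Zs z ^ 2) + lam (Ls z)), e1, e1, e1, e1]
      have e2 : ∀ (T r q : G), x - q + (T + r) = x + T + (r - q) := fun T r q => by abel
      rw [e2]
      ring
    · rw [Fintype.expect_eq_sum_div_card]; simp
  calc ‖Lam κ lam M f0 f1 f2‖ ^ 32 = ((‖Lam κ lam M f0 f1 f2‖ ^ 2) ^ 2) ^ (2 ^ 3) := by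
        rw [← pow_mul, ← pow_mul]; norm_num
    _ ≤ (𝔼 ω : Fin M × Fin M × Fin M × Fin M, ‖𝔼 x, 𝔼 z,
        F2 (x, ω.1, ω.2.1, z) ω.2.2.1 * conj (F2 (x, ω.1, ω.2.1, z) ω.2.2.2)‖) ^ (2 ^ 3) :=
        pow_le_pow_left₀ (by positivity) (s2.trans s3) _
    _ ≤ _ := (E_pow_le 3 fun _ => norm_nonneg _).trans (E_mono s4)

end PET

lemma card_cong {M m : ℕ} (hm : 0 < m) (S : Finset (Fin M))
    (h : ∀ x ∈ S, ∀ y ∈ S, (m : ℤ) ∣ (x : ℤ) - y) : S.card ≤ M / m + 1 := by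
  rw [← card_range (M / m + 1)]
  refine card_le_card_of_injOn (fun x => (x : ℕ) / m) ?_ ?_
  · intro x _
    simp only [coe_range, Set.mem_Iio]
    exact Nat.lt_succ_of_le (Nat.div_le_div_right x.2.le)
  · intro x hx y hy hxy
    simp only at hxy
    have h1 := h x hx y hy
    have h2 : (x : ℕ) % m = (y : ℕ) % m := by
      have : (x : ℤ) % m = (y : ℤ) % m := 
        Int.ModEq.symm (Int.modEq_iff_dvd.mpr h1)
      exact_mod_cast this
    ext
    rw [← Nat.div_add_mod (x : ℕ) m, ← Nat.div_add_mod (y : ℕ) m, hxy, h2]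

lemma card_near {M r : ℕ} (S : Finset (Fin M))
    (h : ∀ x ∈ S, ∀ y ∈ S, (x : ℤ) - y ≤ r) : S.card ≤ r + 1 := by
  rcases S.eq_empty_or_nonempty with rfl | hS
  · simp
  set m := S.min' hS
  have hm := S.min'_mem hS
  have : S.card ≤ (Finset.Icc (m : ℕ) (m + r)).card := by
    refine card_le_card_of_injOn (fun x => (x : ℕ)) ?_ ?_
    · intro x hx
      have h1 := h x hx m hm
      have h2 : m ≤ x := S.min'_le x hx
      have h3 : (m : ℕ) ≤ x := h2
      simp only [coe_Icc, Set.mem_Icc]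
      omega
    · intro x _ y _ hxy; exact Fin.ext hxy
  simp at this; omega

lemma sum_inv_sq (D K : ℕ) (hD : 0 < D) :
    ∑ g ∈ Finset.Ioc D K, (1 : ℝ) / (g : ℝ) ^ 2 ≤ 1 / D := by
  have key : ∀ K, D ≤ K → ∑ g ∈ Finset.Ioc D K, (1 : ℝ) / (g : ℝ) ^ 2 ≤ 1 / D - 1 / K := by
    intro K hK
    induction K, hK using Nat.le_induction with
    | base => simp
    | succ n hn ih =>
      rw [Finset.sum_Ioc_succ_top (by omega)]
      have hn0 : (0:ℝ) < n := by exact_mod_cast (by omega : 0 < n)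
      have : (1:ℝ) / ((n+1 : ℕ) : ℝ)^2 ≤ 1 / n - 1 / ((n+1:ℕ):ℝ) := by
        push_cast
        rw [div_sub_div _ _ hn0.ne' (by positivity), div_le_div_iff₀ (by positivity) (by positivity)]
        nlinarith
      linarith
  rcases le_total D K with h | h
  · refine (key K h).trans ?_
    have : (0:ℝ) ≤ 1 / K := by positivity
    linarith
  · rw [Finset.Ioc_eq_empty_of_le h]; simp

lemma card_dvd {M g : ℕ} (hg : 0 < g) (hgM : g ≤ 3 * M) (c : ℤ) :
    ((univ.filter (fun a : Fin M => (g : ℤ) ∣ a + c)).card : ℝ) ≤ 4 * M / g := by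
  have := card_cong hg (univ.filter (fun a : Fin M => (g : ℤ) ∣ a + c)) (by
    intro x hx y hy
    simp only [mem_filter, mem_univ, true_and] at hx hy
    have := dvd_sub hx hy
    rwa [add_sub_add_right_eq_sub] at this)
  have h2 : ((M / g : ℕ) : ℝ) ≤ M / g := Nat.cast_div_le
  have hg' : (0:ℝ) < g := by exact_mod_cast hg
  have h3 : (1:ℝ) ≤ 3 * M / g := by
    rw [le_div_iff₀ hg', one_mul]; exact_mod_cast hgM
  have h4 : ((univ.filter (fun a : Fin M => (g : ℤ) ∣ a + c)).card : ℝ) ≤ ((M / g : ℕ) : ℝ) + 1 := by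
    exact_mod_cast this
  calc _ ≤ _ := h4
    _ ≤ M / g + 3 * M / g := by linarith
    _ = _ := by ring

def badp (M D : ℕ) (c c' : ℤ) (p : Fin M × Fin M) : Prop :=
  |(p.1 : ℤ) + c| * D < M ∨ D < Int.gcd (p.1 + c) (p.2 + c')

open Classical in
lemma bad_card (M D : ℕ) (hD : 0 < D) (hDM : D ≤ M) (c c' : ℤ) (hc : |c| ≤ 2 * M) :
    ((univ.filter (badp M D c c')).card : ℝ) ≤ 19 * M ^ 2 / D := by
  have hM : 0 < M := by omega
  have hD' : (0:ℝ) < D := by exact_mod_cast hD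
  set A1 := univ.filter (fun a : Fin M => |(a : ℤ) + c| * D < M)
  have hA1 : (A1.card : ℝ) ≤ 3 * M / D := by
    have := card_near (r := 2 * M / D) A1 (by
      intro x hx y hy
      simp only [A1, mem_filter, mem_univ, true_and] at hx hy
      rw [Int.natCast_div]
      rw [Int.le_ediv_iff_mul_le (by exact_mod_cast hD)]
      have h1 := le_abs_self ((x:ℤ) + c)
      have h2 := neg_abs_le ((y:ℤ) + c)
      have hD0 : (0:ℤ) < D := by exact_mod_cast hD
      push_cast
      nlinarith)
    have h2 : ((2 * M / D : ℕ) : ℝ) ≤ ((2 * M : ℕ) : ℝ) / D := Nat.cast_div_le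
    push_cast at h2
    have h3 : (1:ℝ) ≤ M / D := by
      rw [le_div_iff₀ hD', one_mul]; exact_mod_cast hDM
    have h4 : (A1.card : ℝ) ≤ ((2 * M / D : ℕ) : ℝ) + 1 := by exact_mod_cast this
    calc _ ≤ _ := h4
      _ ≤ 2 * M / D + M / D := by linarith
      _ = _ := by ring
  set A2 : ℕ → Finset (Fin M × Fin M) := fun g =>
    (univ.filter (fun a : Fin M => (g : ℤ) ∣ a + c)) ×ˢ (univ.filter (fun a : Fin M => (g : ℤ) ∣ a + c'))
  have hsub : univ.filter (badp M D c c') ⊆ (A1 ×ˢ univ) ∪ (Finset.Ioc D (3 * M)).biUnion A2 := by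
    intro p hp
    simp only [badp, mem_filter, mem_univ, true_and] at hp
    by_cases h1 : |(p.1 : ℤ) + c| * D < M
    · exact mem_union_left _ (by simp [A1, h1])
    · have h2 := hp.resolve_left h1
      refine mem_union_right _ ?_
      simp only [mem_biUnion, mem_Ioc]
      refine ⟨Int.gcd (p.1 + c) (p.2 + c'), ⟨h2, ?_⟩, ?_⟩
      · have hne : (p.1 : ℤ) + c ≠ 0 := by
          intro h0; rw [h0] at h1; simp at h1; omega
        have := Int.le_of_dvd (abs_pos.mpr hne) ((dvd_abs _ _).mpr (Int.gcd_dvd_left (p.1 + c) (p.2 + c')))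
        have h3 : |(p.1 : ℤ) + c| ≤ |(p.1 : ℤ)| + |c| := abs_add_le _ _
        have h4 : |(p.1 : ℤ)| ≤ M := by
          rw [abs_of_nonneg (by positivity)]; exact_mod_cast p.1.2.le
        omega
      · simp only [A2, mem_product, mem_filter, mem_univ, true_and]
        exact ⟨Int.gcd_dvd_left _ _, Int.gcd_dvd_right _ _⟩
  have hcard := (card_le_card hsub).trans (card_union_le _ _)
  have hb : (((Finset.Ioc D (3 * M)).biUnion A2).card : ℝ) ≤ 16 * M ^ 2 / D := by
    calc (((Finset.Ioc D (3 * M)).biUnion A2).card : ℝ) ≤ ∑ g ∈ Finset.Ioc D (3 * M), ((A2 g).card : ℝ) := by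
          exact_mod_cast card_biUnion_le
      _ ≤ ∑ g ∈ Finset.Ioc D (3 * M), 16 * (M:ℝ) ^ 2 * (1 / (g : ℝ) ^ 2) := by
          refine sum_le_sum fun g hg => ?_
          rw [mem_Ioc] at hg
          have hg0 : 0 < g := by omega
          have hg0' : (0:ℝ) < g := by exact_mod_cast hg0
          simp only [A2, card_product]
          push_cast
          calc _ ≤ (4 * (M:ℝ) / g) * (4 * M / g) :=
                mul_le_mul (card_dvd hg0 hg.2 c) (card_dvd hg0 hg.2 c') (by positivity) (by positivity)
            _ = _ := by field_simp; ring
      _ ≤ 16 * (M:ℝ)^2 * (1 / D) := by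
          rw [← mul_sum]
          exact mul_le_mul_of_nonneg_left (sum_inv_sq _ _ hD) (by positivity)
      _ = _ := by ring
  have ha : ((A1 ×ˢ (univ : Finset (Fin M))).card : ℝ) ≤ 3 * M ^ 2 / D := by
    rw [card_product]; push_cast; simp only [card_univ, Fintype.card_fin]
    calc _ ≤ 3 * M / D * (M : ℝ) := mul_le_mul_of_nonneg_right hA1 (by positivity)
      _ = _ := by ring
  calc ((univ.filter (badp M D c c')).card : ℝ) ≤
        ((A1 ×ˢ (univ : Finset (Fin M))).card : ℝ) + (((Finset.Ioc D (3 * M)).biUnion A2).card : ℝ) := by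
        exact_mod_cast hcard
    _ ≤ 3 * M ^ 2 / D + 16 * M ^ 2 / D := add_le_add ha hb
    _ = _ := by ring

lemma rep_good (M D L : ℕ) (hM : 0 < M) (hL : L = 200 * M ^ 2) (γ γ' b b' : ℤ)
    (h3 : |γ| ≤ 3 * M) (h3' : |γ'| ≤ 3 * M)
    (hg1 : (M : ℤ) ≤ |γ| * D) (hg2 : Int.gcd γ γ' ≤ D)
    (Φ : ZMod L → ℝ) (hΦ : ∀ n, 0 ≤ Φ n) [NeZero L] :
    𝔼 z : Fin M, 𝔼 z' : Fin M, Φ ((2 * (γ' * (z' - b') - γ * (z - b)) : ℤ)) ≤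
      200 * (D ^ 2 + 1) * 𝔼 n, Φ n := by
  classical
  have hγ : γ ≠ 0 := by
    rintro rfl; simp at hg1; omega
  let F : Fin M × Fin M → ZMod L := fun p => ((2 * (γ' * (p.2 - b') - γ * (p.1 - b)) : ℤ))
  have hfib : ∀ n, ((univ.filter (fun p => F p = n)).card : ℝ) ≤ D ^ 2 + 1 := by
    intro n
    have heq : ∀ p q : Fin M × Fin M, F p = n → F q = n →
        γ' * ((p.2 : ℤ) - q.2) = γ * ((p.1 : ℤ) - q.1) := by
      intro p q hp hq
      have h := hp.trans hq.symm
      simp only [F] at h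
      rw [ZMod.intCast_eq_intCast_iff_dvd_sub] at h
      have e : 2 * (γ' * ((q.2:ℤ) - b') - γ * (q.1 - b)) - 2 * (γ' * ((p.2:ℤ) - b') - γ * (p.1 - b)) =
        2 * (γ * ((p.1:ℤ) - q.1) - γ' * ((p.2:ℤ) - q.2)) := by ring
      rw [e] at h
      have hb : |2 * (γ * ((p.1:ℤ) - q.1) - γ' * ((p.2:ℤ) - q.2))| < L := by
        have i1 : |(p.1:ℤ) - q.1| ≤ M := by rw [abs_le]; constructor <;> omega
        have i2 : |(p.2:ℤ) - q.2| ≤ M := by rw [abs_le]; constructor <;> omega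
        have j1 : |γ * ((p.1:ℤ) - q.1)| ≤ 3 * M * M := by
          rw [abs_mul]; exact mul_le_mul h3 i1 (abs_nonneg _) (by positivity)
        have j2 : |γ' * ((p.2:ℤ) - q.2)| ≤ 3 * M * M := by
          rw [abs_mul]; exact mul_le_mul h3' i2 (abs_nonneg _) (by positivity)
        have hM' : (0:ℤ) < M * M := by positivity
        rw [hL]; push_cast
        rw [abs_lt]
        rw [abs_le] at j1 j2
        constructor <;> nlinarith
      have := Int.eq_zero_of_abs_lt_dvd h hb
      linarith
    set g := Int.gcd γ γ' with hgdef
    have hg0 : 0 < g := Int.gcd_pos_of_ne_zero_left _ hγ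
    obtain ⟨m, hm⟩ : (g : ℤ) ∣ γ := Int.gcd_dvd_left _ _
    obtain ⟨m', hm'⟩ : (g : ℤ) ∣ γ' := Int.gcd_dvd_right _ _
    have hcop : IsCoprime m m' := by
      rw [Int.isCoprime_iff_gcd_eq_one]
      have : Int.gcd (g * m) (g * m') = g * Int.gcd m m' := by
        rw [Int.gcd_mul_left]; simp
      rw [← hm, ← hm', ← hgdef] at this
      exact (Nat.eq_of_mul_eq_mul_left hg0 (by omega)).symm
    have hm0 : m ≠ 0 := by rintro rfl; simp at hm; exact hγ hm
    have hmD : M ≤ m.natAbs * D ^ 2 := by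
      have h1 : |γ| = g * |m| := by rw [hm, abs_mul]; simp
      rw [h1] at hg1
      have h2 : (0:ℤ) ≤ |m| * D := by positivity
      have h3 : (g:ℤ) ≤ D := by exact_mod_cast hg2
      have : (M:ℤ) ≤ |m| * D ^ 2 := by nlinarith
      zify; exact this
    have hdv : ∀ p q : Fin M × Fin M, F p = n → F q = n → m ∣ (p.2 : ℤ) - q.2 := by
      intro p q hp hq
      have h := heq p q hp hq
      rw [hm, hm'] at h
      have h' : m' * ((p.2 : ℤ) - q.2) = m * ((p.1 : ℤ) - q.1) := by
        have hg0' : (g:ℤ) ≠ 0 := by exact_mod_cast hg0.ne'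
        apply mul_left_cancel₀ hg0'; linarith
      exact hcop.dvd_of_dvd_mul_left ⟨_, h'⟩
    have hinj : ((univ.filter (fun p => F p = n)).card) =
        ((univ.filter (fun p => F p = n)).image Prod.snd).card := by
      rw [card_image_of_injOn]
      intro p hp q hq hpq
      simp only [coe_filter, mem_univ, true_and, Set.mem_ofPred_eq] at hp hq
      have h := heq p q hp hq
      rw [hpq] at h
      simp [hγ] at h
      refine Prod.ext ?_ hpq
      ext
      have : (p.1:ℤ) = q.1 := by linarith
      exact_mod_cast this
    have hc := card_cong (m := m.natAbs) (Int.natAbs_pos.mpr hm0)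
      ((univ.filter (fun p => F p = n)).image Prod.snd) (by
        intro x hx y hy
        simp only [mem_image, mem_filter, mem_univ, true_and] at hx hy
        obtain ⟨p, hp, rfl⟩ := hx
        obtain ⟨q, hq, rfl⟩ := hy
        rw [Int.natAbs_dvd]
        exact hdv p q hp hq)
    rw [← hinj] at hc
    have : M / m.natAbs ≤ D ^ 2 := Nat.div_le_of_le_mul hmD
    have : (univ.filter (fun p => F p = n)).card ≤ D ^ 2 + 1 := by omega
    exact_mod_cast this
  have e1 : 𝔼 z : Fin M, 𝔼 z' : Fin M, Φ ((2 * (γ' * (z' - b') - γ * (z - b)) : ℤ)) = 𝔼 p, Φ (F p) := by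
    rw [E_prodR]
  rw [e1, Fintype.expect_eq_sum_div_card, Fintype.expect_eq_sum_div_card]
  have e2 : ∑ p, Φ (F p) = ∑ n, ((univ.filter (fun p => F p = n)).card : ℝ) * Φ n := by
    rw [← Finset.sum_fiberwise (univ : Finset (Fin M × Fin M)) F]
    refine sum_congr rfl fun n _ => ?_
    rw [sum_congr rfl (g := fun _ => Φ n) (fun p hp => by rw [(mem_filter.mp hp).2])]
    simp
  have e3 : ∑ p, Φ (F p) ≤ (D^2+1) * ∑ n, Φ n := by
    rw [e2, mul_sum]
    exact sum_le_sum fun n _ => mul_le_mul_of_nonneg_right (hfib n) (hΦ n)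
  simp only [Fintype.card_prod, Fintype.card_fin, ZMod.card]
  have hL' : (L:ℝ) = 200 * M^2 := by rw [hL]; push_cast; ring
  rw [hL']; push_cast
  have hM' : (0:ℝ) < M := by exact_mod_cast hM
  have hs : 0 ≤ ∑ n, Φ n := sum_nonneg fun n _ => hΦ n
  rw [div_le_iff₀ (by positivity)]
  refine e3.trans (le_of_eq ?_)
  have : (200:ℝ) * M^2 ≠ 0 := by positivity
  field_simp

lemma AV (M D L : ℕ) [NeZero L] (hD : 0 < D) (hDM : D ≤ M) (hL : L = 200 * M ^ 2) (c c' b b' : ℤ)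
    (hc : |c| ≤ 2 * M) (hc' : |c'| ≤ 2 * M) (Φ : Fin M → Fin M → ZMod L → ℝ)
    (hΦ : ∀ a a' n, 0 ≤ Φ a a' n) (hΦ1 : ∀ a a' n, Φ a a' n ≤ 1) :
    𝔼 a : Fin M, 𝔼 a' : Fin M, 𝔼 z : Fin M, 𝔼 z' : Fin M,
      Φ a a' ((2 * ((a' + c') * (z' - b') - (a + c) * (z - b)) : ℤ)) ≤
      19 / D + 200 * (D ^ 2 + 1) * 𝔼 a : Fin M, 𝔼 a' : Fin M, 𝔼 n, Φ a a' n := by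
  classical
  have hM : 0 < M := by omega
  have : Nonempty (Fin M) := ⟨⟨0, hM⟩⟩
  have hb : ∀ (c : ℤ) (_ : |c| ≤ 2 * M) (a : Fin M), |(a:ℤ) + c| ≤ 3 * M := by
    intro c hc a
    have := a.2
    rw [abs_le] at hc ⊢
    constructor <;> omega
  have key : ∀ p : Fin M × Fin M, 𝔼 z : Fin M, 𝔼 z' : Fin M,
      Φ p.1 p.2 ((2 * ((p.2 + c') * (z' - b') - (p.1 + c) * (z - b)) : ℤ)) ≤
      (if badp M D c c' p then 1 else 0) + 200 * (D ^ 2 + 1) * 𝔼 n, Φ p.1 p.2 n := by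
    intro p
    have hnn : 0 ≤ 200 * ((D:ℝ) ^ 2 + 1) * 𝔼 n, Φ p.1 p.2 n :=
      mul_nonneg (by positivity) (E_nonneg fun n => hΦ _ _ _)
    split_ifs with hbad
    · have : 𝔼 z : Fin M, 𝔼 z' : Fin M,
        Φ p.1 p.2 ((2 * ((p.2 + c') * (z' - b') - (p.1 + c) * (z - b)) : ℤ)) ≤ 1 :=
        E_le_const zero_le_one fun z => E_le_const zero_le_one fun z' => hΦ1 _ _ _
      linarith
    · simp only [badp, not_or, not_lt] at hbad
      rw [zero_add]
      exact rep_good M D L hM hL _ _ b b' (hb c hc _) (hb c' hc' _) hbad.1 hbad.2 _ (hΦ _ _)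
  have := E_mono key
  rw [E_prodR, expect_add_distrib, ← mul_expect] at this
  refine this.trans ?_
  rw [E_prodR (f := fun p : Fin M × Fin M => 𝔼 n, Φ p.1 p.2 n)]
  gcongr
  rw [Fintype.expect_eq_sum_div_card]
  simp only [sum_boole, Fintype.card_prod, Fintype.card_fin]
  have := bad_card M D hD hDM c c' hc
  have hM' : (0:ℝ) < M := by exact_mod_cast hM
  rw [div_le_iff₀ (by positivity)]
  push_cast
  refine this.trans (le_of_eq ?_)
  ring

lemma E_uniqR {α : Type} [Fintype α] [Unique α] (f : α → ℝ) : 𝔼 x, f x = f default := by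
  rw [Fintype.expect_eq_sum_div_card]; simp

section K1
variable {G J P : Type} [AddCommGroup G] [Fintype G] [Fintype J] [Fintype P]

lemma bx_one_expand (σ : Fin 2 → J → G) (g : G → ℂ) :
    ((bx 1 σ g : ℝ) : ℂ) = 𝔼 x, 𝔼 h : (J × J) × (J × J),
      g x * (conj (g (x + (σ 0 h.2.1 - σ 0 h.1.1))) * conj (g (x + (σ 1 h.2.2 - σ 1 h.1.2))) *
        g (x + (σ 0 h.2.1 - σ 0 h.1.1) + (σ 1 h.2.2 - σ 1 h.1.2))) := by
  trans 𝔼 a, 𝔼 a', 𝔼 x, 𝔼 c, 𝔼 c', (g (x + σ 1 c + σ 0 a) * conj (g (x + σ 1 c + σ 0 a'))) *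
    conj (g (x + σ 1 c' + σ 0 a) * conj (g (x + σ 1 c' + σ 0 a')))
  · simp only [bx, Fin.tail, ofReal_E, sq_expect]
    rfl
  trans 𝔼 h : (J × J) × (J × J), 𝔼 x, (g (x + σ 1 h.1.2 + σ 0 h.1.1) * conj (g (x + σ 1 h.1.2 + σ 0 h.2.1))) *
    conj (g (x + σ 1 h.2.2 + σ 0 h.1.1) * conj (g (x + σ 1 h.2.2 + σ 0 h.2.1)))
  · simp only [E_prod]
    refine E_cong fun a => ?_
    rw [E_comm (α := J) (β := J)]
    refine E_cong fun a' => ?_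
    rw [E_comm]
    refine E_cong fun c => ?_
    rw [E_comm]
  rw [E_comm (α := G)]
  refine E_cong fun h => ?_
  rw [← E_shift (fun x => (g (x + σ 1 h.1.2 + σ 0 h.1.1) * conj (g (x + σ 1 h.1.2 + σ 0 h.2.1))) *
    conj (g (x + σ 1 h.2.2 + σ 0 h.1.1) * conj (g (x + σ 1 h.2.2 + σ 0 h.2.1)))) (- σ 1 h.1.2 - σ 0 h.1.1)]
  refine E_cong fun x => ?_
  have e1 : x + (- σ 1 h.1.2 - σ 0 h.1.1) + σ 1 h.1.2 + σ 0 h.1.1 = x := by abel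
  have e2 : x + (- σ 1 h.1.2 - σ 0 h.1.1) + σ 1 h.1.2 + σ 0 h.2.1 = x + (σ 0 h.2.1 - σ 0 h.1.1) := by abel
  have e3 : x + (- σ 1 h.1.2 - σ 0 h.1.1) + σ 1 h.2.2 + σ 0 h.1.1 = x + (σ 1 h.2.2 - σ 1 h.1.2) := by abel
  have e4 : x + (- σ 1 h.1.2 - σ 0 h.1.1) + σ 1 h.2.2 + σ 0 h.2.1 =
    x + (σ 0 h.2.1 - σ 0 h.1.1) + (σ 1 h.2.2 - σ 1 h.1.2) := by abel
  simp only [e1, e2, e3, e4, map_mul, Complex.conj_conj]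
  ring

lemma norm_conj_le {a : ℂ} (ha : ‖a‖ ≤ 1) : ‖conj a‖ ≤ 1 := by rwa [RCLike.norm_conj]
lemma norm_mul_le1 {a b : ℂ} (ha : ‖a‖ ≤ 1) (hb : ‖b‖ ≤ 1) : ‖a * b‖ ≤ 1 := by
  rw [norm_mul]; exact mul_le_one₀ ha (norm_nonneg _) hb

lemma K1 [Nonempty J] (σ : P → Fin 2 → J → G) (n : P → G) (f : G → ℂ) (hf : ∀ x, ‖f x‖ ≤ 1) :
    (𝔼 p, bx 1 (σ p) (fun x => f (x + n p) * conj (f x))) ^ 32 ≤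
    𝔼 p, 𝔼 p', bx 3 ![σ p 0, σ p 1, σ p' 0, σ p' 1] (fun x => f (x + n p) * conj (f (x + n p'))) := by
  let g : P → G → ℂ := fun p x => f (x + n p) * conj (f x)
  have hg : ∀ p x, ‖g p x‖ ≤ 1 := fun p x => norm_mul_conj_le (hf _) (hf _)
  let B : P → (J × J) → (J × J) → G → ℂ := fun p h h' x =>
    (conj (g p (x + (σ p 0 h'.1 - σ p 0 h.1))) * conj (g p (x + (σ p 1 h'.2 - σ p 1 h.2))) *
        g p (x + (σ p 0 h'.1 - σ p 0 h.1) + (σ p 1 h'.2 - σ p 1 h.2)))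
  set X := 𝔼 p, bx 1 (σ p) (fun x => f (x + n p) * conj (f x)) with hX
  have hX0 : 0 ≤ X := E_nonneg fun p => bx_nonneg _ _ _
  have eX : (X : ℂ) = 𝔼 x, conj (f x) * 𝔼 q : P × (J × J) × (J × J), f (x + n q.1) * B q.1 q.2.1 q.2.2 x := by
    rw [hX, ofReal_E]
    simp only [bx_one_expand]
    rw [E_comm]
    refine E_cong fun x => ?_
    rw [mul_expect, E_prod]
    refine E_cong fun p => E_cong fun h => ?_
    simp only [B, g]
    ring
  let F : G → P × (J × J) × (J × J) → ℂ := fun x q => f (x + n q.1) * B q.1 q.2.1 q.2.2 x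
  have s1 : X ^ 2 ≤ ‖𝔼 x, 𝔼 q, 𝔼 q', F x q * conj (F x q')‖ := by
    have := cs_dup (fun x => conj (f x)) F (fun x => norm_conj_le (hf x))
    rw [← eX, Complex.norm_real, Real.norm_of_nonneg hX0] at this
    exact this
  let b : Fin 4 → ((P × P) × ((J × J) × (J × J))) → G → (Fin 4 → J) → ℂ := fun i w y h =>
    let p := w.1.1
    let p' := w.1.2
    let k := w.2.1
    let k' := w.2.2
    let x := y + (σ p 0 (h 0) + σ p 1 (h 1) + σ p' 0 (h 2) + σ p' 1 (h 3))
    ![conj (g p (x + (σ p 0 k.1 - σ p 0 (h 0)))) * g p (x + (σ p 0 k.1 - σ p 0 (h 0)) + (σ p 1 k.2 - σ p 1 (h 1))),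
      conj (g p (x + (σ p 1 k.2 - σ p 1 (h 1)))),
      conj (conj (g p' (x + (σ p' 0 k'.1 - σ p' 0 (h 2)))) * g p' (x + (σ p' 0 k'.1 - σ p' 0 (h 2)) + (σ p' 1 k'.2 - σ p' 1 (h 3)))),
      conj (conj (g p' (x + (σ p' 1 k'.2 - σ p' 1 (h 3)))))] i
  have s2 := boxG (J := J) (P := (P × P) × ((J × J) × (J × J))) 3
    (fun w => ![σ w.1.1 0, σ w.1.1 1, σ w.1.2 0, σ w.1.2 1])
    (fun w x => f (x + n w.1.1) * conj (f (x + n w.1.2))) b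
    (by
      intro i w x h
      fin_cases i
      · exact norm_mul_le1 (norm_conj_le (hg _ _)) (hg _ _)
      · exact (norm_conj_le (hg _ _))
      · exact norm_conj_le (norm_mul_le1 (norm_conj_le (hg _ _)) (hg _ _))
      · exact norm_conj_le (norm_conj_le (hg _ _)))
    (by
      intro i w y h c
      fin_cases i
      · simp only [b]
        simp
        congr 1
        · congr 2; abel
        · congr 1; abel
      · simp only [b]
        simp
        congr 2; abel
      · simp only [b]
        simp
        congr 1
        · congr 1; abel
        · congr 2; abel
      · simp only [b]
        simp
        congr 1; abel)
  have e3 : 𝔼 x, 𝔼 q, 𝔼 q', F x q * conj (F x q') =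
      𝔼 w, 𝔼 x, 𝔼 h : Fin 4 → J, (f (x + ∑ i, (![σ w.1.1 0, σ w.1.1 1, σ w.1.2 0, σ w.1.2 1] : Fin 4 → J → G) i (h i) + n w.1.1) *
        conj (f (x + ∑ i, (![σ w.1.1 0, σ w.1.1 1, σ w.1.2 0, σ w.1.2 1] : Fin 4 → J → G) i (h i) + n w.1.2))) * ∏ i, b i w x h := by
    trans 𝔼 w : (P × P) × ((J × J) × (J × J)), 𝔼 s : (J × J) × (J × J), 𝔼 x,
      F x (w.1.1, s.1, w.2.1) * conj (F x (w.1.2, s.2, w.2.2))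
    · rw [← E_prod (fun v : ((P × P) × ((J × J) × (J × J))) × (J × J) × (J × J) => 𝔼 x,
        F x (v.1.1.1, v.2.1, v.1.2.1) * conj (F x (v.1.1.2, v.2.2, v.1.2.2)))]
      trans 𝔼 v : (P × (J × J) × (J × J)) × (P × (J × J) × (J × J)), 𝔼 x, F x v.1 * conj (F x v.2)
      · rw [E_prod (α := P × (J × J) × (J × J)) (β := P × (J × J) × (J × J))]
        rw [E_comm (α := G)]
        refine E_cong fun q => ?_
        rw [E_comm (α := G)]
      · refine Fintype.expect_equiv
          { toFun := fun v => (((v.1.1, v.2.1), (v.1.2.2, v.2.2.2)), (v.1.2.1, v.2.2.1))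
            invFun := fun u => ((u.1.1.1, u.2.1, u.1.2.1), (u.1.1.2, u.2.2, u.1.2.2))
            left_inv := fun t => rfl
            right_inv := fun s => rfl } _ _ ?_
        intro v; rfl
    refine E_cong fun w => ?_
    rw [E_comm (α := G)]
    simp only [E_cons, E_uniq (α := Fin 0 → J), E_prod]
    refine E_cong fun a => E_cong fun c => E_cong fun a' => E_cong fun c' => ?_
    refine (E_shift (fun x => F x (w.1.1, (a, c), w.2.1) * conj (F x (w.1.2, (a', c'), w.2.2)))
      (σ w.1.1 0 a + σ w.1.1 1 c + σ w.1.2 0 a' + σ w.1.2 1 c')).symm.trans ?_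
    refine E_cong fun x => ?_
    rw [show (∏ i : Fin (3+1), _) = _ from Fin.prod_univ_four _, Fin.sum_univ_four]
    have c2 : (Fin.cons a (Fin.cons c (Fin.cons a' (Fin.cons c' default))) : Fin (3+1) → J) 2 = a' := rfl
    have c3 : (Fin.cons a (Fin.cons c (Fin.cons a' (Fin.cons c' default))) : Fin (3+1) → J) 3 = c' := rfl
    simp only [F, B, b]
    simp [c2, c3]
    ring
  rw [e3] at s1
  calc X ^ 32 = (X ^ 2) ^ (2 ^ (3+1)) := by rw [← pow_mul]; norm_num
    _ ≤ _ := pow_le_pow_left₀ (by positivity) s1 _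
    _ ≤ _ := s2
    _ = _ := by
      have : Nonempty ((J × J) × (J × J)) := inferInstance
      rw [E_prodR, E_prodR]
      refine E_congR fun p => E_congR fun p' => ?_
      dsimp only; exact E_constR (α := (J × J) × (J × J)) (bx 3 ![σ p 0, σ p 1, σ p' 0, σ p' 1] fun x => f (x + n p) * conj (f (x + n p')))

end K1

lemma E_impl' {α : Type} [Fintype α] {f g : α → ℝ} {δ : ℝ} {C : ℕ} (h0 : 0 < δ) (h1 : δ ≤ 1/2)
    (h : δ ≤ 𝔼 x, f x) (f1 : ∀ x, f x ≤ 1) (hg0 : ∀ x, 0 ≤ g x)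
    (hg : ∀ x, δ^2 ≤ f x → δ^C ≤ g x) : δ^(C+2) ≤ 𝔼 x, g x := by
  have h2 : δ^2 ≤ δ/2 := by nlinarith
  have := E_impl (e := δ^C) (by positivity) h f1 h0.le hg0 (fun x hx => hg x (h2.trans hx))
  refine le_trans ?_ this
  rw [pow_add, mul_comm]
  gcongr

lemma AVG {R : Type} [Fintype R] (M L : ℕ) [NeZero L] (hL : L = 200 * M ^ 2) (δ : ℝ) (h0 : 0 < δ) (h1 : δ ≤ 1/2)
    (k : ℕ) (hM : 1 ≤ δ^(k+6) * M) (c b : R → ℤ) (hc : ∀ r, |c r| ≤ 2 * M)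
    (Φ : R → R → Fin M → Fin M → ZMod L → ℝ) (hΦ : ∀ r r' a a' n, 0 ≤ Φ r r' a a' n)
    (hΦ1 : ∀ r r' a a' n, Φ r r' a a' n ≤ 1)
    (H : δ^k ≤ 𝔼 r, 𝔼 r', 𝔼 a : Fin M, 𝔼 a' : Fin M, 𝔼 z : Fin M, 𝔼 z' : Fin M,
      Φ r r' a a' ((2 * ((a' + c r') * (z' - b r') - (a + c r) * (z - b r)) : ℤ))) :
    δ^(3*k+21) ≤ 𝔼 r, 𝔼 r', 𝔼 a : Fin M, 𝔼 a' : Fin M, 𝔼 n, Φ r r' a a' n := by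
  set x := δ^k with hx
  have hx0 : 0 < x := by positivity
  have hx1 : x ≤ 1 := pow_le_one₀ h0.le (by linarith)
  set D := ⌈38 / x⌉₊ with hD
  have hD1 : 38 / x ≤ D := Nat.le_ceil _
  have hD2 : (D:ℝ) ≤ 39 / x := by
    have := (Nat.ceil_lt_add_one (a := 38 / x) (by positivity)).le
    refine this.trans ?_
    rw [div_add' _ _ _ hx0.ne']
    gcongr; linarith
  have hD0 : 0 < D := by
    have : (0:ℝ) < D := lt_of_lt_of_le (by positivity) hD1
    exact_mod_cast this
  have d6 : δ^6 ≤ 1/64 := (pow_le_pow_left₀ h0.le h1 6).trans (by norm_num)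
  have d21 : δ^21 ≤ 1/2^21 := (pow_le_pow_left₀ h0.le h1 21).trans (by norm_num)
  have hDM : D ≤ M := by
    have : (D:ℝ) ≤ M := by
      refine hD2.trans ?_
      rw [div_le_iff₀ hx0]
      rw [pow_add, ← hx] at hM
      have hM0 : (0:ℝ) ≤ M := by positivity
      nlinarith [mul_nonneg hx0.le hM0]
    exact_mod_cast this
  set E := 𝔼 r, 𝔼 r', 𝔼 a : Fin M, 𝔼 a' : Fin M, 𝔼 n, Φ r r' a a' n with hE
  have hE0 : 0 ≤ E := E_nonneg fun _ => E_nonneg fun _ => E_nonneg fun _ => E_nonneg fun _ => E_nonneg fun _ => hΦ _ _ _ _ _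
  have key : x ≤ 19 / D + 200 * (D^2+1) * E := by
    cases isEmpty_or_nonempty R
    · simp at H; linarith
    refine H.trans ?_
    have hp : ∀ r r', _ := fun r r' => AV M D L hD0 hDM hL (c r) (c r') (b r) (b r') (hc r) (hc r') (Φ r r') (hΦ r r') (hΦ1 r r')
    refine (E_mono fun r => E_mono fun r' => hp r r').trans ?_
    simp only [expect_add_distrib, E_constR, ← mul_expect]
    rfl
  have k1 : 19 / (D:ℝ) ≤ x / 2 := by
    rw [div_le_div_iff₀ (by positivity) (by norm_num)]
    rw [div_le_iff₀ hx0] at hD1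
    linarith
  have k2 : ((D:ℝ)^2 + 1) ≤ 1522 / x^2 := by
    have : (D:ℝ)^2 ≤ (39/x)^2 := by gcongr
    rw [div_pow] at this
    have h3 : (1:ℝ) ≤ 1 / x^2 := by rw [le_div_iff₀ (by positivity)]; nlinarith
    calc (D:ℝ)^2+1 ≤ 39^2/x^2 + 1/x^2 := by linarith
      _ = _ := by ring
  have k3 : x / 2 ≤ 200 * (1522 / x^2) * E := by
    have : 200 * ((D:ℝ)^2+1) * E ≤ 200 * (1522 / x^2) * E := by gcongr
    linarith
  have k4 : x^3 ≤ 608800 * E := by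
    have e : 200 * (1522 / x^2) * E = (304400 * E) / x^2 := by ring
    rw [e, le_div_iff₀ (by positivity)] at k3
    nlinarith
  rw [pow_add, mul_comm 3 k, pow_mul, ← hx]
  have : x^3 * δ^21 ≤ x^3 * (1/2^21) := by gcongr
  nlinarith

section CC
variable {G : Type} [AddCommGroup G] [Fintype G]

abbrev lm {L : ℕ} (ι : ZMod L →+ G) : ℤ →+ G := ι.comp (Int.castAddHom (ZMod L))

omit [Fintype G] in
lemma lm_apply {L : ℕ} (ι : ZMod L →+ G) (n : ℤ) : lm ι n = ι (n : ZMod L) := rfl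

lemma V_one_ge {L : ℕ} [NeZero L] (ι : ZMod L →+ G) (g : G → ℂ) :
    (𝔼 n, ‖𝔼 x, g x * conj (g (x + ι n))‖) ^ 2 ≤ V ι 1 g := by
  rw [V_succ]
  refine (E_sq_le _).trans (E_mono fun m => ?_)
  rw [V_zero]
  refine le_trans ?_ (E_sq_le _)
  gcongr
  refine le_trans (le_of_eq ?_) (nE_le _)
  rw [E_comm]
  have : ∀ n : ZMod L, 𝔼 x, g (x + ι n + ι m) * conj (g (x + ι n)) = 𝔼 x, g (x + ι m) * conj (g x) :=
    fun n => E_shift (fun x => g (x + ι m) * conj (g x)) (ι n)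
  rw [E_cong this, E_const, ← RCLike.norm_conj, map_expect]
  congr 1
  refine E_cong fun x => ?_
  simp [mul_comm]

lemma CC {L : ℕ} [NeZero L] (ι : ZMod L →+ G) (M : ℕ) (hL : L = 200 * M ^ 2) (δ : ℝ) (h0 : 0 < δ) (h1 : δ ≤ 1/2)
    (hM : 1 ≤ δ^8 * M) (g : G → ℂ) (hg : ∀ x, ‖g x‖ ≤ 1)
    (H : δ ≤ 𝔼 d : Fin M × Fin M, bx 0 (fun _ => dsh (lm ι) M ((d.1 : ℤ) - d.2)) g) :
    δ^54 ≤ V ι 1 g := by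
  let Φ : ZMod L → ℝ := fun n => ‖𝔼 x, g x * conj (g (x + ι n))‖
  set X := 𝔼 d : Fin M × Fin M, bx 0 (fun _ => dsh (lm ι) M ((d.1 : ℤ) - d.2)) g with hX
  let nn : (Fin M × Fin M) × (Fin M × Fin M) → ℤ := fun p => 2 * (p.2.1 + -(p.1.1 : ℤ)) * (p.2.2 - (p.1.2 : ℤ))
  have eX : (X : ℂ) = 𝔼 x, conj (g x) * 𝔼 p, g (x + lm ι (nn p)) := by
    rw [hX, ofReal_E]
    simp only [bx, ofReal_E, sq_expect]
    trans 𝔼 d : Fin M × Fin M, 𝔼 a : Fin M, 𝔼 a' : Fin M, 𝔼 x, g (x + lm ι (nn ((d.2, a'), (d.1, a)))) * conj (g x)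
    · refine E_cong fun d => ?_
      rw [E_comm]; refine E_cong fun a => ?_
      rw [E_comm]; refine E_cong fun a' => ?_
      rw [← E_shift (fun x => g (x + lm ι (nn ((d.2, a'), (d.1, a)))) * conj (g x)) (dsh (lm ι) M ((d.1 : ℤ) - d.2) a')]
      refine E_cong fun x => ?_
      congr 2
      simp only [dsh, nn, add_assoc, ← map_add]
      congr 2; ring
    simp only [mul_expect]
    rw [E_comm (α := G)]
    simp only [E_prod]
    rw [E_comm (α := Fin M)]
    refine E_cong fun a' => ?_
    trans 𝔼 u : Fin M, 𝔼 z' : Fin M, 𝔼 z : Fin M, 𝔼 x, g (x + lm ι (nn ((a', z'), (u, z)))) * conj (g x)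
    · refine E_cong fun u => ?_
      rw [E_comm]
    rw [E_comm]
    refine E_cong fun z' => E_cong fun u => E_cong fun z => E_cong fun x => ?_
    ring
  have hX0 : 0 ≤ X := h0.le.trans H
  have s1 : X^2 ≤ 𝔼 p, 𝔼 p', Φ ((nn p' - nn p : ℤ)) := by
    have := cs_dup (fun x => conj (g x)) (fun x p => g (x + lm ι (nn p))) (fun x => norm_conj_le (hg x))
    rw [← eX, Complex.norm_real, Real.norm_of_nonneg hX0] at this
    refine this.trans ?_
    rw [E_comm]
    refine (nE_le _).trans (E_mono fun p => ?_)
    rw [E_comm]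
    refine (nE_le _).trans (E_mono fun p' => ?_)
    simp only [Φ]
    rw [← E_shift (fun x => g x * conj (g (x + ι ((nn p' - nn p : ℤ) : ZMod L)))) (lm ι (nn p))]
    refine le_of_eq ?_
    congr 1
    refine E_cong fun x => ?_
    rw [← lm_apply, add_assoc x, ← map_add]
    congr 4; simp
  have s2 : δ^2 ≤ X^2 := by gcongr
  have s3 := AVG M L hL δ h0 h1 2 (by simpa using hM) (fun r : Fin M × Fin M => -(r.1:ℤ)) (fun r => (r.2:ℤ))
    (by intro r; have := r.1.2; rw [abs_neg, abs_of_nonneg (by positivity)]; omega)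
    (fun _ _ _ _ n => Φ n) (fun _ _ _ _ _ => norm_nonneg _)
    (fun _ _ _ _ _ => nE_le_one fun x => norm_mul_conj_le (hg _) (hg _))
    (by
      refine (s2.trans s1).trans (le_of_eq ?_)
      rw [E_prodR]
      refine E_congR fun r => ?_
      rw [E_prodR]
      trans 𝔼 a : Fin M, 𝔼 z : Fin M, 𝔼 r' : Fin M × Fin M, 𝔼 a' : Fin M, 𝔼 z' : Fin M, Φ ((nn (r', (a', z')) - nn (r, (a, z)) : ℤ))
      · refine E_congR fun a => E_congR fun z => ?_
        rw [E_prodR]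
        refine E_congR fun r' => ?_
        rw [E_prodR]
      trans 𝔼 a : Fin M, 𝔼 r' : Fin M × Fin M, 𝔼 z : Fin M, 𝔼 a' : Fin M, 𝔼 z' : Fin M, Φ ((nn (r', (a', z')) - nn (r, (a, z)) : ℤ))
      · refine E_congR fun a => ?_
        rw [E_commR]
      rw [E_commR]
      refine E_congR fun r' => E_congR fun a => ?_
      rw [E_commR]
      refine E_congR fun a' => E_congR fun z => E_congR fun z' => ?_
      simp only [nn]
      congr 2; ring)
  have : Nonempty (Fin M) := by
    rcases Nat.eq_zero_or_pos M with rfl | h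
    · simp at hM; linarith
    · exact ⟨⟨0, h⟩⟩
  simp only [E_constR] at s3
  calc δ^54 = (δ^27)^2 := by ring
    _ ≤ (𝔼 n, Φ n)^2 := by gcongr
    _ ≤ _ := V_one_ge ι g

noncomputable def W {L : ℕ} [NeZero L] (ι : ZMod L →+ G) (M : ℕ) : ℕ → (G → ℂ) → ℝ
  | 0, g => 𝔼 d : Fin M × Fin M, bx 0 (fun _ => dsh (lm ι) M ((d.1 : ℤ) - d.2)) g
  | s+1, g => 𝔼 d : Fin M × Fin M, 𝔼 h : Fin M, 𝔼 h' : Fin M,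
      V ι s (fun x => g (x + dsh (lm ι) M ((d.1 : ℤ) - d.2) h) * conj (g (x + dsh (lm ι) M ((d.1 : ℤ) - d.2) h')))

lemma V_zero' {L : ℕ} [NeZero L] (ι : ZMod L →+ G) (g : G → ℂ) :
    ((V ι 0 g : ℝ) : ℂ) = 𝔼 m, 𝔼 x, g (x + ι m) * conj (g x) := by
  rw [V_zero, ofReal_E]
  simp only [sq_expect]
  rw [E_comm]
  trans 𝔼 n : ZMod L, 𝔼 n' : ZMod L, 𝔼 x, g (x + ι (n + -n')) * conj (g x)
  · refine E_cong fun n => ?_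
    rw [E_comm]
    refine E_cong fun n' => ?_
    rw [← E_shift (fun x => g (x + ι (n + -n')) * conj (g x)) (ι n')]
    refine E_cong fun x => ?_
    congr 2
    rw [add_assoc, ← map_add]; congr 2; simp
  rw [E_comm]
  have : ∀ n' : ZMod L, 𝔼 n, 𝔼 x, g (x + ι (n + -n')) * conj (g x) = 𝔼 n, 𝔼 x, g (x + ι n) * conj (g x) :=
    fun n' => E_shift (fun n => 𝔼 x, g (x + ι n) * conj (g x)) (-n')
  rw [E_cong this, E_const]

lemma W_succ {L : ℕ} [NeZero L] (ι : ZMod L →+ G) (M s : ℕ) (g : G → ℂ) :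
    W ι M (s+1) g = 𝔼 m, W ι M s (fun x => g (x + ι m) * conj (g x)) := by
  cases s with
  | zero =>
    apply Complex.ofReal_injective
    simp only [W, bx, ofReal_E, V_zero', sq_expect]
    rw [E_comm (α := ZMod L)]
    refine E_cong fun d => ?_
    set D := dsh (lm ι) M ((d.1 : ℤ) - d.2)
    rw [E_comm (α := ZMod L)]
    trans 𝔼 a, 𝔼 a', 𝔼 x, 𝔼 m : ZMod L, g (x + D a + ι m) * conj (g (x + D a)) * conj (g (x + D a' + ι m) * conj (g (x + D a')))
    · refine E_cong fun a => E_cong fun a' => ?_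
      rw [E_comm]
      refine E_cong fun x => E_cong fun m => ?_
      simp only [map_mul (starRingEnd ℂ), Complex.conj_conj]
      rw [add_right_comm x (ι m), add_right_comm x (ι m)]
      ring
    trans 𝔼 x, 𝔼 a, 𝔼 a', 𝔼 m : ZMod L, g (x + D a + ι m) * conj (g (x + D a)) * conj (g (x + D a' + ι m) * conj (g (x + D a')))
    · rw [E_comm (α := G)]
      refine E_cong fun a => ?_
      rw [E_comm (α := G)]
    refine E_cong fun x => ?_
    rw [E_comm (α := ZMod L)]
    refine E_cong fun a => ?_
    rw [E_comm (α := ZMod L)]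
  | succ s =>
    simp only [W, V_succ]
    rw [E_commR (α := ZMod L)]
    refine E_congR fun d => ?_
    rw [E_commR (α := ZMod L)]
    refine E_congR fun h => ?_
    rw [E_commR (α := ZMod L)]
    refine E_congR fun h' => E_congR fun m => ?_
    congr 1
    funext x
    simp only [map_mul (starRingEnd ℂ), Complex.conj_conj]
    rw [add_right_comm x (ι m), add_right_comm x (ι m)]
    ring

lemma W_le_one {L : ℕ} [NeZero L] (ι : ZMod L →+ G) (M s : ℕ) (g : G → ℂ) (hg : ∀ x, ‖g x‖ ≤ 1) :
    W ι M s g ≤ 1 := by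
  cases s with
  | zero => exact E_le_const zero_le_one fun d => bx_le_one _ _ _ hg
  | succ s => exact E_le_const zero_le_one fun d => E_le_const zero_le_one fun d => E_le_const zero_le_one fun d =>
      V_le_one _ _ _ fun x => norm_mul_conj_le (hg _) (hg _)

end CC

lemma pow_half {δ : ℝ} (h0 : 0 < δ) (h1 : δ ≤ 1/2) {k : ℕ} (hk : k ≠ 0) : δ^k ≤ 1/2 :=
  (pow_le_of_le_one h0.le (by linarith) hk).trans h1

lemma powM {δ : ℝ} (h0 : 0 < δ) (h1 : δ ≤ 1/2) {a b : ℕ} (hab : b ≤ a) {M : ℝ} (hM : 1 ≤ δ^a * M) : 1 ≤ δ^b * M := by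
  have : 0 ≤ M := by
    by_contra h
    push Not at h
    nlinarith [pow_pos h0 a]
  exact hM.trans (mul_le_mul_of_nonneg_right (pow_le_pow_of_le_one h0.le (by linarith) hab) this)

lemma VV (s : ℕ) : ∃ C : ℕ, ∀ (G : Type) [AddCommGroup G] [Fintype G] (L : ℕ) [NeZero L] (ι : ZMod L →+ G) (M : ℕ)
    (_ : L = 200 * M^2) (δ : ℝ) (_ : 0 < δ) (_ : δ ≤ 1/2) (_ : 1 ≤ δ^C * M) (g : G → ℂ) (_ : ∀ x, ‖g x‖ ≤ 1)
    (_ : δ ≤ W ι M s g), δ^C ≤ V ι (s+1) g := by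
  induction s with
  | zero =>
    refine ⟨54, fun G _ _ L _ ι M hL δ h0 h1 hM g hg H => ?_⟩
    exact CC ι M hL δ h0 h1 (powM h0 h1 (by norm_num) hM) g hg H
  | succ s ih =>
    obtain ⟨C, ih⟩ := ih
    refine ⟨2*C+2, fun G _ _ L _ ι M hL δ h0 h1 hM g hg H => ?_⟩
    rw [W_succ] at H
    rw [V_succ]
    refine E_impl' h0 h1 H (fun m => W_le_one _ _ _ _ fun x => norm_mul_conj_le (hg _) (hg _)) (fun m => V_nonneg _ _ _) ?_
    intro m hm
    rw [pow_mul]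
    refine ih G L ι M hL (δ^2) (by positivity) (by nlinarith) ?_ _ (fun x => norm_mul_conj_le (hg _) (hg _)) hm
    rw [← pow_mul]
    exact powM h0 h1 (by omega) hM

lemma BV (k : ℕ) : ∃ C : ℕ, ∀ (G : Type) [AddCommGroup G] [Fintype G] (L : ℕ) [NeZero L] (ι : ZMod L →+ G) (M : ℕ)
    (_ : L = 200 * M^2) (δ : ℝ) (_ : 0 < δ) (_ : δ ≤ 1/2) (_ : 1 ≤ δ^C * M) (g : G → ℂ) (_ : ∀ x, ‖g x‖ ≤ 1)
    (_ : δ ≤ 𝔼 d : Fin (k+1) → Fin M × Fin M, bx k (fun i => dsh (lm ι) M (((d i).1 : ℤ) - (d i).2)) g),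
    δ^C ≤ V ι (2*k+1) g := by
  induction k with
  | zero =>
    refine ⟨54, fun G _ _ L _ ι M hL δ h0 h1 hM g hg H => ?_⟩
    refine CC ι M hL δ h0 h1 (powM h0 h1 (by norm_num) hM) g hg (H.trans (le_of_eq ?_))
    rw [E_consR]
    refine E_congR fun d => ?_
    rw [E_uniqR (α := Fin 0 → _)]
    rfl
  | succ k ih =>
    obtain ⟨C, ih⟩ := ih
    obtain ⟨C', hv⟩ := VV (2*k+2)
    refine ⟨(2*C+2)*C' + 2 * C, fun G _ _ L _ ι M hL δ h0 h1 hM g hg H => ?_⟩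
    have hM0 : (0:ℝ) ≤ M := by positivity
    have H2 : δ ^ (2*C+2) ≤ W ι M (2*k+2) g := by
      let Q := (Fin M × Fin M) × Fin M × Fin M
      let G2 : Q → G → ℂ := fun q x => g (x + dsh (lm ι) M ((q.1.1 : ℤ) - q.1.2) q.2.1) * conj (g (x + dsh (lm ι) M ((q.1.1 : ℤ) - q.1.2) q.2.2))
      have := E_impl' (α := Q) (f := fun q => 𝔼 d : Fin (k+1) → Fin M × Fin M, bx k (fun i => dsh (lm ι) M (((d i).1 : ℤ) - (d i).2)) (G2 q))
        (g := fun q => V ι (2*k+1) (G2 q)) (C := 2 * C) h0 h1 ?_ ?_ (fun q => V_nonneg _ _ _) ?_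
      · refine this.trans (le_of_eq ?_)
        simp only [W]
        rw [E_prodR]
        refine E_congR fun d => ?_
        rw [E_prodR]
      · refine H.trans (le_of_eq ?_)
        rw [E_consR, E_prodR (α := Fin M × Fin M) (β := Fin M × Fin M)]
        refine E_congR fun d => ?_
        rw [E_prodR (α := Fin M) (β := Fin M)]
        simp only [bx]
        trans 𝔼 t : Fin (k+1) → Fin M × Fin M, 𝔼 a : Fin M, 𝔼 a' : Fin M, bx k (fun i => dsh (lm ι) M (((t i).1 : ℤ) - (t i).2)) (G2 (d, a, a'))
        · rfl
        rw [E_commR]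
        refine E_congR fun a => ?_
        rw [E_commR]
      · intro q
        exact E_le_const zero_le_one fun d => bx_le_one _ _ _ fun x => norm_mul_conj_le (hg _) (hg _)
      · intro q hq
        rw [pow_mul]
        refine ih G L ι M hL (δ^2) (by positivity) (by nlinarith) ?_ _ (fun x => norm_mul_conj_le (hg _) (hg _)) hq
        rw [← pow_mul]
        exact powM h0 h1 (by nlinarith) hM
    have := hv G L ι M hL (δ^(2*C+2)) (by positivity)
      (by calc δ^(2*C+2) ≤ δ^1 := pow_le_pow_of_le_one h0.le (by linarith) (by omega)
            _ ≤ _ := by simpa using h1)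
      (by rw [← pow_mul]; exact powM h0 h1 (by nlinarith) hM) g hg H2
    refine le_trans ?_ this
    rw [← pow_mul]
    exact pow_le_pow_of_le_one h0.le (by linarith) (by omega)

lemma bx_succ {G J : Type} [AddCommGroup G] [Fintype G] [Fintype J] (k : ℕ) (σ : Fin (k+1+1) → J → G) (g : G → ℂ) :
    bx (k+1) σ g = 𝔼 a, 𝔼 a', bx k (Fin.tail σ) (fun x => g (x + σ 0 a) * conj (g (x + σ 0 a'))) := rfl

lemma reord {M : ℕ} [NeZero M] (Ψ : Fin M × Fin M → Fin M × Fin M → Fin M × Fin M → Fin M × Fin M → ℝ) :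
    𝔼 r : (Fin M × Fin M × Fin M × Fin M), 𝔼 r' : (Fin M × Fin M × Fin M × Fin M), 𝔼 a, 𝔼 a',
      Ψ (r.2.1, r.2.2.1) (a, r.1) (r'.2.1, r'.2.2.1) (a', r'.1) = 𝔼 d0, 𝔼 d1, 𝔼 d2, 𝔼 d3, Ψ d0 d1 d2 d3 := by
  trans 𝔼 a0 : Fin M, 𝔼 u : Fin M, 𝔼 u' : Fin M, 𝔼 b0 : Fin M, 𝔼 v : Fin M, 𝔼 v' : Fin M, 𝔼 a : Fin M, 𝔼 a' : Fin M, Ψ (u, u') (a, a0) (v, v') (a', b0)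
  · simp only [E_prodR, E_constR]
  let S := Fin M × Fin M × Fin M × Fin M × Fin M × Fin M × Fin M × Fin M
  trans 𝔼 t : S, Ψ (t.2.1, t.2.2.1) (t.2.2.2.2.2.2.1, t.1) (t.2.2.2.2.1, t.2.2.2.2.2.1) (t.2.2.2.2.2.2.2, t.2.2.2.1)
  · simp only [S, E_prodR]
  trans 𝔼 t : S, Ψ (t.1, t.2.1) (t.2.2.1, t.2.2.2.1) (t.2.2.2.2.1, t.2.2.2.2.2.1) (t.2.2.2.2.2.2.1, t.2.2.2.2.2.2.2)
  · refine Fintype.expect_equiv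
      { toFun := fun t => (t.2.1, t.2.2.1, t.2.2.2.2.2.2.1, t.1, t.2.2.2.2.1, t.2.2.2.2.2.1, t.2.2.2.2.2.2.2, t.2.2.2.1)
        invFun := fun t => (t.2.2.2.1, t.1, t.2.1, t.2.2.2.2.2.2.2, t.2.2.2.2.1, t.2.2.2.2.2.1, t.2.2.1, t.2.2.2.2.2.2.1)
        left_inv := fun t => rfl
        right_inv := fun s => rfl } _ _ (fun t => rfl)
  · simp only [S, E_prodR]

lemma C1 : ∃ C : ℕ, ∀ (G : Type) [AddCommGroup G] [Fintype G] (L : ℕ) [NeZero L] (ι : ZMod L →+ G) (κ : ℤ →+ G) (M : ℕ)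
    (_ : L = 200 * M^2) (δ : ℝ) (_ : 0 < δ) (_ : δ ≤ 1/2) (_ : 1 ≤ δ^C * M) (f0 f1 f2 : G → ℂ)
    (_ : ∀ x, ‖f0 x‖ ≤ 1) (_ : ∀ x, ‖f1 x‖ ≤ 1) (_ : ∀ x, ‖f2 x‖ ≤ 1)
    (_ : δ ≤ ‖Lam κ (lm ι) M f0 f1 f2‖), δ^C ≤ V ι 8 f2 := by
  obtain ⟨C, hv⟩ := BV 3
  obtain ⟨K, hK⟩ : ∃ K : ℕ, K = 32 * 32 := ⟨_, rfl⟩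
  refine ⟨(3*K+21) * (2*C+2), fun G _ _ L _ ι κ M hL δ h0 h1 hM f0 f1 f hf0 hf1 hf H => ?_⟩
  have hMp : 0 < M := by
    rcases Nat.eq_zero_or_pos M with rfl | h
    · simp at hM; linarith
    · exact h
  have : NeZero M := ⟨hMp.ne'⟩
  have P1 := pet κ (lm ι) M f0 f1 f hf0 hf1 hf
  let σ : (Fin M × Fin M × Fin M × Fin M) × Fin M × Fin M → Fin 2 → Fin M → G := fun p => ![dsh (lm ι) M ((p.1.2.1:ℤ) - p.1.2.2.1), dsh (lm ι) M ((p.2.1:ℤ) - p.1.1)]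
  let c : (Fin M × Fin M × Fin M × Fin M) → ℤ := fun r => (r.2.1 : ℤ) - r.2.2.1 - r.1
  let b : (Fin M × Fin M × Fin M × Fin M) → ℤ := fun r => r.2.2.2
  let n : (Fin M × Fin M × Fin M × Fin M) × Fin M × Fin M → ℤ := fun p => 2 * ((p.2.1 + c p.1) * (p.2.2 - b p.1))
  have P2 : 𝔼 ω : Fin M × Fin M × Fin M × Fin M,
      bx 2 (fun i => dsh (lm ι) M (![((ω.1 : ℤ) - ω.2.1) + ((ω.2.2.1 : ℤ) - ω.2.2.2),
        ((ω.2.2.1 : ℤ) - ω.2.2.2), ((ω.1 : ℤ) - ω.2.1)] i)) f =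
      𝔼 p, bx 1 (σ p) (fun x => f (x + lm ι (n p)) * conj (f x)) := by
    simp only [E_prodR]
    rw [E_commR]
    refine E_congR fun a' => ?_
    trans 𝔼 u, 𝔼 u', 𝔼 a, 𝔼 z, 𝔼 z' : Fin M, bx 1 (σ ((a', u, u', z'), (a, z))) (fun x => f (x + lm ι (n ((a', u, u', z'), (a, z)))) * conj (f x))
    · rw [E_commR]; refine E_congR fun u => ?_
      rw [E_commR]; refine E_congR fun u' => ?_
      refine E_congR fun a => ?_
      rw [bx_succ 1]
      refine E_congR fun z => E_congR fun z' => ?_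
      rw [← bx_shift 1 (σ ((a', u, u', z'), (a, z))) _ (dsh (lm ι) M (((a:ℤ)-a')+(u-u')) z')]
      congr 1
      · funext i; fin_cases i <;> rfl
      · funext x
        congr 2
        simp only [dsh, n, c, b, add_assoc]
        simp only [Matrix.cons_val_zero]
        rw [← (lm ι).map_add]
        congr 2
        ring
    refine E_congR fun u => E_congR fun u' => ?_
    trans 𝔼 a : Fin M, 𝔼 z' : Fin M, 𝔼 z : Fin M, bx 1 (σ ((a', u, u', z'), (a, z))) (fun x => f (x + lm ι (n ((a', u, u', z'), (a, z)))) * conj (f x))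
    · refine E_congR fun a => ?_
      rw [E_commR]
    rw [E_commR]
  have KK := K1 σ (fun p => lm ι (n p)) f hf
  rw [← P2] at KK
  let Φ : (Fin M × Fin M × Fin M × Fin M) → (Fin M × Fin M × Fin M × Fin M) → Fin M → Fin M → ZMod L → ℝ := fun r r' a a' m =>
    bx 3 ![dsh (lm ι) M ((r.2.1:ℤ) - r.2.2.1), dsh (lm ι) M ((a:ℤ) - r.1), dsh (lm ι) M ((r'.2.1:ℤ) - r'.2.2.1), dsh (lm ι) M ((a':ℤ) - r'.1)]
      (fun x => f x * conj (f (x + ι m)))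
  have A := AVG M L hL δ h0 h1 K (powM h0 h1 (by nlinarith) hM) c b
    (by
      intro r
      have h1 := r.1.2
      have h2 := r.2.1.2
      have h3 := r.2.2.1.2
      simp only [c]
      rw [abs_le]; constructor <;> omega)
    Φ (fun _ _ _ _ _ => bx_nonneg _ _ _) (fun _ _ _ _ _ => bx_le_one _ _ _ fun x => norm_mul_conj_le (hf _) (hf _))
    (by
      calc δ^K = ((δ^32)^32) := by rw [hK, pow_mul]
        _ ≤ _ := (pow_le_pow_left₀ (by positivity) ((pow_le_pow_left₀ h0.le H 32).trans P1) 32)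
        _ ≤ _ := KK
        _ = 𝔼 p : (Fin M × Fin M × Fin M × Fin M) × Fin M × Fin M, 𝔼 p' : (Fin M × Fin M × Fin M × Fin M) × Fin M × Fin M, Φ p.1 p'.1 p.2.1 p'.2.1 ((n p' - n p : ℤ)) := by
          refine E_congR fun p => E_congR fun p' => ?_
          simp only [Φ, σ]
          rw [← bx_shift 3 _ (fun x => f x * conj (f (x + ι ((n p' - n p : ℤ) : ZMod L)))) (lm ι (n p))]
          congr 1
          funext x
          rw [← lm_apply, add_assoc x, ← map_add]
          congr 4; simp
        _ = _ := by
          rw [E_prodR]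
          refine E_congR fun r => ?_
          rw [E_prodR]
          trans 𝔼 a : Fin M, 𝔼 z : Fin M, 𝔼 r' : (Fin M × Fin M × Fin M × Fin M), 𝔼 a' : Fin M, 𝔼 z' : Fin M, Φ r r' a a' ((n (r', (a', z')) - n (r, (a, z)) : ℤ))
          · refine E_congR fun a => E_congR fun z => ?_
            rw [E_prodR]
            refine E_congR fun r' => ?_
            rw [E_prodR]
          trans 𝔼 a : Fin M, 𝔼 r' : (Fin M × Fin M × Fin M × Fin M), 𝔼 z : Fin M, 𝔼 a' : Fin M, 𝔼 z' : Fin M, Φ r r' a a' ((n (r', (a', z')) - n (r, (a, z)) : ℤ))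
          · refine E_congR fun a => ?_
            rw [E_commR]
          rw [E_commR]
          refine E_congR fun r' => E_congR fun a => ?_
          rw [E_commR]
          refine E_congR fun a' => E_congR fun z => E_congR fun z' => ?_
          simp only [n]
          congr 2; ring)
  have A2 : δ^(3*K+21) ≤ 𝔼 m : ZMod L, 𝔼 d : Fin (3+1) → Fin M × Fin M,
      bx 3 (fun i => dsh (lm ι) M (((d i).1 : ℤ) - (d i).2)) (fun x => f x * conj (f (x + ι m))) := by
    refine A.trans (le_of_eq ?_)
    trans 𝔼 r, 𝔼 r', 𝔼 m, 𝔼 a, 𝔼 a', Φ r r' a a' m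
    · refine E_congR fun r => E_congR fun r' => ?_
      rw [E_commR (α := ZMod L)]
      refine E_congR fun a => ?_
      rw [E_commR (α := ZMod L)]
    trans 𝔼 m, 𝔼 r, 𝔼 r', 𝔼 a, 𝔼 a', Φ r r' a a' m
    · rw [E_commR (α := ZMod L)]
      refine E_congR fun r => ?_
      rw [E_commR (α := ZMod L)]
    refine E_congR fun m => ?_
    let Ψ : Fin M × Fin M → Fin M × Fin M → Fin M × Fin M → Fin M × Fin M → ℝ := fun d0 d1 d2 d3 =>
      bx 3 ![dsh (lm ι) M ((d0.1:ℤ) - d0.2), dsh (lm ι) M ((d1.1:ℤ) - d1.2), dsh (lm ι) M ((d2.1:ℤ) - d2.2), dsh (lm ι) M ((d3.1:ℤ) - d3.2)]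
        (fun x => f x * conj (f (x + ι m)))
    trans 𝔼 d0, 𝔼 d1, 𝔼 d2, 𝔼 d3, Ψ d0 d1 d2 d3
    · exact reord Ψ
    simp only [E_consR, E_uniqR (α := Fin 0 → _)]
    refine E_congR fun d0 => E_congR fun d1 => E_congR fun d2 => E_congR fun d3 => ?_
    simp only [Ψ]
    congr 1
    funext i
    fin_cases i <;> rfl
  have B := E_impl' (C := 2*C) (g := fun m => V ι 7 (fun x => f x * conj (f (x + ι m)))) (by positivity) (pow_half h0 h1 (by omega)) A2
    (fun m => E_le_const zero_le_one fun d => bx_le_one _ _ _ fun x => norm_mul_conj_le (hf _) (hf _))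
    (fun m => V_nonneg _ _ _) (by
      intro m hm
      rw [pow_mul]
      refine hv G L ι M hL ((δ^(3*K+21))^2) (by positivity) (by rw [← pow_mul]; exact pow_half h0 h1 (by omega)) ?_ _ (fun x => norm_mul_conj_le (hf _) (hf _)) hm
      rw [← pow_mul, ← pow_mul]
      exact powM h0 h1 (by nlinarith) hM)
  rw [← pow_mul] at B
  refine B.trans (le_of_eq ?_)
  rw [V_succ]
  refine E_congR fun m => ?_
  rw [← V_conj]
  congr 1; funext x
  simp [mul_comm]

noncomputable def ee (θ : ℝ) : ℂ := Complex.exp (Complex.I * (2 * Real.pi * θ : ℝ))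
noncomputable def nn (θ : ℝ) : ℝ := |θ - round θ|

lemma ee_norm (θ : ℝ) : ‖ee θ‖ = 1 := by
  rw [ee, mul_comm]; exact Complex.norm_exp_ofReal_mul_I _
lemma ee_add (a b : ℝ) : ee (a + b) = ee a * ee b := by
  rw [ee, ee, ee, ← Complex.exp_add]; congr 1; push_cast; ring
lemma ee_int (n : ℤ) : ee n = 1 := by
  rw [ee, Complex.exp_eq_one_iff]; exact ⟨n, by push_cast; ring⟩
lemma ee_conj (a : ℝ) : conj (ee a) = ee (-a) := by
  rw [ee, ee, ← Complex.exp_conj]; congr 1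
  rw [map_mul, Complex.conj_I, Complex.conj_ofReal]; push_cast; ring
lemma ee_add_int (a : ℝ) (n : ℤ) : ee (a + n) = ee a := by rw [ee_add, ee_int, mul_one]
lemma ee_nat_mul (a : ℝ) (n : ℕ) : ee (a * n) = ee a ^ n := by
  rw [ee, ee, ← Complex.exp_nat_mul]; congr 1; push_cast; ring

lemma nn_nonneg (θ : ℝ) : 0 ≤ nn θ := abs_nonneg _
lemma nn_le_half (θ : ℝ) : nn θ ≤ 1/2 := abs_sub_round θ
lemma nn_le (θ : ℝ) (m : ℤ) : nn θ ≤ |θ - m| := round_le _ _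
lemma nn_add (a b : ℝ) : nn (a + b) ≤ nn a + nn b := by
  refine (nn_le _ (round a + round b)).trans ?_
  push_cast
  rw [show a + b - (round a + round b) = (a - round a) + (b - round b) by ring]
  exact abs_add_le _ _
lemma nn_neg (a : ℝ) : nn (-a) ≤ nn a := by
  refine (nn_le _ (- round a)).trans ?_
  push_cast
  rw [← abs_neg]; refine le_of_eq ?_; rw [nn]; congr 1; ring
lemma nn_sub (a b : ℝ) : nn (a - b) ≤ nn a + nn b := by
  rw [sub_eq_add_neg]; exact (nn_add _ _).trans (by gcongr; exact nn_neg _)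
lemma nn_int_mul (k : ℤ) (a : ℝ) : nn (k * a) ≤ |(k:ℝ)| * nn a := by
  refine (nn_le _ (k * round a)).trans ?_
  push_cast
  rw [← mul_sub, abs_mul]; rfl
lemma ee_round (θ : ℝ) : ee θ = ee (θ - round θ) := by
  rw [← ee_add_int (θ - round θ) (round θ)]; congr 1; ring

lemma ee_sub_one_norm (θ : ℝ) : ‖ee θ - 1‖ = 2 * |Real.sin (Real.pi * θ)| := by
  rw [ee, Complex.norm_exp_I_mul_ofReal_sub_one, Real.norm_eq_abs, abs_mul]
  rw [abs_of_pos (by norm_num : (0:ℝ) < 2)]; congr 3; ring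

lemma ee_lower (θ : ℝ) : 4 * nn θ ≤ ‖ee θ - 1‖ := by
  rw [ee_round, ee_sub_one_norm]
  set φ := θ - round θ with hφ
  have h1 : |φ| ≤ 1/2 := nn_le_half θ
  have h2 := Real.mul_le_sin (x := Real.pi * |φ|) (by positivity) (by nlinarith [Real.pi_pos])
  have h3 : 2 / Real.pi * (Real.pi * |φ|) = 2 * |φ| := by field_simp
  have h4 : |Real.sin (Real.pi * φ)| = |Real.sin (Real.pi * |φ|)| := by
    rcases abs_choice φ with h | h <;> rw [h]
    rw [mul_neg, Real.sin_neg, abs_neg]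
  have h5 : nn θ = |φ| := rfl
  rw [h4, h5]
  linarith [le_abs_self (Real.sin (Real.pi * |φ|))]

lemma ee_upper (θ : ℝ) : ‖ee θ - 1‖ ≤ 7 * nn θ := by
  rw [ee_round, ee_sub_one_norm]
  have h5 : nn θ = |θ - round θ| := rfl
  rw [h5]
  have : |Real.sin (Real.pi * (θ - round θ))| ≤ |Real.pi * (θ - round θ)| := Real.abs_sin_le_abs
  rw [abs_mul, abs_of_pos Real.pi_pos] at this
  nlinarith [Real.pi_lt_d2, abs_nonneg (θ - round θ)]

lemma E_range {M : ℕ} (g : ℕ → ℂ) : 𝔼 b : Fin M, g b = (∑ b ∈ range M, g b) / M := by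
  rw [Fintype.expect_eq_sum_div_card, Fin.sum_univ_eq_sum_range (fun b => g b), Fintype.card_fin]

lemma geo_bound (M : ℕ) (φ : ℝ) : ‖𝔼 b : Fin M, ee (φ * (b:ℕ))‖ * (M * nn φ) ≤ 1 := by
  rcases Nat.eq_zero_or_pos M with rfl | hM
  · simp
  have hM' : (0:ℝ) < M := by exact_mod_cast hM
  rw [E_range (fun b => ee (φ * b)), norm_div, Complex.norm_natCast]
  simp only [ee_nat_mul]
  have h1 : ‖∑ b ∈ range M, ee φ ^ b‖ * ‖ee φ - 1‖ ≤ 2 := by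
    rw [← norm_mul, geom_sum_mul]
    refine (norm_sub_le _ _).trans ?_
    simp [ee_norm]; norm_num
  have h2 := ee_lower φ
  have h3 : ‖∑ b ∈ range M, ee φ ^ b‖ * (4 * nn φ) ≤ 2 := le_trans (by gcongr) h1
  rw [div_mul_eq_mul_div, div_le_iff₀ hM']
  nlinarith

lemma shift_sum {M s : ℕ} (g : ℕ → ℂ) (hg : ∀ b, ‖g b‖ ≤ 1) :
    ‖∑ b ∈ range M, g (b + s) - ∑ b ∈ range M, g b‖ ≤ 2 * s := by
  induction s with
  | zero => simp
  | succ s ih =>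
    have : ∑ b ∈ range M, g (b + (s+1)) - ∑ b ∈ range M, g (b+s) = g (M + s) - g s := by
      have := sum_range_succ' (fun b => g (b + s)) M
      rw [sum_range_succ] at this
      have e : ∀ b, g (b + (s+1)) = g (b + 1 + s) := fun b => by congr 1; ring
      simp only [e, zero_add] at this ⊢
      linear_combination -this
    calc _ = ‖(∑ b ∈ range M, g (b + (s+1)) - ∑ b ∈ range M, g (b+s)) + (∑ b ∈ range M, g (b+s) - ∑ b ∈ range M, g b)‖ := by
          congr 1; ring
      _ ≤ ‖g (M+s) - g s‖ + 2 * s := by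
          rw [this]; exact (norm_add_le _ _).trans (by gcongr)
      _ ≤ (1 + 1) + 2 * s := by gcongr; exact (norm_sub_le _ _).trans (add_le_add (hg _) (hg _))
      _ = _ := by push_cast; ring

lemma shift_avg {M J : ℕ} {S : Type} [Fintype S] [Nonempty S] (t : S → ℕ) (hs : ∀ s, t s ≤ J) (g : ℕ → ℂ) (hg : ∀ b, ‖g b‖ ≤ 1) :
    ‖𝔼 b : Fin M, g b - 𝔼 b : Fin M, 𝔼 s, g (b + t s)‖ ≤ 2 * J / M := by
  rw [E_comm]
  have : 𝔼 b : Fin M, g b = 𝔼 _s : S, 𝔼 b : Fin M, g b := by rw [E_const]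
  rw [this, ← expect_sub_distrib]
  refine (nE_le _).trans (E_le_const (by positivity) fun s => ?_)
  rw [E_range (fun b => g b), E_range (fun b => g (b + t s)), ← sub_div, norm_div, Complex.norm_natCast, norm_sub_rev]
  have := shift_sum (M := M) (s := t s) g hg
  gcongr
  refine this.trans ?_
  have := hs s
  gcongr

set_option maxHeartbeats 1000000 in
lemma vin {M : ℕ} (S : Finset ℕ) (hS : S ⊆ range M) {η K θ ξ : ℝ} (hη : 0 < η) (hη1 : η ≤ 1) (hK : 1 ≤ K)
    (hc : η * M ≤ #S) (hM : 44 * K ≤ η^2 * M) (H : ∀ w ∈ S, nn (ξ + θ * w) * M ≤ K) :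
    ∃ d : ℕ, 0 < d ∧ d * η ≤ 2 ∧ nn (d * θ) * M^2 * η^3 ≤ 176 * K^2 := by
  have hM0 : (0:ℝ) < M := by
    by_contra h
    push Not at h
    have : (0:ℝ) ≤ M := by positivity
    nlinarith [sq_nonneg η]
  have hηM : 44 ≤ η * M := by nlinarith [mul_pos hη hM0]
  set D := ⌈2/η⌉₊ with hD
  have hD1 : 2/η ≤ D := Nat.le_ceil _
  have hD0 : 0 < D := Nat.ceil_pos.mpr (by positivity)
  obtain ⟨w, hw, w', hw', hne, hlab⟩ : ∃ w ∈ S, ∃ w' ∈ S, w ≠ w' ∧ w / D = w' / D := by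
    refine Finset.exists_ne_map_eq_of_card_lt_of_maps_to (t := range (M/D+1)) ?_ (f := fun w => w / D) ?_
    · rw [card_range]
      have : ((M/D+1 : ℕ) : ℝ) < #S := by
        push_cast
        have h1 : ((M/D : ℕ) : ℝ) ≤ M / D := Nat.cast_div_le
        have h2 : (M:ℝ) / D ≤ η * M / 2 := by
          rw [div_le_iff₀ (by positivity)]
          rw [div_le_iff₀ hη] at hD1
          nlinarith
        linarith
      exact_mod_cast this
    · intro w hw
      have := mem_range.mp (hS hw)
      simp only [coe_range, Set.mem_Iio]
      have : w / D ≤ M / D := Nat.div_le_div_right this.le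
      omega
  wlog hlt : w < w' generalizing w w'
  · exact this w' hw' w hw hne.symm hlab.symm (lt_of_le_of_ne (not_lt.mp hlt) hne.symm)
  obtain ⟨d, hd⟩ : ∃ d, w' = w + d := ⟨w' - w, by omega⟩
  have hd0 : 0 < d := by omega
  have hdD : d < D := by
    have h1 := Nat.div_add_mod w D
    have h2 := Nat.div_add_mod w' D
    have h3 := Nat.mod_lt w hD0
    have h4 := Nat.mod_lt w' hD0
    rw [hlab] at h1
    omega
  have hdη : d * η ≤ 2 := by
    have : (d:ℝ) < 2/η := Nat.lt_ceil.mp hdD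
    rw [lt_div_iff₀ hη] at this; exact this.le
  refine ⟨d, hd0, hdη, ?_⟩
  have hd0' : (0:ℝ) < d := by exact_mod_cast hd0
  have h1 : nn (d * θ) * M ≤ 2 * K := by
    have e : (d:ℝ) * θ = (ξ + θ * w') - (ξ + θ * w) := by rw [hd]; push_cast; ring
    rw [e]
    have := nn_sub (ξ + θ * w') (ξ + θ * w)
    nlinarith [H w hw, H w' hw']
  set p := round (d * θ) with hp
  set γ := d * θ - p with hγ
  have hγn : nn (d * θ) = |γ| := rfl
  rw [hγn] at h1 ⊢
  set B := ⌈4 * K⌉₊ with hB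
  have hB1 : 4 * K ≤ B := Nat.le_ceil _
  have hB2 : (B:ℝ) ≤ 5 * K := (Nat.ceil_lt_add_one (by positivity)).le.trans (by linarith)
  let lab : ℕ → ℕ × ℤ := fun w => (w % d, round (ξ + θ * w) - p * ((w / d : ℕ):ℤ) - ⌊ξ + θ * ((w % d : ℕ):ℝ)⌋)
  have hwd : ∀ w : ℕ, (w:ℝ) = d * ((w / d : ℕ):ℝ) + ((w % d : ℕ):ℝ) := fun w => by exact_mod_cast (Nat.div_add_mod w d).symm
  have hmaps : ∀ w ∈ S, lab w ∈ range d ×ˢ Icc (-(B:ℤ)) B := by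
    intro w hw
    have hwM := mem_range.mp (hS hw)
    simp only [lab, mem_product, mem_range, mem_Icc]
    refine ⟨Nat.mod_lt _ hd0, ?_⟩
    have ha := abs_le.mp (abs_sub_round (ξ + θ * w))
    have hf1 := Int.floor_le (ξ + θ * ((w % d : ℕ):ℝ))
    have hf2 := Int.lt_floor_add_one (ξ + θ * ((w % d : ℕ):ℝ))
    have ht : |γ * ((w/d : ℕ):ℝ)| ≤ 2 * K := by
      rw [abs_mul, Nat.abs_cast]
      refine le_trans ?_ h1
      gcongr
      exact (Nat.div_le_self _ _).trans hwM.le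
    have ht := abs_le.mp ht
    have e : ξ + θ * w = ξ + θ * ((w % d : ℕ):ℝ) + p * ((w / d : ℕ):ℝ) + γ * ((w / d : ℕ):ℝ) := by
      rw [hwd w, hγ]
      have : (w:ℝ) = d * ((w / d : ℕ):ℝ) + ((w % d : ℕ):ℝ) := hwd w
      rw [← this]; nth_rewrite 1 [this]; ring
    constructor
    · have : (-(B:ℝ)) ≤ round (ξ + θ * w) - p * ((w / d : ℕ):ℝ) - ⌊ξ + θ * ((w % d : ℕ):ℝ)⌋ := by linarith
      rw [← Int.cast_le (R := ℝ)]
      simp only [Int.cast_sub, Int.cast_mul, Int.cast_natCast, Int.cast_neg]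
      exact this
    · have : round (ξ + θ * w) - p * ((w / d : ℕ):ℝ) - ⌊ξ + θ * ((w % d : ℕ):ℝ)⌋ ≤ (B:ℝ) := by linarith
      rw [← Int.cast_le (R := ℝ)]
      simp only [Int.cast_sub, Int.cast_mul, Int.cast_natCast, Int.cast_neg]
      exact this
  have hne : (range d ×ˢ Icc (-(B:ℤ)) B).Nonempty := ⟨lab w, hmaps w hw⟩
  have hcard : ((#(range d ×ˢ Icc (-(B:ℤ)) B) : ℕ) : ℝ) ≤ d * (11 * K) := by
    rw [card_product, card_range, Int.card_Icc]
    push_cast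
    have : (((B:ℤ) + 1 - -(B:ℤ)).toNat : ℝ) = 2 * B + 1 := by
      have : ((B:ℤ) + 1 - -(B:ℤ)).toNat = 2 * B + 1 := by omega
      rw [this]; push_cast; ring
    rw [this]
    gcongr; linarith
  obtain ⟨y, hy, hfib⟩ := exists_le_card_fiber_of_nsmul_le_card_of_maps_to (b := (#S : ℝ) / (d * (11 * K))) hmaps hne (by
    rw [nsmul_eq_mul]
    have hpos : (0:ℝ) < d * (11 * K) := by positivity
    calc _ ≤ (d * (11 * K)) * ((#S : ℝ) / (d * (11 * K))) :=
          mul_le_mul_of_nonneg_right hcard (div_nonneg (Nat.cast_nonneg _) hpos.le)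
      _ = _ := mul_div_cancel₀ _ hpos.ne')
  set T := S.filter (fun w => lab w = y) with hT
  have hn : η * M / (d * (11 * K)) ≤ #T := le_trans (by gcongr) hfib
  have hn2 : 2 ≤ η * M / (d * (11 * K)) := by
    rw [le_div_iff₀ (by positivity)]
    nlinarith
  have hTne : T.Nonempty := by
    rw [← card_pos]
    have : (0:ℝ) < #T := by linarith
    exact_mod_cast this
  set m1 := T.min' hTne with hm1
  set m2 := T.max' hTne with hm2
  have hm1T : m1 ∈ T := min'_mem _ _
  have hm2T : m2 ∈ T := max'_mem _ _
  have hcT : #T ≤ m2 - m1 + 1 := by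
    have : T ⊆ Icc m1 m2 := fun x hx => mem_Icc.mpr ⟨min'_le _ _ hx, le_max' _ _ hx⟩
    have := card_le_card this
    rw [Nat.card_Icc] at this
    have : m1 ≤ m2 := min'_le _ _ hm2T
    omega
  have hm12 : m1 ≤ m2 := min'_le _ _ hm2T
  simp only [hT, mem_filter] at hm1T hm2T
  have hlabe := hm1T.2.trans hm2T.2.symm
  simp only [lab, Prod.mk.injEq] at hlabe
  obtain ⟨hr, hl2⟩ := hlabe
  rw [hr] at hl2
  have a1 := H m1 hm1T.1
  have a2 := H m2 hm2T.1
  have hl3 : (round (ξ + θ * m1) : ℝ) - p * ((m1 / d : ℕ):ℝ) = round (ξ + θ * m2) - p * ((m2 / d : ℕ):ℝ) := by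
    have := sub_left_inj.mp hl2
    have := congrArg (Int.cast (R := ℝ)) this
    simp only [Int.cast_sub, Int.cast_mul, Int.cast_natCast] at this
    exact this
  have w1 := hwd m1
  have w2 := hwd m2
  rw [hr] at w1
  have hg : γ * ((m2:ℝ) - m1) = d * (((ξ + θ * m2) - round (ξ + θ * m2)) - ((ξ + θ * m1) - round (ξ + θ * m1))) := by
    have hs : (m2:ℝ) - m1 = d * (((m2 / d : ℕ):ℝ) - ((m1 / d : ℕ):ℝ)) := by linear_combination w2 - w1
    have hpp : (p:ℝ) * (((m2 / d : ℕ):ℝ) - ((m1 / d : ℕ):ℝ)) = round (ξ + θ * m2) - round (ξ + θ * m1) := by linear_combination hl3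
    rw [hγ]
    linear_combination (-(p:ℝ)) * hs + (-(d:ℝ)) * hpp
  have hg2 : |γ| * ((m2:ℝ) - m1) * M ≤ d * (2 * K) := by
    have e : |γ| * ((m2:ℝ) - m1) = |γ * ((m2:ℝ) - m1)| := by
      rw [abs_mul]; congr 1; rw [abs_of_nonneg]; have : (m1:ℝ) ≤ m2 := by exact_mod_cast hm12
      linarith
    rw [e, hg, abs_mul, abs_of_pos hd0']
    have := abs_sub ((ξ + θ * m2) - round (ξ + θ * m2)) ((ξ + θ * m1) - round (ξ + θ * m1))
    simp only [nn] at a1 a2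
    rw [mul_assoc]
    refine mul_le_mul_of_nonneg_left ?_ hd0'.le
    nlinarith
  have hdiff : η * M / (d * (11 * K)) / 2 ≤ (m2:ℝ) - m1 := by
    have : (#T : ℝ) ≤ (m2:ℝ) - m1 + 1 := by
      have : ((#T : ℕ):ℝ) ≤ ((m2 - m1 + 1 : ℕ):ℝ) := by exact_mod_cast hcT
      rw [Nat.cast_add, Nat.cast_sub hm12] at this
      simpa using this
    linarith
  have f1 : |γ| * (η * M / (d * (11 * K)) / 2) * M ≤ d * (2 * K) := le_trans (by gcongr) hg2
  have f2 : |γ| * M^2 * η ≤ 44 * K^2 * d^2 := by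
    have e : |γ| * (η * M / (d * (11 * K)) / 2) * M = (|γ| * M^2 * η) / (22 * d * K) := by field_simp; ring
    rw [e, div_le_iff₀ (by positivity)] at f1
    refine f1.trans (le_of_eq ?_); ring
  calc |γ| * M^2 * η^3 = (|γ| * M^2 * η) * η^2 := by ring
    _ ≤ (44 * K^2 * d^2) * η^2 := by gcongr
    _ = 44 * K^2 * (d * η)^2 := by ring
    _ ≤ 44 * K^2 * 2^2 := by gcongr
    _ = _ := by ring

lemma cpow {δ : ℝ} (h0 : 0 < δ) (h1 : δ ≤ 1/2) {c : ℝ} (j : ℕ) (hc : c ≤ 2^j) : c * δ^j ≤ 1 := by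
  calc c * δ^j ≤ 2^j * δ^j := by gcongr
    _ = (2*δ)^j := by rw [mul_pow]
    _ ≤ 1 := pow_le_one₀ (by positivity) (by linarith)

lemma pmono {δ : ℝ} (h0 : 0 < δ) (h1 : δ ≤ 1/2) {a b : ℕ} (hab : b ≤ a) : δ^a ≤ δ^b :=
  pow_le_pow_of_le_one h0.le (by linarith) hab

lemma pdown {δ : ℝ} (h0 : 0 < δ) (h1 : δ ≤ 1/2) {a b : ℕ} (hab : b ≤ a) {X : ℝ} (hX : 0 ≤ X) (h : X * δ^b ≤ 1) : X * δ^a ≤ 1 :=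
  (mul_le_mul_of_nonneg_left (pmono h0 h1 hab) hX).trans h

lemma vinE {M : ℕ} {δ θ ξ : ℝ} (h0 : 0 < δ) (h1 : δ ≤ 1/2) (hM : 1 ≤ δ^18 * M) (f : Fin M → ℝ) (f1 : ∀ w, f w ≤ 1)
    (h : δ ≤ 𝔼 w, f w) (H : ∀ w : Fin M, δ^2 ≤ f w → nn (ξ + θ * (w:ℕ)) * M * δ^2 ≤ 1) :
    ∃ d : ℕ, 0 < d ∧ d * δ^18 ≤ 1 ∧ nn (d * θ) * M^2 * δ^18 ≤ 1 := by
  have hM0 : (0:ℝ) < M := by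
    by_contra hh; push Not at hh
    nlinarith [pow_pos h0 18]
  set S : Finset (Fin M) := univ.filter (fun w => δ^2 ≤ f w) with hS
  have hc : δ^2 * M ≤ #(S.image (fun w : Fin M => (w:ℕ))) := by
    rw [card_image_of_injective _ Fin.val_injective]
    have e : 𝔼 w, f w ≤ 𝔼 w, ((if δ^2 ≤ f w then 1 else 0) + δ^2) := by
      refine E_mono fun w => ?_
      split_ifs with hw
      · nlinarith [f1 w]
      · linarith
    have : Nonempty (Fin M) := ⟨⟨0, by exact_mod_cast hM0⟩⟩
    rw [expect_add_distrib, E_constR] at e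
    have e2 : 𝔼 w : Fin M, (if δ^2 ≤ f w then (1:ℝ) else 0) = #S / M := by
      rw [Fintype.expect_eq_sum_div_card, Fintype.card_fin, sum_boole]
    rw [e2] at e
    rw [← le_div_iff₀ hM0]; nlinarith
  obtain ⟨d, hd, hd1, hd2⟩ := vin (M := M) (S.image (fun w : Fin M => (w:ℕ))) (by
      intro w hw
      obtain ⟨v, -, rfl⟩ := mem_image.mp hw
      exact mem_range.mpr v.2) (η := δ^2) (K := 1/δ^2) (θ := θ) (ξ := ξ) (by positivity)
      (by nlinarith) (by rw [le_div_iff₀ (by positivity)]; nlinarith) hc (by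
        rw [mul_one_div, div_le_iff₀ (by positivity)]
        have := cpow h0 h1 (c := 44) 12 (by norm_num)
        calc (44:ℝ) ≤ 44 * (δ^18 * M) := by linarith
          _ = (44 * δ^12) * ((δ^2)^2*M*δ^2) := by ring
          _ ≤ 1 * ((δ^2)^2*M*δ^2) := by gcongr
          _ = _ := one_mul _) (by
      intro w hw
      obtain ⟨v, hv, rfl⟩ := mem_image.mp hw
      have := H v (mem_filter.mp hv).2
      rw [le_div_iff₀ (by positivity)]; exact this)
  refine ⟨d, hd, ?_, ?_⟩
  · refine pdown h0 h1 (b := 3) (by norm_num) (by positivity) ?_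
    have : (0:ℝ) ≤ d * δ^2 := by positivity
    calc (d:ℝ) * δ^3 = d*δ^2*δ := by ring
      _ ≤ d * δ^2 * (1/2) := by gcongr
      _ ≤ 1 := by linarith
  · rw [one_div, inv_pow, mul_comm 176 _, ← div_eq_inv_mul, le_div_iff₀ (by positivity)] at hd2
    have := cpow h0 h1 (c := 176) 8 (by norm_num)
    calc nn (d * θ) * M^2 * δ^18 = (nn (d * θ) * M^2 * (δ^2)^3 * (δ^2)^2) * δ^8 := by ring
      _ ≤ 176 * δ^8 := by gcongr
      _ ≤ 1 := this

set_option maxHeartbeats 1000000 in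
lemma weyl {M : ℕ} {δ θ ξ : ℝ} (h0 : 0 < δ) (h1 : δ ≤ 1/2) (hM : 1 ≤ δ^100 * M)
    (h : δ ≤ ‖𝔼 b : Fin M, 𝔼 c : Fin M, ee (θ * ((b:ℕ) + (c:ℕ))^2 + ξ * ((b:ℕ) + (c:ℕ)))‖) :
    ∃ q : ℕ, 0 < q ∧ q * δ^100 ≤ 1 ∧ nn (q * θ) * M^2 * δ^100 ≤ 1 ∧ nn (q * ξ) * M * δ^100 ≤ 1 := by
  have hM0 : (0:ℝ) < M := by
    by_contra hh; push Not at hh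
    nlinarith [pow_pos h0 100]
  have s1 : δ^2 ≤ 𝔼 c' : Fin M, 𝔼 c : Fin M, ‖𝔼 b : Fin M, ee (2 * θ * ((c:ℕ) - (c':ℕ)) * (b:ℕ))‖ := by
    have := cs_dup (fun _ : Fin M => (1:ℂ)) (fun b c : Fin M => ee (θ * ((b:ℕ) + (c:ℕ))^2 + ξ * ((b:ℕ) + (c:ℕ)))) (by simp)
    simp only [one_mul] at this
    calc δ^2 ≤ ‖𝔼 b : Fin M, 𝔼 c : Fin M, ee (θ * ((b:ℕ) + (c:ℕ))^2 + ξ * ((b:ℕ) + (c:ℕ)))‖^2 := by gcongr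
      _ ≤ _ := this
      _ = ‖𝔼 c : Fin M, 𝔼 c' : Fin M, 𝔼 b : Fin M, ee (θ * ((b:ℕ) + (c:ℕ))^2 + ξ * ((b:ℕ) + (c:ℕ))) * conj (ee (θ * ((b:ℕ) + (c':ℕ))^2 + ξ * ((b:ℕ) + (c':ℕ))))‖ := by
        rw [E_comm]; congr 1; exact E_cong fun c => E_comm _
      _ ≤ 𝔼 c : Fin M, 𝔼 c' : Fin M, ‖𝔼 b : Fin M, ee (2 * θ * ((c:ℕ) - (c':ℕ)) * (b:ℕ))‖ := by
        refine (nE_le _).trans (E_mono fun c => (nE_le _).trans (E_mono fun c' => le_of_eq ?_))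
        have : ∀ b : Fin M, ee (θ * ((b:ℕ) + (c:ℕ))^2 + ξ * ((b:ℕ) + (c:ℕ))) * conj (ee (θ * ((b:ℕ) + (c':ℕ))^2 + ξ * ((b:ℕ) + (c':ℕ))))
            = ee (θ * ((c:ℕ)^2 - (c':ℕ)^2) + ξ * ((c:ℕ) - (c':ℕ))) * ee (2 * θ * ((c:ℕ) - (c':ℕ)) * (b:ℕ)) := by
          intro b
          rw [ee_conj, ← ee_add, ← ee_add]; congr 1; ring
        rw [E_cong this, ← mul_expect, norm_mul, ee_norm, one_mul]
      _ = _ := E_commR _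
  obtain ⟨c', hc'⟩ := exists_large s1 (by positivity)
  obtain ⟨d, hd, hd1, hd2⟩ := vinE (δ := δ^2) (θ := 2 * θ) (ξ := - (2 * θ * (c':ℕ))) (by positivity) (pow_half h0 h1 (by norm_num))
    (by rw [← pow_mul]; exact powM h0 h1 (by norm_num) hM) (fun c : Fin M => ‖𝔼 b : Fin M, ee (2 * θ * ((c:ℕ) - (c':ℕ)) * (b:ℕ))‖)
    (fun c => nE_le_one fun b => (ee_norm _).le) hc' (by
      intro w hw
      have g := geo_bound M (2 * θ * ((w:ℕ) - (c':ℕ)))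
      rw [show -(2 * θ * (c':ℕ)) + 2 * θ * ((w:ℕ):ℝ) = 2 * θ * ((w:ℕ) - (c':ℕ)) by ring]
      refine le_trans ?_ g
      rw [mul_comm (_ * _) ((δ^2)^2), mul_comm (nn _)]
      exact mul_le_mul_of_nonneg_right hw (mul_nonneg hM0.le (nn_nonneg _)))
  set p := 2 * d with hp
  have hp0 : 0 < p := by omega
  have hp1 : (p:ℝ) * δ^37 ≤ 1 := by
    rw [hp]; push_cast
    have : (0:ℝ) ≤ d * (δ^2)^18 := by positivity
    calc 2 * (d:ℝ) * δ^37 = 2 * δ * (d * (δ^2)^18) := by ring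
      _ ≤ 1 * (d * (δ^2)^18) := by gcongr; linarith
      _ ≤ 1 := by linarith
  have hp2 : nn (p * θ) * M^2 * δ^36 ≤ 1 := by
    rw [show (p:ℝ) * θ = d * (2 * θ) by rw [hp]; push_cast; ring, show δ^36 = (δ^2)^18 by ring]; exact hd2
  rw [E_comm] at h
  obtain ⟨c, hc⟩ := exists_large (h.trans (nE_le _)) h0
  set J := ⌊δ^80 * M⌋₊ with hJ
  have hJ1 : (J:ℝ) ≤ δ^80 * M := Nat.floor_le (by positivity)
  have hJ2 : δ^81 * M ≤ J := by
    have : δ^80 * M < J + 1 := Nat.lt_floor_add_one _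
    have h3 : 1 ≤ δ^81 * M := powM h0 h1 (by norm_num) hM
    have : δ^81 * M ≤ δ^80 * M * (1/2) := by
      rw [show δ^81 * M = δ^80 * M * δ by ring]; gcongr
    linarith
  have hJ0 : 0 < J := by
    have h3 : 1 ≤ δ^81 * M := powM h0 h1 (by norm_num) hM
    have : (0:ℝ) < J := by linarith
    exact_mod_cast this
  have : Nonempty (Fin J) := ⟨⟨0, hJ0⟩⟩
  have hpJ : (p:ℝ) * J ≤ δ^43 * M := by
    calc (p:ℝ) * J ≤ p * (δ^80 * M) := by gcongr
      _ = (p * δ^37) * (δ^43 * M) := by ring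
      _ ≤ 1 * (δ^43 * M) := by gcongr
      _ = _ := one_mul _
  have sh := shift_avg (M := M) (J := p * J) (S := Fin J) (fun s => p * (s:ℕ)) (fun s => Nat.mul_le_mul_left _ s.2.le)
    (fun b => ee (θ * (b + (c:ℕ))^2 + ξ * (b + (c:ℕ)))) (fun b => (ee_norm _).le)
  have e1 : 2 * ((p * J : ℕ) : ℝ) / M ≤ δ / 4 := by
    rw [div_le_iff₀ hM0]; push_cast
    have : 8 * δ^42 ≤ 1 := cpow h0 h1 _ (by norm_num)
    calc 2 * ((p:ℝ) * J) ≤ 2 * (δ^43 * M) := by gcongr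
      _ = (8 * δ^42) * (δ / 4 * M) := by ring
      _ ≤ 1 * (δ / 4 * M) := by gcongr
      _ = _ := one_mul _
  have s2 : δ / 2 ≤ ‖𝔼 b : Fin M, 𝔼 s : Fin J, ee (θ * ((((b:ℕ) + p * (s:ℕ) : ℕ):ℝ) + (c:ℕ))^2 + ξ * ((((b:ℕ) + p * (s:ℕ) : ℕ):ℝ) + (c:ℕ)))‖ := by
    have := norm_sub_norm_le (𝔼 b : Fin M, ee (θ * ((b:ℕ) + (c:ℕ))^2 + ξ * ((b:ℕ) + (c:ℕ)))) (𝔼 b : Fin M, 𝔼 s : Fin J, ee (θ * ((((b:ℕ) + p * (s:ℕ) : ℕ):ℝ) + (c:ℕ))^2 + ξ * ((((b:ℕ) + p * (s:ℕ) : ℕ):ℝ) + (c:ℕ))))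
    linarith
  obtain ⟨b, hb⟩ := exists_large (s2.trans (nE_le _)) (by positivity)
  set m : ℝ := (b:ℕ) + (c:ℕ) with hm
  have hm2 : m ≤ 2 * M := by
    have h1 : ((b:ℕ):ℝ) ≤ M := by exact_mod_cast b.2.le
    have h2 : ((c:ℕ):ℝ) ≤ M := by exact_mod_cast c.2.le
    linarith
  have s3 : ‖𝔼 s : Fin J, ee (θ * ((((b:ℕ) + p * (s:ℕ) : ℕ):ℝ) + (c:ℕ))^2 + ξ * ((((b:ℕ) + p * (s:ℕ) : ℕ):ℝ) + (c:ℕ)))‖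
      ≤ ‖𝔼 s : Fin J, ee (p * ξ * (s:ℕ))‖ + δ/4 := by
    have e : ∀ s : Fin J, ee (θ * ((((b:ℕ) + p * (s:ℕ) : ℕ):ℝ) + (c:ℕ))^2 + ξ * ((((b:ℕ) + p * (s:ℕ) : ℕ):ℝ) + (c:ℕ)))
       = ee (θ * m^2 + ξ * m) * (ee (p * ξ * (s:ℕ)) + ee (p * ξ * (s:ℕ)) * (ee (((2 * ((b:ℕ)+(c:ℕ)) * (s:ℕ) + p * (s:ℕ)^2 : ℕ) : ℤ) * (p * θ)) - 1)) := by
      intro s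
      rw [mul_sub, mul_one, add_sub_cancel, ← ee_add, ← ee_add]; congr 1; rw [hm]; push_cast; ring
    rw [E_cong e, ← mul_expect, norm_mul, ee_norm, one_mul, expect_add_distrib]
    refine (norm_add_le _ _).trans ?_
    gcongr
    refine (nE_le _).trans (E_le_const (by positivity) fun s => ?_)
    rw [norm_mul, ee_norm, one_mul]
    refine (ee_upper _).trans ?_
    have n1 := nn_int_mul ((2 * ((b:ℕ)+(c:ℕ)) * (s:ℕ) + p * (s:ℕ)^2 : ℕ) : ℤ) (p * θ)
    have hsJ : ((s:ℕ):ℝ) ≤ J := by exact_mod_cast s.2.le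
    have n2 : |((((2 * ((b:ℕ)+(c:ℕ)) * (s:ℕ) + p * (s:ℕ)^2 : ℕ) : ℤ)) : ℝ)| ≤ 5 * δ^80 * M^2 := by
      rw [Int.cast_natCast, Nat.abs_cast]; push_cast
      rw [← hm]
      have : δ^43 ≤ 1 := pow_le_one₀ h0.le (by linarith)
      calc 2 * m * (s:ℕ) + p * ((s:ℕ):ℝ)^2 ≤ 2 * (2 * M) * J + p * (J:ℝ)^2 := by gcongr
        _ = 4 * (M:ℝ) * J + ((p:ℝ) * J) * J := by ring
        _ ≤ 4 * M * (δ^80 * M) + (δ^43 * M) * (δ^80 * M) := by gcongr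
        _ = 4 * δ^80 * M^2 + δ^43 * (δ^80 * M^2) := by ring
        _ ≤ 4 * δ^80 * M^2 + 1 * (δ^80 * M^2) := by gcongr
        _ = _ := by ring
    have n3 := nn_nonneg (p * θ)
    have : 140 * δ^43 ≤ 1 := cpow h0 h1 _ (by norm_num)
    calc 7 * nn (((2 * ((b:ℕ)+(c:ℕ)) * (s:ℕ) + p * (s:ℕ)^2 : ℕ) : ℤ) * (p * θ)) ≤ 7 * ((5 * δ^80 * M^2) * nn (p * θ)) := by
          gcongr; exact n1.trans (by gcongr)
      _ = 35 * δ^44 * (nn (p * θ) * M^2 * δ^36) := by ring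
      _ ≤ 35 * δ^44 * 1 := by gcongr
      _ = (140 * δ^43) * (δ/4) := by ring
      _ ≤ 1 * (δ/4) := by gcongr
      _ = _ := one_mul _
  have s4 : δ^3 ≤ ‖𝔼 s : Fin J, ee (p * ξ * (s:ℕ))‖ := by
    have : δ^3 ≤ δ/4 := by nlinarith [mul_pos h0 h0]
    linarith
  have g := geo_bound J (p * ξ)
  refine ⟨p, hp0, pdown h0 h1 (by norm_num) (by positivity) hp1, pdown h0 h1 (by norm_num) (mul_nonneg (nn_nonneg _) (by positivity)) hp2,
    pdown h0 h1 (b := 84) (by norm_num) (mul_nonneg (nn_nonneg _) hM0.le) ?_⟩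
  have n3 := nn_nonneg (p * ξ)
  calc nn (p * ξ) * M * δ^84 = δ^3 * ((δ^81 * M) * nn (p * ξ)) := by ring
    _ ≤ ‖𝔼 s : Fin J, ee (p * ξ * (s:ℕ))‖ * (J * nn (p * ξ)) := mul_le_mul s4 (mul_le_mul_of_nonneg_right hJ2 n3) (mul_nonneg (mul_nonneg (pow_nonneg h0.le _) hM0.le) n3) (norm_nonneg _)
    _ ≤ 1 := g

def Maj (δ : ℝ) (C M : ℕ) (β : ℝ) : Prop := ∃ q : ℕ, 0 < q ∧ q * δ^C ≤ 1 ∧ nn (q * β) * M^2 * δ^C ≤ 1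

variable {G : Type} [AddCommGroup G] [Fintype G]

def vv {M : ℕ} (z : Fin 3 → Fin M) : ℤ := 1 + ∑ i, ((z i : ℕ) : ℤ)

lemma Pp1 (κ : ℤ →+ G) (M : ℕ) (f0 f1 : G → ℂ) (β : G → ℝ) (b1 : ∀ x, ‖f1 x‖ ≤ 1) {δ : ℝ} (h0 : 0 < δ)
    (h : δ ≤ ‖𝔼 x, 𝔼 y : Y M, f0 x * f1 (x + κ (yy y)) * ee (β x * (yy y)^2)‖) :
    ∃ x : G, ∃ z' : Fin 3 → Fin M, δ^2 ≤ 𝔼 z : Fin 3 → Fin M, ‖f0 (x - κ (vv z))‖ * ‖f0 (x - κ (vv z'))‖ *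
      ‖𝔼 b : Fin M, 𝔼 c : Fin M, ee ((β (x - κ (vv z)) - β (x - κ (vv z'))) * ((b:ℕ) + (c:ℕ))^2
        + (2 * (β (x - κ (vv z)) * vv z - β (x - κ (vv z')) * vv z')) * ((b:ℕ)+(c:ℕ)))‖ := by
  set aa : Fin M × Fin M → ℤ := fun p => (p.1:ℕ) + (p.2:ℕ) with haa
  set F : G × (Fin M × Fin M) → (Fin 3 → Fin M) → ℂ := fun p z => f0 (p.1 - κ (vv z)) * ee (β (p.1 - κ (vv z)) * (aa p.2 + vv z)^2) with hF
  have e : 𝔼 x, 𝔼 y : Y M, f0 x * f1 (x + κ (yy y)) * ee (β x * (yy y)^2)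
      = 𝔼 p : G × (Fin M × Fin M), f1 (p.1 + κ (aa p.2)) * 𝔼 z, F p z := by
    rw [E_prod (α := G) (β := Fin M × Fin M), E_comm, E_comm (α := G)]
    have : ∀ g : Y M → ℂ, 𝔼 y, g y = 𝔼 p : Fin M × Fin M, 𝔼 z, g (p.1, p.2, z) := by
      intro g
      rw [E_prod (α := Fin M) (β := Fin M)]
      unfold Y
      rw [E_prod]
      exact E_cong fun a => E_prod _
    rw [this]
    refine E_cong fun p => ?_
    have e2 : ∀ x : G, f1 (x + κ (aa p)) * 𝔼 z, F (x, p) z = 𝔼 z, f1 (x + κ (aa p)) * F (x, p) z := fun x => mul_expect _ _ _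
    simp only []
    rw [E_cong e2, E_comm (α := G)]
    refine E_cong fun z => ?_
    rw [← E_shift (fun x => f1 (x + κ (aa p)) * F (x, p) z) (κ (vv z))]
    refine E_cong fun x => ?_
    have y1 : yy ((p.1, p.2, z) : Y M) = aa p + vv z := by simp only [yy, aa, vv]; ring
    simp only [hF, y1, add_sub_cancel_right]
    rw [map_add, show x + (κ (aa p) + κ (vv z)) = x + κ (vv z) + κ (aa p) by abel]
    push_cast; ring
  rw [e] at h
  have h2 := cs_dup (fun p : G × (Fin M × Fin M) => f1 (p.1 + κ (aa p.2))) F (fun p => b1 _)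
  have h3 : δ^2 ≤ ‖𝔼 z : G × (Fin M × Fin M), 𝔼 a, 𝔼 a', F z a * conj (F z a')‖ := le_trans (by gcongr) h2
  have h4 : δ^2 ≤ 𝔼 x : G, 𝔼 z' : Fin 3 → Fin M, 𝔼 z : Fin 3 → Fin M, ‖f0 (x - κ (vv z))‖ * ‖f0 (x - κ (vv z'))‖ *
      ‖𝔼 b : Fin M, 𝔼 c : Fin M, ee ((β (x - κ (vv z)) - β (x - κ (vv z'))) * ((b:ℕ) + (c:ℕ))^2
        + (2 * (β (x - κ (vv z)) * vv z - β (x - κ (vv z')) * vv z')) * ((b:ℕ)+(c:ℕ)))‖ := by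
    refine h3.trans ?_
    rw [E_prod (α := G) (β := Fin M × Fin M)]
    refine (nE_le _).trans (E_mono fun x => ?_)
    rw [E_comm, E_commR]
    refine (nE_le _).trans (E_mono fun z => ?_)
    rw [E_comm]
    refine (nE_le _).trans (E_mono fun z' => le_of_eq ?_)
    rw [E_prod (α := Fin M) (β := Fin M)]
    have key : ∀ b c : Fin M, F (x, (b, c)) z * conj (F (x, (b,c)) z') = (f0 (x - κ (vv z)) * conj (f0 (x - κ (vv z'))) *
        ee (β (x - κ (vv z)) * (vv z)^2 - β (x - κ (vv z')) * (vv z')^2)) *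
        ee ((β (x - κ (vv z)) - β (x - κ (vv z'))) * ((b:ℕ) + (c:ℕ))^2
        + (2 * (β (x - κ (vv z)) * vv z - β (x - κ (vv z')) * vv z')) * ((b:ℕ)+(c:ℕ))) := by
      intro b c
      simp only [hF, map_mul, ee_conj]
      have : ee (β (x - κ (vv z)) * (aa (b,c) + vv z)^2) * ee (-(β (x - κ (vv z')) * (aa (b,c) + vv z')^2)) =
          ee (β (x - κ (vv z)) * (vv z)^2 - β (x - κ (vv z')) * (vv z')^2) * ee ((β (x - κ (vv z)) - β (x - κ (vv z'))) * ((b:ℕ) + (c:ℕ))^2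
        + (2 * (β (x - κ (vv z)) * vv z - β (x - κ (vv z')) * vv z')) * ((b:ℕ)+(c:ℕ))) := by
        rw [← ee_add, ← ee_add]; congr 1; simp only [haa]; push_cast; ring
      linear_combination (f0 (x - κ (vv z)) * conj (f0 (x - κ (vv z')))) * this
    simp only [key, ← mul_expect]
    rw [norm_mul, norm_mul, norm_mul, ee_norm, RCLike.norm_conj, mul_one]
  obtain ⟨x, hx⟩ := exists_large h4 (by positivity)
  obtain ⟨z', hz⟩ := exists_large hx (by positivity)
  exact ⟨x, z', hz⟩

lemma vv_le {M : ℕ} (z : Fin 3 → Fin M) : |(vv z : ℝ)| ≤ 3 * M := by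
  have h : ∀ i, ((z i : ℕ):ℝ) ≤ M - 1 := fun i => by
    have : ((z i : ℕ):ℝ) + 1 ≤ M := by exact_mod_cast (z i).2
    linarith
  have h0 : (vv z : ℝ) = 1 + ((z 0:ℕ):ℝ) + ((z 1:ℕ):ℝ) + ((z 2:ℕ):ℝ) := by
    simp only [vv, Fin.sum_univ_three]; push_cast; ring
  rw [h0, abs_of_nonneg (by positivity)]
  linarith [h 0, h 1, h 2]

set_option maxHeartbeats 1000000 in
lemma Pp : ∃ C : ℕ, ∀ (G : Type) [AddCommGroup G] [Fintype G] (κ : ℤ →+ G) (M : ℕ) (δ : ℝ), 0 < δ → δ ≤ 1/2 → 1 ≤ δ^C * M →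
    ∀ (β : G → ℝ) (f0 f1 : G → ℂ), (∀ x, ‖f0 x‖ ≤ 1) → (∀ x, ‖f1 x‖ ≤ 1) →
    δ ≤ ‖𝔼 x, 𝔼 y : Y M, f0 x * f1 (x + κ (yy y)) * ee (β x * (yy y)^2)‖ →
    ∃ x, f0 x ≠ 0 ∧ Maj δ C M (β x) := by
  classical
  obtain ⟨E, hE⟩ : ∃ E : ℕ, E = 406 * 18 := ⟨_, rfl⟩
  refine ⟨E + 406, fun G _ _ κ M δ h0 h1 hM β f0 f1 b0 b1 h => ?_⟩
  have hM0 : (0:ℝ) < M := by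
    by_contra hh; push Not at hh
    nlinarith [pow_pos h0 (E+406)]
  obtain ⟨x, z', hz⟩ := Pp1 κ M f0 f1 β b1 h0 h
  set β' := β (x - κ (vv z')) with hβ'
  rw [E_consR, E_commR] at hz
  obtain ⟨r, hr⟩ := exists_large hz (by positivity)
  set zz : Fin M → Fin 3 → Fin M := fun w => Fin.cons w r with hzz
  set W : Fin M → ℝ := fun w => ‖f0 (x - κ (vv (zz w)))‖ * ‖f0 (x - κ (vv z'))‖ *
      ‖𝔼 b : Fin M, 𝔼 c : Fin M, ee ((β (x - κ (vv (zz w))) - β') * ((b:ℕ) + (c:ℕ))^2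
        + (2 * (β (x - κ (vv (zz w))) * vv (zz w) - β' * vv z')) * ((b:ℕ)+(c:ℕ)))‖ with hW
  have hr : δ^2 ≤ 𝔼 w, W w := hr
  have hx0 : f0 (x - κ (vv z')) ≠ 0 := by
    intro hf
    have : ∀ w, W w = 0 := fun w => by simp only [hW, hf, norm_zero, mul_zero, zero_mul]
    simp only [this, expect_const_zero] at hr
    nlinarith [pow_pos h0 2]
  refine ⟨x - κ (vv z'), hx0, ?_⟩
  rw [← hβ']
  set good : ℕ → Fin M → Prop := fun q w => nn (q * (2 * β' * (vv (zz w) - vv z'))) * M * δ^403 ≤ 1 with hgood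
  have hW1 : ∀ w, W w ≤ 1 := fun w => by
    have := nE_le_one (f := fun b : Fin M => 𝔼 c : Fin M, ee ((β (x - κ (vv (zz w))) - β') * ((b:ℕ) + (c:ℕ))^2
        + (2 * (β (x - κ (vv (zz w))) * vv (zz w) - β' * vv z')) * ((b:ℕ)+(c:ℕ)))) (fun b => nE_le_one fun c => (ee_norm _).le)
    simp only [hW]
    exact mul_le_one₀ (mul_le_one₀ (b0 _) (norm_nonneg _) (b0 _)) (norm_nonneg _) this
  have hgd : ∀ w, δ^4 ≤ W w → ∃ q : ℕ, 0 < q ∧ q * δ^400 ≤ 1 ∧ good q w := by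
    intro w hw
    have hw' : δ^4 ≤ ‖𝔼 b : Fin M, 𝔼 c : Fin M, ee ((β (x - κ (vv (zz w))) - β') * ((b:ℕ) + (c:ℕ))^2
        + (2 * (β (x - κ (vv (zz w))) * vv (zz w) - β' * vv z')) * ((b:ℕ)+(c:ℕ)))‖ := by
      refine hw.trans ?_
      simp only [hW]
      exact mul_le_of_le_one_left (norm_nonneg _) (mul_le_one₀ (b0 _) (norm_nonneg _) (b0 _))
    obtain ⟨q, q0, q1, q2, q3⟩ := weyl (by positivity) (pow_half h0 h1 (by norm_num)) (by
      rw [← pow_mul]; exact powM h0 h1 (by omega) hM) hw'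
    rw [← pow_mul] at q1 q2 q3
    refine ⟨q, q0, q1, ?_⟩
    simp only [hgood]
    set B := β (x - κ (vv (zz w)))
    have e : (q:ℝ) * (2 * β' * (vv (zz w) - vv z')) = q * (2 * (B * vv (zz w) - β' * vv z')) - ((2 * vv (zz w) : ℤ):ℝ) * (q * (B - β')) := by
      push_cast; ring
    have n1 := nn_sub (q * (2 * (B * vv (zz w) - β' * vv z'))) (((2 * vv (zz w) : ℤ):ℝ) * (q * (B - β')))
    rw [← e] at n1
    have n2 := nn_int_mul (2 * vv (zz w)) (q * (B - β'))
    have n3 : |((2 * vv (zz w) : ℤ):ℝ)| ≤ 6 * M := by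
      push_cast; rw [abs_mul, abs_two]; linarith [vv_le (zz w)]
    have n4 := nn_nonneg (q * (B - β'))
    have n5 := nn_nonneg (q * (2 * (B * vv (zz w) - β' * vv z')))
    have c7 : 7 * δ^3 ≤ 1 := cpow h0 h1 _ (by norm_num)
    have n6 : nn (q * (2 * β' * (vv (zz w) - vv z'))) ≤ nn (q * (2 * (B * vv (zz w) - β' * vv z'))) + 6 * M * nn (q * (B - β')) :=
      n1.trans (by gcongr; exact n2.trans (by gcongr))
    calc nn (q * (2 * β' * (vv (zz w) - vv z'))) * M * δ^403
       ≤ (nn (q * (2 * (B * vv (zz w) - β' * vv z'))) + 6 * M * nn (q * (B - β'))) * M * δ^403 := by gcongr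
      _ = (nn (q * (2 * (B * vv (zz w) - β' * vv z'))) * M * δ^(4*100) + 6 * (nn (q * (B - β')) * M^2 * δ^(4*100))) * δ^3 := by ring
      _ ≤ (1 + 6 * 1) * δ^3 := by gcongr
      _ = 7 * δ^3 := by ring
      _ ≤ 1 := c7
  set Qm := ⌊1/δ^400⌋₊ with hQm
  have hQm1 : (Qm:ℝ) * δ^400 ≤ 1 := by
    have := Nat.floor_le (a := 1/δ^400) (by positivity)
    rwa [le_div_iff₀ (by positivity)] at this
  have hpig : ∃ q ∈ Icc 1 Qm, δ^403 ≤ 𝔼 w, if good q w then (1:ℝ) else 0 := by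
    by_contra hcon
    push Not at hcon
    have p1 : ∀ w, W w ≤ δ^4 + ∑ q ∈ Icc 1 Qm, if good q w then (1:ℝ) else 0 := by
      intro w
      have hnn : ∀ q ∈ Icc 1 Qm, (0:ℝ) ≤ if good q w then (1:ℝ) else 0 := fun q _ => by split_ifs <;> norm_num
      by_cases hw : δ^4 ≤ W w
      · obtain ⟨q, q0, q1, q2⟩ := hgd w hw
        have := single_le_sum hnn (a := q) (mem_Icc.mpr ⟨q0, Nat.le_floor (by rw [le_div_iff₀ (by positivity)]; exact q1)⟩)
        rw [if_pos q2] at this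
        have := hW1 w
        have : 0 < δ^4 := by positivity
        linarith
      · push Not at hw
        have := sum_nonneg hnn
        linarith
    have p2 : δ^2 ≤ δ^4 + Qm * δ^403 := by
      have : Nonempty (Fin M) := ⟨⟨0, by exact_mod_cast hM0⟩⟩
      refine (hr.trans (E_mono p1)).trans ?_
      rw [expect_add_distrib, E_constR, expect_sum_comm]
      gcongr
      calc _ ≤ ∑ q ∈ Icc 1 Qm, δ^403 := sum_le_sum fun q hq => (hcon q hq).le
        _ = _ := by rw [sum_const, Nat.card_Icc, nsmul_eq_mul]; simp
    have : (Qm:ℝ) * δ^403 ≤ δ^3 := by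
      calc (Qm:ℝ) * δ^403 = (Qm * δ^400) * δ^3 := by ring
        _ ≤ 1 * δ^3 := by gcongr
        _ = _ := one_mul _
    have : δ^4 + δ^3 < δ^2 := by
      have : 0 < δ^2 := by positivity
      calc δ^4 + δ^3 = δ^2 * (δ^2 + δ) := by ring
        _ < δ^2 * 1 := by gcongr; nlinarith
        _ = _ := mul_one _
    linarith
  obtain ⟨q, hq, hqE⟩ := hpig
  rw [mem_Icc] at hq
  have hε : δ^406 ≤ δ^403 := pmono h0 h1 (by norm_num)
  obtain ⟨d, d0, d1, d2⟩ := vinE (δ := δ^406) (θ := q * (2 * β')) (ξ := q * (2 * β') * (vv (zz ⟨0, by exact_mod_cast hM0⟩) - vv z')) (by positivity)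
    (pow_half h0 h1 (by norm_num)) (by rw [← pow_mul, ← hE]; exact powM h0 h1 (by omega) hM) (fun w => if good q w then (1:ℝ) else 0)
    (fun w => by split_ifs <;> norm_num) (hε.trans hqE) (by
      intro w hw
      have hg : good q w := by
        by_contra hg
        rw [if_neg hg] at hw
        nlinarith [pow_pos (pow_pos h0 406) 2]
      have : (vv (zz w) : ℝ) = vv (zz ⟨0, by exact_mod_cast hM0⟩) + ((w:ℕ):ℝ) := by
        simp only [vv, hzz, Fin.sum_univ_succ, Fin.cons_zero, Fin.cons_succ]; push_cast; ring
      rw [show (q:ℝ) * (2 * β') * (vv (zz ⟨0, by exact_mod_cast hM0⟩) - vv z') + q * (2 * β') * ((w:ℕ):ℝ) = q * (2 * β' * (vv (zz w) - vv z')) by rw [this]; ring]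
      rw [← pow_mul]
      exact pdown h0 h1 (by norm_num) (mul_nonneg (nn_nonneg _) hM0.le) hg)
  rw [← pow_mul, ← hE] at d1 d2
  have q1 : (q:ℝ) * δ^400 ≤ 1 := le_trans (by gcongr; exact hq.2) hQm1
  refine ⟨2 * q * d, by have := hq.1; positivity, ?_, ?_⟩
  · refine pdown h0 h1 (b := E + 401) (by omega) (by positivity) ?_
    push_cast
    calc 2 * (q:ℝ) * d * δ^(E+401) = (2 * δ) * ((q * δ^400) * (d * δ^E)) := by ring
      _ ≤ 1 * (1 * 1) := by gcongr; linarith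
      _ = 1 := by norm_num
  · refine pdown h0 h1 (b := E) (by omega) (mul_nonneg (nn_nonneg _) (by positivity)) ?_
    rw [show ((2 * q * d : ℕ):ℝ) * β' = d * (q * (2 * β')) by push_cast; ring]
    exact d2

open Classical in
lemma Pq : ∃ C : ℕ, ∀ (G : Type) [AddCommGroup G] [Fintype G] (κ : ℤ →+ G) (M : ℕ) (δ : ℝ), 0 < δ → δ ≤ 1/2 → 1 ≤ δ^C * M →
    ∀ (β : G → ℝ) (f0 f1 : G → ℂ), (∀ x, ‖f0 x‖ ≤ 1) → (∀ x, ‖f1 x‖ ≤ 1) →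
    ‖𝔼 x, 𝔼 y : Y M, f0 x * f1 (x + κ (yy y)) * ee (β x * (yy y)^2)‖ ≤
      δ + 𝔼 x, ‖f0 x‖ * (if Maj δ C M (β x) then 1 else 0) := by
  obtain ⟨C, hC⟩ := Pp
  refine ⟨C, fun G _ _ κ M δ h0 h1 hM β f0 f1 b0 b1 => ?_⟩
  set g : G → ℂ := fun x => if Maj δ C M (β x) then 0 else f0 x with hg
  set g' : G → ℂ := fun x => if Maj δ C M (β x) then f0 x else 0 with hg'
  have e : ∀ x, f0 x = g x + g' x := fun x => by simp only [hg, hg']; split_ifs <;> simp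
  have h2 : 𝔼 x, 𝔼 y : Y M, f0 x * f1 (x + κ (yy y)) * ee (β x * (yy y)^2) =
      𝔼 x, 𝔼 y : Y M, g x * f1 (x + κ (yy y)) * ee (β x * (yy y)^2) + 𝔼 x, 𝔼 y : Y M, g' x * f1 (x + κ (yy y)) * ee (β x * (yy y)^2) := by
    simp only [← expect_add_distrib]
    refine E_cong fun x => E_cong fun y => ?_
    rw [e]; ring
  rw [h2]
  refine (norm_add_le _ _).trans (add_le_add ?_ ?_)
  · by_contra hcon
    push Not at hcon
    obtain ⟨x, hx, hx2⟩ := hC G κ M δ h0 h1 hM β g f1 (fun x => by simp only [hg]; split_ifs; · simp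
                                                                   · exact b0 x) b1 hcon.le
    exact hx (by simp only [hg, if_pos hx2])
  · refine (nE_le _).trans (E_mono fun x => (nE_le _).trans ?_)
    refine E_le_const (by split_ifs <;> simp) fun y => ?_
    rw [norm_mul, norm_mul, ee_norm, mul_one]
    simp only [hg']
    split_ifs
    · rw [mul_one]; exact mul_le_of_le_one_right (norm_nonneg _) (b1 _)
    · simp

section st
variable {L : ℕ} [NeZero L]

noncomputable def st (t : ZMod L) : ℂ := ZMod.stdAddChar t

lemma st_add (a b : ZMod L) : st (a + b) = st a * st b := AddChar.map_add_eq_mul _ _ _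
lemma st_zero : st (0 : ZMod L) = 1 := AddChar.map_zero_eq_one _
lemma st_norm (a : ZMod L) : ‖st a‖ = 1 := AddChar.norm_apply _ _
lemma st_conj (a : ZMod L) : conj (st a) = st (-a) := by
  rw [st, st, AddChar.map_neg_eq_conj]
lemma st_ee (t : ZMod L) (a : ℤ) : st (t * (a : ZMod L)) = ee (t.val / L * a) := by
  have : t * (a : ZMod L) = ((t.val * a : ℤ) : ZMod L) := by
    push_cast; rw [ZMod.natCast_zmod_val]
  rw [this, st, ZMod.stdAddChar_coe, ee]
  congr 1; push_cast; ring

lemma parseval (u : ZMod L → ℂ) : ∑ t : ZMod L, ‖𝔼 n, u n * st (t * n)‖^2 = 𝔼 n, ‖u n‖^2 := by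
  have hL : (L:ℂ) ≠ 0 := by exact_mod_cast NeZero.ne L
  have : ((∑ t : ZMod L, ‖𝔼 n, u n * st (t * n)‖^2 : ℝ) : ℂ) = ((𝔼 n, ‖u n‖^2 : ℝ) : ℂ) := by
    rw [Complex.ofReal_sum, ofReal_E]
    simp only [sq_expect]
    have e : ∀ t a a' : ZMod L, u a * st (t * a) * conj (u a' * st (t * a')) = u a * conj (u a') * st (t * (a - a')) := by
      intro t a a'
      rw [map_mul, st_conj, mul_sub, sub_eq_add_neg, st_add]; ring
    simp only [e]
    rw [← expect_sum_comm]
    refine E_cong fun a => ?_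
    rw [← expect_sum_comm]
    have e2 : ∀ a' : ZMod L, ∑ t : ZMod L, u a * conj (u a') * st (t * (a - a')) = if a' = a then (L:ℂ) * (u a * conj (u a)) else 0 := by
      intro a'
      rw [← mul_sum]
      have := AddChar.sum_mulShift (a - a') (ZMod.isPrimitive_stdAddChar L)
      have h2 : ∑ t : ZMod L, st (t * (a - a')) = if a - a' = 0 then (Fintype.card (ZMod L) : ℂ) else 0 := by
        refine this.trans ?_; split_ifs <;> simp
      rw [h2, ZMod.card]
      by_cases h : a' = a
      · subst h; simp; ring
      · rw [if_neg h, if_neg (sub_ne_zero.mpr (Ne.symm h)), mul_zero]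
    rw [E_cong e2, Fintype.expect_eq_sum_div_card, sum_ite_eq' univ a, if_pos (mem_univ _), ZMod.card]
    rw [mul_div_cancel_left₀ _ hL, Complex.mul_conj, Complex.normSq_eq_norm_sq]
  exact_mod_cast this

lemma U2inv (u : ZMod L → ℂ) (hu : ∀ n, ‖u n‖ ≤ 1) :
    ∃ t : ZMod L, 𝔼 m, ‖𝔼 n, u (n + m) * conj (u n)‖^2 ≤ ‖𝔼 n, u n * st (t * n)‖^2 := by
  set w : ZMod L → ℝ := fun t => ‖𝔼 n, u n * st (t * n)‖^2 with hw
  obtain ⟨t, -, ht⟩ := exists_max_image (univ : Finset (ZMod L)) w univ_nonempty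
  refine ⟨t, ?_⟩
  rw [← parseval]
  have e : ∀ s : ZMod L, ‖𝔼 m, (𝔼 n, u (n + m) * conj (u n)) * st (s * m)‖^2 = w s ^ 2 := by
    intro s
    have : 𝔼 m, (𝔼 n, u (n + m) * conj (u n)) * st (s * m) = (w s : ℂ) := by
      simp only [hw]
      rw [sq_expect, E_comm]
      simp only [expect_mul]
      rw [E_comm]
      refine E_cong fun n => ?_
      rw [← E_shift (fun a => u a * st (s * a) * conj (u n * st (s * n))) n]
      refine E_cong fun m => ?_
      rw [map_mul, st_conj, mul_add, st_add, add_comm m n]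
      have : st (s * n) * st (-(s*n)) = 1 := by rw [← st_add, add_neg_cancel, st_zero]
      linear_combination (-(u (n + m) * conj (u n) * st (s * m))) * this
    rw [this, Complex.norm_real, Real.norm_eq_abs, sq_abs]
  simp only [e]
  have hp := parseval u
  calc ∑ s, w s ^ 2 ≤ ∑ s, w t * w s := by
        refine sum_le_sum fun s _ => ?_
        rw [pow_two]
        exact mul_le_mul_of_nonneg_right (ht s (mem_univ _)) (by positivity)
    _ = w t * ∑ s, w s := by rw [mul_sum]
    _ ≤ w t * 1 := by
        refine mul_le_mul_of_nonneg_left ?_ (by positivity)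
        rw [hp]
        exact E_le_const zero_le_one fun n => pow_le_one₀ (norm_nonneg _) (hu n)
    _ = _ := mul_one _

lemma V1inv {G : Type} [AddCommGroup G] [Fintype G] (ι : ZMod L →+ G) (g : G → ℂ) (hg : ∀ x, ‖g x‖ ≤ 1) :
    ∃ φ : G → ZMod L, V ι 1 g ≤ 𝔼 x, ‖𝔼 n, g (x + ι n) * st (φ x * n)‖^2 := by
  choose φ hφ using fun x : G => U2inv (fun n => g (x + ι n)) (fun n => hg _)
  refine ⟨φ, ?_⟩
  rw [V_succ]
  simp only [V_zero]
  rw [E_commR]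
  refine E_mono fun x => le_trans (le_of_eq ?_) (hφ x)
  refine E_congR fun m => ?_
  congr 2
  refine E_cong fun n => ?_
  rw [map_add, add_assoc]

end st

section Dd
variable {G H : Type} [AddCommGroup G] [Fintype G] [AddCommGroup H] [Fintype H]

noncomputable def D (ι : H →+ G) : (k : ℕ) → (Fin k → H) → (G → ℂ) → G → ℂ
  | 0, _, g => g
  | k+1, h, g => D ι k (Fin.tail h) (fun x => g (x + ι (h 0)) * conj (g x))

lemma V_iter (ι : H →+ G) (s k : ℕ) (g : G → ℂ) : V ι (s + k) g = 𝔼 h : Fin k → H, V ι s (D ι k h g) := by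
  induction k generalizing g with
  | zero => rw [E_uniqR]; rfl
  | succ k ih =>
    rw [← add_assoc, V_succ, E_consR]
    refine E_congR fun m => ?_
    rw [ih]
    refine E_congR fun h => ?_
    simp only [D, Fin.cons_zero, Fin.tail_cons]

lemma D_decomp (ι : H →+ G) (k : ℕ) (g : G → ℂ) (hg : ∀ x, ‖g x‖ ≤ 1) :
    ∃ b : Fin k → (Fin k → H) → G → ℂ, (∀ i h x, ‖b i h x‖ ≤ 1) ∧ (∀ i h a x, b i (Function.update h i a) x = b i h x) ∧
      ∀ h x, D ι k h g x = g (x + ι (∑ i, h i)) * ∏ i, b i h x := by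
  induction k generalizing g with
  | zero => exact ⟨fun i => i.elim0, fun i => i.elim0, fun i => i.elim0, fun h x => by simp [D]⟩
  | succ k ih =>
    choose b hb1 hb2 hb3 using fun m : H => ih (fun x => g (x + ι m) * conj (g x)) (fun x => norm_mul_conj_le (hg _) (hg _))
    refine ⟨Fin.cons (fun h x => conj (g (x + ι (∑ i, Fin.tail h i)))) (fun i h x => b (h 0) i (Fin.tail h) x), ?_, ?_, ?_⟩
    · intro i
      refine Fin.cases ?_ ?_ i
      · intro h x; simp only [Fin.cons_zero, RCLike.norm_conj]; exact hg _
      · intro i h x; simp only [Fin.cons_succ]; exact hb1 _ _ _ _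
    · intro i
      refine Fin.cases ?_ ?_ i
      · intro h a x; simp only [Fin.cons_zero, Fin.tail_update_zero]
      · intro i h a x
        simp only [Fin.cons_succ, Fin.tail_update_succ, hb2]
        rw [Function.update_of_ne (Fin.succ_ne_zero i).symm]
    · intro h x
      simp only [D]
      rw [hb3, Fin.prod_univ_succ, Fin.sum_univ_succ]
      simp only [Fin.cons_zero, Fin.cons_succ, Fin.tail]
      rw [map_add, add_assoc, add_comm (ι (∑ i, h (Fin.succ i))) (ι (h 0))]
      ring

lemma D_le_one (ι : H →+ G) (k : ℕ) (h : Fin k → H) (g : G → ℂ) (hg : ∀ x, ‖g x‖ ≤ 1) (x : G) : ‖D ι k h g x‖ ≤ 1 := by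
  induction k generalizing g with
  | zero => exact hg x
  | succ k ih => exact ih _ _ fun x => norm_mul_conj_le (hg _) (hg _)
end Dd

section cubes
variable {H : Type}

lemma cube_mul (k : ℕ) (Ψ Φ : (Fin k → H) → ℂ) (h h') : cube k (fun t => Ψ t * Φ t) h h' = cube k Ψ h h' * cube k Φ h h' := by
  induction k with
  | zero => rfl
  | succ k ih =>
    simp only [cube]
    rw [← ih]; congr 1; funext t; simp only [map_mul]; ring

lemma cube_le (k : ℕ) (Ψ : (Fin k → H) → ℂ) (hΨ : ∀ t, ‖Ψ t‖ ≤ 1) (h h') : ‖cube k Ψ h h'‖ ≤ ‖Ψ h'‖ := by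
  induction k with
  | zero => simp only [cube]; rw [Subsingleton.elim h h']
  | succ k ih =>
    simp only [cube]
    refine (ih _ (fun t => norm_mul_conj_le (hΨ _) (hΨ _)) _ _).trans ?_
    rw [norm_mul, RCLike.norm_conj, Fin.cons_self_tail]
    exact mul_le_of_le_one_left (norm_nonneg _) (hΨ _)

lemma cube_le_one (k : ℕ) (Ψ : (Fin k → H) → ℂ) (hΨ : ∀ t, ‖Ψ t‖ ≤ 1) (h h') : ‖cube k Ψ h h'‖ ≤ 1 :=
  (cube_le k Ψ hΨ h h').trans (hΨ _)

variable {A : Type} [AddCommGroup A]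
def sq : (k : ℕ) → ((Fin k → H) → A) → (Fin k → H) → (Fin k → H) → A
  | 0, φ, h, _ => φ h
  | k+1, φ, h, h' => sq k (fun t => φ (Fin.cons (h 0) t) - φ (Fin.cons (h' 0) t)) (Fin.tail h) (Fin.tail h')

lemma sq_sub (k : ℕ) (φ ψ : (Fin k → H) → A) (h h') : sq k (fun t => φ t - ψ t) h h' = sq k φ h h' - sq k ψ h h' := by
  induction k with
  | zero => rfl
  | succ k ih =>
    simp only [sq]
    rw [← ih]; congr 1; funext t; abel

lemma cube_st {L : ℕ} [NeZero L] (k : ℕ) (φ : (Fin k → H) → ZMod L) (n : ZMod L) (h h') :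
    cube k (fun t => st (φ t * n)) h h' = st (sq k φ h h' * n) := by
  induction k with
  | zero => rfl
  | succ k ih =>
    simp only [cube, sq]
    rw [← ih]; congr 1; funext t
    rw [st_conj, ← st_add]; congr 1; ring

lemma sq_decomp (k : ℕ) (φ : (Fin k → H) → A) : ∃ ψ : Fin k → (Fin k → H) → (Fin k → H) → A,
    (∀ i h h' a, ψ i h (Function.update h' i a) = ψ i h h') ∧
    ∀ h h', sq k φ h h' = (-1 : ℤ)^k • φ h' + ∑ i, ψ i h h' := by
  induction k with
  | zero => exact ⟨fun i => i.elim0, fun i => i.elim0, fun h h' => by simp [sq, Subsingleton.elim h h']⟩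
  | succ k ih =>
    choose ψ h1 h2 using fun m : H => ih (fun t => φ (Fin.cons m t))
    refine ⟨Fin.cons (fun h h' => sq k (fun t => φ (Fin.cons (h 0) t)) (Fin.tail h) (Fin.tail h'))
      (fun i h h' => - ψ (h' 0) i (Fin.tail h) (Fin.tail h')), ?_, ?_⟩
    · intro i
      refine Fin.cases ?_ ?_ i
      · intro h h' a; simp only [Fin.cons_zero, Fin.tail_update_zero]
      · intro i h h' a
        simp only [Fin.cons_succ, Fin.tail_update_succ, h1]
        rw [Function.update_of_ne (Fin.succ_ne_zero i).symm]
    · intro h h'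
      simp only [sq]
      rw [sq_sub, h2 (h' 0), Fin.sum_univ_succ]
      simp only [Fin.cons_zero, Fin.cons_succ, Fin.cons_self_tail, sum_neg_distrib, pow_succ]
      rw [mul_neg_one, neg_smul]; abel
end cubes

lemma countMaj {M L C : ℕ} [NeZero L] (hL : L = 200 * M^2) {δ : ℝ} (h0 : 0 < δ) (h1 : δ ≤ 1/2) (T : Finset (ZMod L))
    (hT : ∀ t ∈ T, Maj δ C M (t.val / L)) : (#T : ℝ) * δ^(3*C+11) ≤ 1 := by
  classical
  have hL0 : (0:ℝ) < L := by exact_mod_cast Nat.pos_of_ne_zero (NeZero.ne L)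
  have hX : 0 < δ^C := by positivity
  set X := 1/δ^C with hXd
  have hX1 : 1 ≤ X := by
    rw [hXd, le_div_iff₀ hX, one_mul]; exact pow_le_one₀ h0.le (by linarith)
  set Q := ⌊X⌋₊
  set R := ⌊200 * X⌋₊
  have hQ : (Q:ℝ) ≤ X := Nat.floor_le (by positivity)
  have hR : (R:ℝ) ≤ 200 * X := Nat.floor_le (by positivity)
  choose! q q0 q1 q2 using hT
  have hinj : #T ≤ #(range (Q+1) ×ˢ (Icc (-(R:ℤ)) R ×ˢ Icc (0:ℤ) Q)) := by
    refine card_le_card_of_injOn (fun t => (q t, ((q t * t.val : ℕ) : ℤ) - L * round ((q t : ℝ) * (t.val / L)), round ((q t : ℝ) * (t.val / L)))) ?_ ?_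
    · intro t ht
      have b1 : q t ≤ Q := Nat.le_floor (by rw [hXd, le_div_iff₀ hX]; exact q1 t ht)
      have b2 : |(((q t * t.val : ℕ) : ℤ) - L * round ((q t : ℝ) * (t.val / L)) : ℝ)| ≤ 200 * X := by
        have e : (((q t * t.val : ℕ) : ℤ) - L * round ((q t : ℝ) * (t.val / L)) : ℝ) = L * ((q t : ℝ) * (t.val / L) - round ((q t : ℝ) * (t.val / L))) := by
          push_cast; field_simp
        rw [e, abs_mul, abs_of_pos hL0]
        have := q2 t ht
        change L * nn ((q t : ℝ) * (t.val / L)) ≤ _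
        rw [hXd, mul_one_div, le_div_iff₀ hX]
        have hLr : (L:ℝ) = 200 * M^2 := by rw [hL]; push_cast; ring
        calc (L:ℝ) * nn ((q t : ℝ) * (t.val / L)) * δ^C = 200 * (nn ((q t : ℝ) * (t.val / L)) * M^2 * δ^C) := by
              rw [show (L:ℝ) * nn ((q t : ℝ) * (t.val / L)) = 200 * M^2 * nn ((q t : ℝ) * (t.val / L)) by rw [← hLr]]; ring
          _ ≤ 200 * 1 := by gcongr
          _ = 200 := by norm_num
      have b3 : (t.val : ℝ) / L ≤ 1 := by
        rw [div_le_one hL0]; exact_mod_cast (ZMod.val_lt t).le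
      have b4 : round ((q t : ℝ) * (t.val / L)) ≤ Q := by
        have : (q t : ℝ) * (t.val / L) ≤ q t := mul_le_of_le_one_right (by positivity) b3
        have h3 : round ((q t : ℝ) * (t.val / L)) ≤ round (q t : ℝ) := by
          rw [round_eq, round_eq]; gcongr
        rw [round_natCast] at h3
        exact h3.trans (by exact_mod_cast b1)
      have b5 : 0 ≤ round ((q t : ℝ) * (t.val / L)) := by
        rw [round_eq]; positivity
      have b6 : |((q t * t.val : ℕ) : ℤ) - L * round ((q t : ℝ) * (t.val / L))| ≤ R := by
        have : |((q t * t.val : ℕ) : ℤ) - L * round ((q t : ℝ) * (t.val / L))| = ((|((q t * t.val : ℕ) : ℤ) - L * round ((q t : ℝ) * (t.val / L))|.toNat : ℕ):ℤ) :=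
          (Int.toNat_of_nonneg (abs_nonneg _)).symm
        rw [this]
        have : |((q t * t.val : ℕ) : ℤ) - L * round ((q t : ℝ) * (t.val / L))|.toNat ≤ R := by
          refine Nat.le_floor ?_
          have h5 : ((|((q t * t.val : ℕ) : ℤ) - L * round ((q t : ℝ) * (t.val / L))|.toNat : ℕ) : ℝ) = (((|((q t * t.val : ℕ) : ℤ) - L * round ((q t : ℝ) * (t.val / L))|.toNat : ℕ):ℤ) : ℝ) := by rw [Int.cast_natCast]
          rw [h5, ← this, Int.cast_abs]
          refine le_trans (le_of_eq ?_) b2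
          push_cast; rfl
        exact_mod_cast this
      simp only [coe_product, Set.mem_prod, mem_coe, mem_range, mem_Icc]
      exact ⟨by omega, abs_le.mp b6, b5, b4⟩
    · intro t ht t' ht' e
      simp only [Prod.mk.injEq] at e
      obtain ⟨e1, e2, e3⟩ := e
      rw [← e3, ← e1] at e2
      have e2 : ((q t * t.val : ℕ):ℤ) = (q t * t'.val : ℕ) := by linarith
      have e2 : q t * t.val = q t * t'.val := by exact_mod_cast e2
      exact ZMod.val_injective L (Nat.eq_of_mul_eq_mul_left (q0 t ht) e2)
  rw [card_product, card_product, card_range, Int.card_Icc, Int.card_Icc] at hinj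
  have e1 : ((R:ℤ) + 1 - -(R:ℤ)).toNat = 2 * R + 1 := by omega
  have e2 : ((Q:ℤ) + 1 - 0).toNat = Q + 1 := by omega
  rw [e1, e2] at hinj
  have h3 : (#T : ℝ) ≤ (Q+1) * ((2 * R + 1) * (Q + 1)) := by exact_mod_cast hinj
  have h4 : (#T : ℝ) ≤ 1700 * X^3 := by
    calc (#T : ℝ) ≤ (Q+1) * ((2 * R + 1) * (Q + 1)) := h3
      _ ≤ (X + X) * ((2 * (200 * X) + X) * (X + X)) := by gcongr
      _ = 1604 * X^3 := by ring
      _ ≤ 1700 * X^3 := by gcongr; norm_num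
  have c := cpow h0 h1 (c := 1700) 11 (by norm_num)
  have hXX : X * δ^C = 1 := by rw [hXd]; field_simp
  calc (#T : ℝ) * δ^(3*C+11) ≤ 1700 * X^3 * δ^(3*C+11) := by gcongr
    _ = 1700 * δ^11 * (X * δ^C)^3 := by rw [pow_add, pow_mul' δ 3 C]; ring
    _ ≤ 1 := by rw [hXX]; simpa using c

variable {G : Type} [AddCommGroup G] [Fintype G]

noncomputable def FF {L : ℕ} (ι : ZMod L →+ G) (κ : ℤ →+ G) (M : ℕ) (f0 f1 : G → ℂ) (x : G) : ℂ :=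
  𝔼 y : Y M, f0 (x - ι ((yy y)^2 : ℤ)) * f1 (x - ι ((yy y)^2 : ℤ) + κ (yy y))

lemma FF_le {L : ℕ} (ι : ZMod L →+ G) (κ : ℤ →+ G) (M : ℕ) (f0 f1 : G → ℂ) (b0 : ∀ x, ‖f0 x‖ ≤ 1) (b1 : ∀ x, ‖f1 x‖ ≤ 1) (x : G) :
   ‖FF ι κ M f0 f1 x‖ ≤ 1 := nE_le_one fun y => norm_mul_le1 (b0 _) (b1 _)

lemma stepC {L : ℕ} [NeZero L] (ι : ZMod L →+ G) (j : ℕ) (F : G → ℂ) (hF : ∀ x, ‖F x‖ ≤ 1)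
    (ψ : Fin (j+1) → G → (Fin (j+1) → ZMod L) → ZMod L) (hψ : ∀ i x h a, ψ i x (Function.update h i a) = ψ i x h) :
    (𝔼 x, 𝔼 h, ‖𝔼 n, D ι (j+1) h F (x + ι n) * st ((∑ i, ψ i x h) * n)‖^2)^(2^(j+1)) ≤ V ι (j+1) F := by
  obtain ⟨b, hb1, hb2, hb3⟩ := D_decomp ι (j+1) F hF
  have key := boxG (J := ZMod L) (P := ZMod L × ZMod L) j (fun _ _ => ι) (fun p x => F (x + ι p.2) * conj (F x))
    (fun i p x h => b i h (x + ι p.2) * conj (b i h x) * st (ψ i (x - ι p.1) h * p.2)) (fun i p x h => by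
      rw [norm_mul, st_norm, mul_one]; exact norm_mul_conj_le (hb1 _ _ _) (hb1 _ _ _)) (fun i p x h a => by
      simp only [hb2, hψ])
  have e1 : 𝔼 p : ZMod L × ZMod L, bx j (fun _ => (ι : ZMod L → G)) (fun x => F (x + ι p.2) * conj (F x)) = V ι (j+1) F := by
    rw [E_prodR, V_succ]; exact E_constR (α := ZMod L) (𝔼 m, V ι j fun x => F (x + ι m) * conj (F x))
  rw [e1] at key
  refine le_trans (le_of_eq ?_) key
  congr 1
  have e2 : ∀ (x : G) (h : Fin (j+1) → ZMod L), ((‖𝔼 n, D ι (j+1) h F (x + ι n) * st ((∑ i, ψ i x h) * n)‖^2 : ℝ) : ℂ)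
      = 𝔼 n, 𝔼 m, (D ι (j+1) h F (x + ι n + ι m) * conj (D ι (j+1) h F (x + ι n))) * st ((∑ i, ψ i x h) * m) := by
    intro x h
    rw [sq_expect, E_comm]
    refine E_cong fun n => ?_
    rw [← E_shift (fun a => D ι (j+1) h F (x + ι a) * st ((∑ i, ψ i x h) * a) * conj (D ι (j+1) h F (x + ι n) * st ((∑ i, ψ i x h) * n))) n]
    refine E_cong fun m => ?_
    rw [map_mul, st_conj, mul_add, st_add, map_add, add_comm (ι m), ← add_assoc]
    have : st ((∑ i, ψ i x h) * n) * st (-((∑ i, ψ i x h) * n)) = 1 := by rw [← st_add, add_neg_cancel, st_zero]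
    linear_combination (D ι (j+1) h F (x + ι n + ι m) * conj (D ι (j+1) h F (x + ι n)) * st ((∑ i, ψ i x h) * m)) * this
  have e3 : ((𝔼 x, 𝔼 h, ‖𝔼 n, D ι (j+1) h F (x + ι n) * st ((∑ i, ψ i x h) * n)‖^2 : ℝ) : ℂ) =
     𝔼 p : ZMod L × ZMod L, 𝔼 x, 𝔼 h : Fin (j+1) → ZMod L, (F (x + ∑ i, ι (h i) + ι p.2) * conj (F (x + ∑ i, ι (h i)))) * ∏ i, (b i h (x + ι p.2) * conj (b i h x) * st (ψ i (x - ι p.1) h * p.2)) := by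
    rw [ofReal_E]
    simp only [ofReal_E, e2]
    rw [E_prod]
    have r1 : ∀ x : G, 𝔼 h : Fin (j+1) → ZMod L, 𝔼 n, 𝔼 m, (D ι (j+1) h F (x + ι n + ι m) * conj (D ι (j+1) h F (x + ι n))) * st ((∑ i, ψ i x h) * m)
       = 𝔼 n, 𝔼 m, 𝔼 h : Fin (j+1) → ZMod L, (D ι (j+1) h F (x + ι n + ι m) * conj (D ι (j+1) h F (x + ι n))) * st ((∑ i, ψ i x h) * m) := by
      intro x; rw [E_comm]; exact E_cong fun n => E_comm _
    rw [E_cong r1, E_comm]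
    refine E_cong fun n => ?_
    rw [E_comm]
    refine E_cong fun m => ?_
    rw [← E_shift (fun x => 𝔼 h : Fin (j+1) → ZMod L, (D ι (j+1) h F (x + ι n + ι m) * conj (D ι (j+1) h F (x + ι n))) * st ((∑ i, ψ i x h) * m)) (-ι n)]
    refine E_cong fun x => E_cong fun h => ?_
    simp only [← sub_eq_add_neg, sub_add_cancel]
    rw [hb3, hb3, prod_mul_distrib, prod_mul_distrib, map_mul, map_prod, map_sum]
    have : st ((∑ i, ψ i (x - ι n) h) * m) = ∏ i, st (ψ i (x - ι n) h * m) := by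
      rw [sum_mul]
      induction (univ : Finset (Fin (j+1))) using Finset.induction_on with
      | empty => simp [st_zero]
      | insert i s hi ih => rw [sum_insert hi, prod_insert hi, st_add, ih]
    rw [this, show x + ι m + ∑ i, ι (h i) = x + ∑ i, ι (h i) + ι m by abel]
    ring
  have e4 : 0 ≤ 𝔼 x, 𝔼 h, ‖𝔼 n, D ι (j+1) h F (x + ι n) * st ((∑ i, ψ i x h) * n)‖^2 :=
    E_nonneg fun x => E_nonneg fun h => by positivity
  rw [← abs_of_nonneg e4, ← Real.norm_eq_abs, ← Complex.norm_real, e3]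

open Classical in
lemma IC : ∃ C : ℕ, ∀ (G : Type) [AddCommGroup G] [Fintype G] (L : ℕ) [NeZero L] (ι : ZMod L →+ G) (κ : ℤ →+ G) (M : ℕ)
    (ε : ℝ) (_ : 0 < ε) (_ : ε ≤ 1/2) (_ : 1 ≤ ε^C * M) (f0 f1 : G → ℂ) (_ : ∀ x, ‖f0 x‖ ≤ 1) (_ : ∀ x, ‖f1 x‖ ≤ 1)
    (k : ℕ) (c : G → (Fin k → ZMod L) → ℂ) (_ : ∀ x h, ‖c x h‖ ≤ 1) (φ : G → (Fin k → ZMod L) → ZMod L)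
    (b : Fin k → (Fin k → ZMod L) → G → ℂ) (_ : ∀ i h x, ‖b i h x‖ ≤ 1) (_ : ∀ i h a x, b i (Function.update h i a) x = b i h x),
    ‖𝔼 x, 𝔼 h, c x h * 𝔼 n, FF ι κ M f0 f1 (x + ι n + ι (∑ i, h i)) * (∏ i, b i h (x + ι n)) * st (φ x h * n)‖^(2^k) ≤
     ε + 𝔼 h, 𝔼 h', 𝔼 x, ‖c x h'‖ * (if Maj ε C M ((sq k (φ x) h h').val / L) then 1 else 0) := by
  obtain ⟨C, hC⟩ := Pq
  refine ⟨C, fun G _ _ L _ ι κ M ε h0 h1 hM f0 f1 b0 b1 k c hc φ b hb1 hb2 => ?_⟩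
  set Ψ : G × ZMod L × Y M → (Fin k → ZMod L) → ℂ := fun z h => c z.1 h * st (φ z.1 h * z.2.1) *
    (f0 ((z.1 + ι z.2.1 - ι ((yy z.2.2)^2 : ℤ)) + ι (∑ i, h i)) * f1 ((z.1 + ι z.2.1 - ι ((yy z.2.2)^2 : ℤ) + κ (yy z.2.2)) + ι (∑ i, h i))) with hΨ
  have key := box_cs (H := ZMod L) k (Z := G × ZMod L × Y M) Ψ (fun i z h => b i h (z.1 + ι z.2.1)) (fun _ _ _ => hb1 _ _ _) (fun _ _ _ _ => hb2 _ _ _ _)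
  have e1 : 𝔼 x, 𝔼 h, c x h * 𝔼 n, FF ι κ M f0 f1 (x + ι n + ι (∑ i, h i)) * (∏ i, b i h (x + ι n)) * st (φ x h * n) =
      𝔼 z, 𝔼 h, Ψ z h * ∏ i, b i h (z.1 + ι z.2.1) := by
    rw [E_prod]
    refine E_cong fun x => ?_
    rw [E_comm (β := Fin k → ZMod L)]
    refine E_cong fun h => ?_
    rw [E_prod, mul_expect]
    refine E_cong fun n => ?_
    simp only [FF, expect_mul, mul_expect]
    refine E_cong fun y => ?_
    simp only [hΨ]
    rw [show x + ι n + ι (∑ i, h i) - ι ((yy y)^2 : ℤ) = x + ι n - ι ((yy y)^2 : ℤ) + ι (∑ i, h i) by abel,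
      show x + ι n - ι ((yy y)^2 : ℤ) + ι (∑ i, h i) + κ (yy y) = x + ι n - ι ((yy y)^2 : ℤ) + κ (yy y) + ι (∑ i, h i) by abel]
    ring
  rw [e1]
  refine key.trans ?_
  have e2 : 𝔼 z, 𝔼 h, 𝔼 h', cube k (Ψ z) h h' = 𝔼 h, 𝔼 h', 𝔼 z, cube k (Ψ z) h h' := by
    rw [E_comm]; exact E_cong fun h => E_comm _
  rw [e2]
  have hne : Nonempty (Fin k → ZMod L) := inferInstance
  have : ε + 𝔼 h, 𝔼 h', 𝔼 x, ‖c x h'‖ * (if Maj ε C M ((sq k (φ x) h h').val / L) then 1 else 0) =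
      𝔼 h, 𝔼 h', (ε + 𝔼 x, ‖c x h'‖ * (if Maj ε C M ((sq k (φ x) h h').val / L) then 1 else 0)) := by
    simp only [expect_add_distrib, E_constR]
  rw [this]
  refine (nE_le _).trans (E_mono fun h => (nE_le _).trans (E_mono fun h' => ?_))
  set P0 : G → ℂ := fun w => cube k (fun t => f0 (w + ι (∑ i, t i))) h h' with hP0
  set P1 : G → ℂ := fun w => cube k (fun t => f1 (w + ι (∑ i, t i))) h h' with hP1
  set ψ : G → ZMod L := fun x => sq k (φ x) h h' with hψ
  have e3 : ∀ z, cube k (Ψ z) h h' = cube k (c z.1) h h' * st (ψ z.1 * z.2.1) * (P0 (z.1 + ι z.2.1 - ι ((yy z.2.2)^2 : ℤ)) * P1 (z.1 + ι z.2.1 - ι ((yy z.2.2)^2 : ℤ) + κ (yy z.2.2))) := by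
    intro z
    simp only [hΨ]
    rw [cube_mul k (fun t => c z.1 t * st (φ z.1 t * z.2.1)), cube_mul k (c z.1), cube_st, cube_mul k (fun t => f0 ((z.1 + ι z.2.1 - ι ((yy z.2.2)^2 : ℤ)) + ι (∑ i, t i)))]
  have e4 : 𝔼 z, cube k (Ψ z) h h' = 𝔼 n, 𝔼 x, 𝔼 y : Y M, (cube k (c x) h h' * st (ψ x * n) * P0 (x + ι n)) * P1 (x + κ (yy y) + ι n) * ee ((ψ x).val / L * (yy y)^2) := by
    rw [E_cong e3, E_prod, E_comm (α := ZMod L) (β := G)]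
    refine E_cong fun x => ?_
    rw [E_prod, E_comm, E_comm (α := ZMod L) (β := Y M)]
    refine E_cong fun y => ?_
    rw [← E_shift (fun n => cube k (c x) h h' * st (ψ x * n) * (P0 (x + ι n - ι ((yy y)^2 : ℤ)) * P1 (x + ι n - ι ((yy y)^2 : ℤ) + κ (yy y)))) (((yy y)^2 : ℤ) : ZMod L)]
    refine E_cong fun n => ?_
    rw [mul_add, st_add, st_ee, map_add, show x + (ι n + ι (((yy y)^2 : ℤ) : ZMod L)) - ι (((yy y)^2 : ℤ) : ZMod L) = x + ι n by abel,
      show x + ι n + κ (yy y) = x + κ (yy y) + ι n by abel]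
    push_cast; ring
  rw [e4]
  refine (nE_le _).trans (E_le_const (add_nonneg h0.le (E_nonneg fun x => mul_nonneg (norm_nonneg _) (by split_ifs <;> norm_num))) fun n => ?_)
  refine (hC G κ M ε h0 h1 hM (fun x => (ψ x).val / L) (fun x => cube k (c x) h h' * st (ψ x * n) * P0 (x + ι n)) (fun x => P1 (x + ι n))
    (fun x => norm_mul_le1 (norm_mul_le1 (cube_le_one k _ (hc x) _ _) (st_norm _).le) (cube_le_one k _ (fun t => b0 _) _ _))
    (fun x => cube_le_one k _ (fun t => b1 _) _ _)).trans ?_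
  refine add_le_add le_rfl (E_mono fun x => mul_le_mul_of_nonneg_right ?_ (by split_ifs <;> norm_num))
  rw [norm_mul, norm_mul, st_norm, mul_one]
  exact (mul_le_of_le_one_right (norm_nonneg _) (cube_le_one k _ (fun t => b0 _) _ _)).trans (cube_le k _ (hc x) _ _)

variable {G : Type} [AddCommGroup G] [Fintype G]

open Classical in
lemma lowA {L : ℕ} [NeZero L] (ι : ZMod L →+ G) (j : ℕ) (F : G → ℂ) (hF : ∀ x, ‖F x‖ ≤ 1)
    (φ : G → (Fin (j+1) → ZMod L) → ZMod L) (T : Finset (ZMod L)) (ρ η d : ℝ) (hρ : 0 ≤ ρ) (hη : 0 ≤ η) (hd : 0 ≤ d) (hT : (#T : ℝ) * ρ ≤ 1)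
    (S : G → (Fin (j+1) → ZMod L) → Prop)
    (hS : ∀ x h, S x h → d ≤ ‖𝔼 n, D ι (j+1) h F (x + ι n) * st (φ x h * n)‖^2)
    (h : η ≤ 𝔼 h, 𝔼 h', 𝔼 x, (if S x h' ∧ sq (j+1) (φ x) h h' ∈ T then (1:ℝ) else 0)) :
    (d * (ρ * η))^(2^(j+1)) ≤ V ι (j+1) F := by
  set g : G → (Fin (j+1) → ZMod L) × ZMod L → ℝ := fun x p => 𝔼 h', if S x h' ∧ sq (j+1) (φ x) p.1 h' = p.2 then (1:ℝ) else 0 with hg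
  have hmax : ∀ x, ∃ p, ∀ p', g x p' ≤ g x p := fun x => by
    obtain ⟨p, -, hp⟩ := exists_max_image univ (g x) ⟨(0, 0), mem_univ _⟩
    exact ⟨p, fun p' => hp p' (mem_univ _)⟩
  choose p hp using hmax
  have gnn : ∀ x p, 0 ≤ g x p := fun x p => E_nonneg fun _ => by split_ifs <;> norm_num
  have h1 : η ≤ 𝔼 x, #T * g x (p x) := by
    refine h.trans ?_
    have : 𝔼 h, 𝔼 h', 𝔼 x, (if S x h' ∧ sq (j+1) (φ x) h h' ∈ T then (1:ℝ) else 0) = 𝔼 x, 𝔼 h, 𝔼 h', (if S x h' ∧ sq (j+1) (φ x) h h' ∈ T then (1:ℝ) else 0) := by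
      rw [E_commR (α := G)]; exact E_congR fun h => E_commR _
    rw [this]
    refine E_mono fun x => E_le_const (mul_nonneg (by positivity) (gnn _ _)) fun h => ?_
    have e : ∀ h', (if S x h' ∧ sq (j+1) (φ x) h h' ∈ T then (1:ℝ) else 0) = ∑ t ∈ T, if S x h' ∧ sq (j+1) (φ x) h h' = t then (1:ℝ) else 0 := by
      intro h'
      by_cases hs : S x h' <;> simp [hs]
    rw [E_congR e, expect_sum_comm, ← nsmul_eq_mul]
    exact sum_le_card_nsmul _ _ _ fun t _ => hp x (h, t)
  have h2 : ρ * η ≤ 𝔼 x, g x (p x) := by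
    rw [← mul_expect] at h1
    calc ρ * η ≤ ρ * (#T * 𝔼 x, g x (p x)) := by gcongr
      _ = (#T * ρ) * 𝔼 x, g x (p x) := by ring
      _ ≤ 1 * 𝔼 x, g x (p x) := by
        have : 0 ≤ 𝔼 x, g x (p x) := E_nonneg fun x => gnn _ _
        gcongr
      _ = _ := one_mul _
  choose ψ hψ1 hψ2 using fun x => sq_decomp (j+1) (φ x)
  have key := stepC ι j F hF (fun i x h' => (-1:ℤ)^(j+1) • (-ψ x i (p x).1 h') + (if i = 0 then (-1:ℤ)^(j+1) • (p x).2 else 0))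
    (fun i x h a => by simp only [hψ1])
  refine le_trans (pow_le_pow_left₀ (by positivity) ?_ _) key
  calc d * (ρ * η) ≤ d * 𝔼 x, g x (p x) := by gcongr
    _ = 𝔼 x, 𝔼 h', d * (if S x h' ∧ sq (j+1) (φ x) (p x).1 h' = (p x).2 then (1:ℝ) else 0) := by
      simp only [hg, mul_expect]
    _ ≤ _ := by
      refine E_mono fun x => E_mono fun h' => ?_
      split_ifs with hc
      · rw [mul_one]
        refine (hS x h' hc.1).trans (le_of_eq ?_)
        have e : φ x h' = ∑ i, ((-1:ℤ)^(j+1) • (-ψ x i (p x).1 h') + (if i = 0 then (-1:ℤ)^(j+1) • (p x).2 else 0)) := by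
          have h3 := hψ2 x (p x).1 h'
          rw [hc.2] at h3
          rw [sum_add_distrib, sum_ite_eq' univ (0 : Fin (j+1)), if_pos (mem_univ _), ← smul_sum, ← smul_add, h3, sum_neg_distrib,
            add_comm ((-1:ℤ)^(j+1) • φ x h'), neg_add_cancel_left, smul_smul, ← mul_pow]
          norm_num
        rw [← e]
      · rw [mul_zero]; positivity

lemma low (j : ℕ) : ∃ C : ℕ, ∀ (G : Type) [AddCommGroup G] [Fintype G] (L : ℕ) [NeZero L] (ι : ZMod L →+ G) (κ : ℤ →+ G) (M : ℕ)
    (_ : L = 200 * M^2) (δ : ℝ) (_ : 0 < δ) (_ : δ ≤ 1/2) (_ : 1 ≤ δ^C * M) (f0 f1 : G → ℂ)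
    (_ : ∀ x, ‖f0 x‖ ≤ 1) (_ : ∀ x, ‖f1 x‖ ≤ 1) (_ : δ ≤ V ι (1 + (j+1)) (FF ι κ M f0 f1)), δ^C ≤ V ι (j+1) (FF ι κ M f0 f1) := by
  classical
  obtain ⟨C, hC⟩ := IC
  obtain ⟨K, hK⟩ : ∃ K : ℕ, K = 2^(j+1) := ⟨_, rfl⟩
  have K1 : 1 ≤ K := hK ▸ Nat.one_le_two_pow
  refine ⟨(2+((2*K+1)*(3*C+11)+(2*K+1)))*K, fun G _ _ L _ ι κ M hL δ h0 h1 hM f0 f1 b0 b1 H => ?_⟩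
  set F := FF ι κ M f0 f1 with hFd
  have hF : ∀ x, ‖F x‖ ≤ 1 := FF_le ι κ M f0 f1 b0 b1
  rw [V_iter] at H
  choose φ hφ using fun h => V1inv ι (D ι (j+1) h F) (D_le_one ι (j+1) h F hF)
  set A : G → (Fin (j+1) → ZMod L) → ℂ := fun x h => 𝔼 n, D ι (j+1) h F (x + ι n) * st (φ h x * n) with hA
  have A1 : ∀ x h, ‖A x h‖ ≤ 1 := fun x h => nE_le_one fun n => norm_mul_le1 (D_le_one ι _ h F hF _) (st_norm _).le
  set c : G → (Fin (j+1) → ZMod L) → ℂ := fun x h => if δ/2 ≤ ‖A x h‖^2 then conj (A x h) else 0 with hc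
  have c1 : ∀ x h, ‖c x h‖ ≤ 1 := fun x h => by
    simp only [hc]; split_ifs
    · rw [RCLike.norm_conj]; exact A1 x h
    · simp
  obtain ⟨b, hb1, hb2, hb3⟩ := D_decomp ι (j+1) F hF
  set ε := δ^(2*K+1) with hε
  have ε0 : 0 < ε := by positivity
  have ε1 : ε ≤ 1/2 := pow_half h0 h1 (by omega)
  have hi := hC G L ι κ M ε ε0 ε1 (by rw [hε, ← pow_mul]; exact powM h0 h1 (le_trans (by nlinarith : (2*K+1)*C ≤ 2+((2*K+1)*(3*C+11)+(2*K+1))) (Nat.le_mul_of_pos_right _ K1)) hM) f0 f1 b0 b1 (j+1) c c1 (fun x h => φ h x) b hb1 hb2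
  have i1 : δ/2 ≤ ‖𝔼 x, 𝔼 h, c x h * 𝔼 n, F (x + ι n + ι (∑ i, h i)) * (∏ i, b i h (x + ι n)) * st (φ h x * n)‖ := by
    have e : 𝔼 x, 𝔼 h, c x h * 𝔼 n, F (x + ι n + ι (∑ i, h i)) * (∏ i, b i h (x + ι n)) * st (φ h x * n) =
       ((𝔼 x, 𝔼 h, if δ/2 ≤ ‖A x h‖^2 then ‖A x h‖^2 else 0 : ℝ) : ℂ) := by
      rw [ofReal_E]
      refine E_cong fun x => ?_
      rw [ofReal_E]
      refine E_cong fun h => ?_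
      have : 𝔼 n, F (x + ι n + ι (∑ i, h i)) * (∏ i, b i h (x + ι n)) * st (φ h x * n) = A x h := by
        simp only [hA]; exact E_cong fun n => by rw [hb3]
      rw [this]
      simp only [hc]
      split_ifs
      · rw [mul_comm, Complex.mul_conj']; push_cast; ring
      · simp
    rw [e, Complex.norm_real, Real.norm_eq_abs]
    refine le_trans ?_ (le_abs_self _)
    have h3 : δ ≤ 𝔼 x, 𝔼 h, ‖A x h‖^2 := by
      rw [E_commR]; exact H.trans (E_mono fun h => hφ h)
    have h4 : 𝔼 x, 𝔼 h, ‖A x h‖^2 ≤ 𝔼 x, 𝔼 h, ((if δ/2 ≤ ‖A x h‖^2 then ‖A x h‖^2 else 0) + δ/2) := by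
      refine E_mono fun x => E_mono fun h => ?_
      split_ifs with hh
      · linarith
      · push Not at hh; linarith
    have : Nonempty G := ⟨0⟩
    simp only [expect_add_distrib, E_constR] at h4
    linarith
  set T : Finset (ZMod L) := univ.filter fun t => Maj ε C M (t.val / L) with hT
  have hT1 := countMaj hL ε0 ε1 T (C := C) (fun t ht => by simpa [hT] using ht)
  have i2 : ε ≤ 𝔼 h, 𝔼 h', 𝔼 x, (if δ/2 ≤ ‖A x h'‖^2 ∧ sq (j+1) (fun h => φ h x) h h' ∈ T then (1:ℝ) else 0) := by
    rw [← hK] at hi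
    have s1 := (pow_le_pow_left₀ (by positivity) ((by nlinarith : δ^2 ≤ δ/2).trans i1) K).trans hi
    rw [← pow_mul] at s1
    have s2 : 2 * ε ≤ δ^(2*K) := by
      rw [hε, pow_succ]; have : 0 < δ^(2*K) := by positivity
      nlinarith
    have s3 : ε ≤ 𝔼 h, 𝔼 h', 𝔼 x, ‖c x h'‖ * (if Maj ε C M ((sq (j+1) (fun h => φ h x) h h').val / L) then 1 else 0) := by linarith
    refine s3.trans (E_mono fun h => E_mono fun h' => E_mono fun x => ?_)
    simp only [hT, mem_filter, mem_univ, true_and]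
    by_cases m1 : Maj ε C M ((sq (j+1) (fun h => φ h x) h h').val / L)
    · rw [if_pos m1, mul_one]
      simp only [m1, and_true, hc]
      split_ifs
      · rw [RCLike.norm_conj]; exact A1 x h'
      · simp
    · rw [if_neg m1, if_neg (fun h => m1 h.2), mul_zero]
  have := lowA ι j F hF (fun x h => φ h x) T (ε^(3*C+11)) ε (δ/2) (by positivity) ε0.le (by positivity) hT1 (fun x h => δ/2 ≤ ‖A x h‖^2) (fun x h hh => hh) i2
  refine le_trans ?_ this
  rw [← hK, pow_mul]
  refine pow_le_pow_left₀ (by positivity) ?_ K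
  rw [pow_add, pow_add, hε, ← pow_mul]
  refine mul_le_mul_of_nonneg_right (by nlinarith) (by positivity)

lemma low_all (s : ℕ) : ∃ C : ℕ, ∀ (G : Type) [AddCommGroup G] [Fintype G] (L : ℕ) [NeZero L] (ι : ZMod L →+ G) (κ : ℤ →+ G) (M : ℕ)
    (_ : L = 200 * M^2) (δ : ℝ) (_ : 0 < δ) (_ : δ ≤ 1/2) (_ : 1 ≤ δ^C * M) (f0 f1 : G → ℂ)
    (_ : ∀ x, ‖f0 x‖ ≤ 1) (_ : ∀ x, ‖f1 x‖ ≤ 1) (_ : δ ≤ V ι (s+1) (FF ι κ M f0 f1)), δ^(C+1) ≤ V ι 1 (FF ι κ M f0 f1) := by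
  induction s with
  | zero => exact ⟨0, fun G _ _ L _ ι κ M hL δ h0 h1 hM f0 f1 b0 b1 H => by simpa using H⟩
  | succ s ih =>
    obtain ⟨C1, h1⟩ := ih
    obtain ⟨C2, h2⟩ := low s
    refine ⟨(C2+1)*(C1+1), fun G _ _ L _ ι κ M hL δ h0 hh hM f0 f1 b0 b1 H => ?_⟩
    have a := h2 G L ι κ M hL δ h0 hh (powM h0 hh (by nlinarith) hM) f0 f1 b0 b1 (by rwa [add_comm 1])
    have a : δ^(C2+1) ≤ V ι (s+1) (FF ι κ M f0 f1) := (pmono h0 hh (by omega)).trans a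
    have := h1 G L ι κ M hL (δ^(C2+1)) (by positivity) (pow_half h0 hh (by omega)) (by rw [← pow_mul]; exact powM h0 hh (by nlinarith) hM) f0 f1 b0 b1 a
    rw [← pow_mul] at this
    exact (pmono h0 hh (by omega)).trans this

lemma Fdual {L : ℕ} [NeZero L] (ι : ZMod L →+ G) (κ : ℤ →+ G) (M : ℕ) (f0 f1 f2 : G → ℂ) :
    Lam κ (lm ι) M f0 f1 f2 = 𝔼 x, f2 x * FF ι κ M f0 f1 x := by
  simp only [Lam, FF, mul_expect]
  rw [E_comm, E_comm (α := G)]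
  refine E_cong fun y => ?_
  rw [← E_shift (fun x => f2 x * (f0 (x - ι ((yy y)^2 : ℤ)) * f1 (x - ι ((yy y)^2 : ℤ) + κ (yy y)))) (ι ((yy y)^2 : ℤ))]
  refine E_cong fun x => ?_
  simp only [add_sub_cancel_right, lm_apply]
  ring_nf

lemma C2 : ∃ C : ℕ, ∀ (G : Type) [AddCommGroup G] [Fintype G] (L : ℕ) [NeZero L] (ι : ZMod L →+ G) (κ : ℤ →+ G) (M : ℕ)
    (_ : L = 200 * M^2) (δ : ℝ) (_ : 0 < δ) (_ : δ ≤ 1/2) (_ : 1 ≤ δ^C * M) (f0 f1 f2 : G → ℂ)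
    (_ : ∀ x, ‖f0 x‖ ≤ 1) (_ : ∀ x, ‖f1 x‖ ≤ 1) (_ : ∀ x, ‖f2 x‖ ≤ 1)
    (_ : δ ≤ ‖Lam κ (lm ι) M f0 f1 f2‖), δ^C ≤ V ι 1 (FF ι κ M f0 f1) := by
  obtain ⟨C1, h1⟩ := C1
  obtain ⟨C2, h2⟩ := low_all 7
  refine ⟨(2*C1+1)*(C2+1), fun G _ _ L _ ι κ M hL δ h0 hh hM f0 f1 f2 b0 b1 b2 H => ?_⟩
  have F1 := FF_le ι κ M f0 f1 b0 b1
  rw [Fdual] at H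
  have a1 : δ^2 ≤ ‖Lam κ (lm ι) M f0 f1 (fun x => conj (FF ι κ M f0 f1 x))‖ := by
    rw [Fdual]
    calc δ^2 ≤ ‖𝔼 x, f2 x * FF ι κ M f0 f1 x‖^2 := by gcongr
      _ ≤ 𝔼 x, ‖FF ι κ M f0 f1 x‖^2 := cs_kill _ _ b2
      _ = ‖((𝔼 x, ‖FF ι κ M f0 f1 x‖^2 : ℝ) : ℂ)‖ := by
        rw [Complex.norm_real, Real.norm_eq_abs, abs_of_nonneg (E_nonneg fun x => by positivity)]
      _ = _ := by
        rw [ofReal_E]; congr 1; exact E_cong fun x => by rw [Complex.ofReal_pow, ← Complex.conj_mul']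
  have a2 := h1 G L ι κ M hL (δ^2) (by positivity) (pow_half h0 hh (by omega)) (by rw [← pow_mul]; exact powM h0 hh (by nlinarith) hM) f0 f1 _ b0 b1 (fun x => by rw [RCLike.norm_conj]; exact F1 x) a1
  rw [V_conj, ← pow_mul] at a2
  have a2 : δ^(2*C1+1) ≤ _ := (pmono h0 hh (by omega)).trans a2
  have := h2 G L ι κ M hL (δ^(2*C1+1)) (by positivity) (pow_half h0 hh (by omega)) (by rw [← pow_mul]; exact powM h0 hh (by nlinarith) hM) f0 f1 b0 b1 a2
  rwa [← pow_mul] at this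

lemma yy_bd {M : ℕ} (y : Y M) : 1 ≤ yy y ∧ yy y ≤ 5 * M := by
  have h1 := y.1.2
  have h2 := y.2.1.2
  have h3 := (y.2.2 0).2
  have h4 := (y.2.2 1).2
  have h5 := (y.2.2 2).2
  simp only [yy, Fin.sum_univ_three]
  omega

lemma yshift {M J : ℕ} {S : Type} [Fintype S] [Nonempty S] (t : S → ℕ) (hs : ∀ s, t s ≤ J) (g : ℤ → ℂ) (hg : ∀ b, ‖g b‖ ≤ 1) :
    ‖𝔼 y : Y M, g (yy y) - 𝔼 y : Y M, 𝔼 s, g (yy y + t s)‖ ≤ 2 * J / M := by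
  rw [E_prod, E_prod, E_comm, E_comm (α := Fin M), ← expect_sub_distrib]
  refine (nE_le _).trans (E_le_const (by positivity) fun r => ?_)
  have := shift_avg (M := M) t hs (fun b => g (1 + b + (r.1 : ℤ) + ∑ i, ((r.2 i : ℕ) : ℤ))) (fun _ => hg _)
  refine le_trans (le_of_eq ?_) this
  congr 1
  congr 1
  refine E_cong fun b => E_cong fun s => ?_
  simp only [yy]; congr 1; push_cast; ring

lemma majShift {M J Q q : ℕ} (hM : 0 < M) (hJ : 0 < J) (β : ℝ) (hqQ : q ∣ Q) (hQ0 : 0 < Q) {B τ : ℝ}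
    (hB : nn (q * β) * M^2 ≤ B) (hτ : (Q * J : ℝ) ≤ τ * M) (τ1 : τ ≤ 1) (g : ℤ → ℂ) (hg : ∀ b, ‖g b‖ ≤ 1) :
    ‖𝔼 y : Y M, g (yy y) * ee (β * (yy y)^2)‖ ≤ 𝔼 y : Y M, ‖𝔼 j : Fin J, g (yy y + (Q * j : ℕ))‖ + (2 * τ + 77 * (B * τ)) := by
  have : NeZero J := ⟨hJ.ne'⟩
  have hMr : (0:ℝ) < M := by exact_mod_cast hM
  have hQJ : (0:ℝ) ≤ Q * J := by positivity
  have hτ0 : 0 ≤ τ := by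
    by_contra h; push Not at h; nlinarith
  have a1 := yshift (M := M) (J := Q * J) (fun j : Fin J => Q * j) (fun j => Nat.mul_le_mul_left _ j.2.le) (fun y => g y * ee (β * (y:ℝ)^2))
    (fun b => norm_mul_le1 (hg _) (ee_norm _).le)
  have a2 : 2 * ((Q * J : ℕ) : ℝ) / M ≤ 2 * τ := by
    rw [div_le_iff₀ hMr]; push_cast; linarith
  have a3 : ∀ y : Y M, ‖𝔼 j : Fin J, g (yy y + (Q * j : ℕ)) * ee (β * ((yy y + (Q * j : ℕ) : ℤ):ℝ)^2)‖ ≤ ‖𝔼 j : Fin J, g (yy y + (Q * j : ℕ))‖ + 77 * (B * τ) := by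
    intro y
    have e1 : 𝔼 j : Fin J, g (yy y + (Q * j : ℕ)) * ee (β * ((yy y + (Q * j : ℕ) : ℤ):ℝ)^2) =
      ee (β * (yy y)^2) * (𝔼 j : Fin J, g (yy y + (Q * j : ℕ)) + 𝔼 j : Fin J, g (yy y + (Q * j : ℕ)) * (ee (β * ((Q * j : ℕ) * (2 * yy y + (Q * j : ℕ)))) - 1)) := by
      rw [← expect_add_distrib, mul_expect]
      refine E_cong fun j => ?_
      rw [show β * ((yy y + (Q * j : ℕ) : ℤ):ℝ)^2 = β * (yy y)^2 + β * ((Q * j : ℕ) * (2 * yy y + (Q * j : ℕ))) by push_cast; ring, ee_add]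
      ring
    rw [e1, norm_mul, ee_norm, one_mul]
    refine (norm_add_le _ _).trans (add_le_add le_rfl ?_)
    have B0 : 0 ≤ B := le_trans (mul_nonneg (nn_nonneg _) (by positivity)) hB
    refine (nE_le _).trans (E_le_const (by positivity) fun j => ?_)
    rw [norm_mul]
    refine (mul_le_of_le_one_left (norm_nonneg _) (hg _)).trans ((ee_upper _).trans ?_)
    obtain ⟨r, hr⟩ := hqQ
    have y1 := yy_bd y
    have ej : β * ((Q * j : ℕ) * (2 * yy y + (Q * j : ℕ))) = ((r * j * (2 * yy y + (Q * j : ℕ)) : ℤ) : ℝ) * (q * β) := by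
      push_cast; rw [show (Q:ℝ) = q * r by rw [hr]; push_cast; ring]; ring
    rw [ej]
    have s1 := nn_int_mul (r * j * (2 * yy y + (Q * j : ℕ)) : ℤ) (q * β)
    have y1r : (yy y : ℝ) ≤ 5 * M := by exact_mod_cast y1.2
    have y0r : (1:ℝ) ≤ yy y := by exact_mod_cast y1.1
    have hrQ : (r:ℝ) ≤ Q := by
      have : r ≤ Q := by
        rw [hr]; refine Nat.le_mul_of_pos_left _ (Nat.pos_of_ne_zero ?_)
        rintro rfl; simp at hr; omega
      exact_mod_cast this
    have hjJ : ((j:ℕ):ℝ) ≤ J := by exact_mod_cast j.2.le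
    have s2 : |((r * j * (2 * yy y + (Q * j : ℕ)) : ℤ) : ℝ)| ≤ (τ * M) * (11 * M) := by
      push_cast
      rw [abs_of_nonneg (by positivity)]
      have q1 : (r:ℝ) * ((j:ℕ):ℝ) ≤ Q * J := by gcongr
      have q2 : (Q:ℝ) * ((j:ℕ):ℝ) ≤ Q * J := by gcongr
      have q3 : 2 * (yy y : ℝ) + Q * ((j:ℕ):ℝ) ≤ 11 * M := by nlinarith
      exact mul_le_mul (q1.trans hτ) q3 (by positivity) (by positivity)
    calc 7 * nn (((r * j * (2 * yy y + (Q * j : ℕ)) : ℤ) : ℝ) * (q * β)) ≤ 7 * ((τ * M) * (11 * M) * nn (q * β)) := by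
          have := nn_nonneg (q * β)
          have := s1.trans (mul_le_mul_of_nonneg_right s2 this)
          linarith
      _ = 77 * ((nn (q * β) * M^2) * τ) := by ring
      _ ≤ 77 * (B * τ) := by gcongr
  have a4 : ‖𝔼 y : Y M, g (yy y) * ee (β * (yy y)^2)‖ ≤ 2 * τ + 𝔼 y : Y M, ‖𝔼 j : Fin J, g (yy y + (Q * j : ℕ)) * ee (β * ((yy y + (Q * j : ℕ) : ℤ):ℝ)^2)‖ := by
    have := norm_sub_norm_le (𝔼 y : Y M, g (yy y) * ee (β * (yy y)^2)) (𝔼 y : Y M, 𝔼 j : Fin J, g (yy y + (Q * j : ℕ)) * ee (β * ((yy y + (Q * j : ℕ) : ℤ):ℝ)^2))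
    have h3 := nE_le (fun y : Y M => 𝔼 j : Fin J, g (yy y + (Q * j : ℕ)) * ee (β * ((yy y + (Q * j : ℕ) : ℤ):ℝ)^2))
    linarith
  have a5 := E_mono a3
  have : Nonempty (Y M) := ⟨(⟨0, hM⟩, ⟨0, hM⟩, fun _ => ⟨0, hM⟩)⟩
  rw [expect_add_distrib, E_constR] at a5
  linarith

lemma inv : ∃ C : ℕ, ∀ (G : Type) [AddCommGroup G] [Fintype G] (L : ℕ) [NeZero L] (ι : ZMod L →+ G) (κ : ℤ →+ G) (M : ℕ)
    (_ : L = 200 * M^2) (δ : ℝ) (_ : 0 < δ) (_ : δ ≤ 1/2) (_ : 1 ≤ δ^C * M) (f0 f1 f2 : G → ℂ)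
    (_ : ∀ x, ‖f0 x‖ ≤ 1) (_ : ∀ x, ‖f1 x‖ ≤ 1) (_ : ∀ x, ‖f2 x‖ ≤ 1)
    (_ : δ ≤ ‖Lam κ (lm ι) M f0 f1 f2‖) (Q J : ℕ) (_ : ∀ q : ℕ, 0 < q → q * δ^C ≤ 1 → q ∣ Q) (_ : 0 < Q) (_ : 0 < J)
    (_ : (Q * J : ℝ) ≤ δ^C * M), δ^C ≤ 𝔼 x, ‖𝔼 j : Fin J, f1 (x + κ ((Q * j : ℕ) : ℤ))‖ := by
  classical
  obtain ⟨C1, h1⟩ := C2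
  obtain ⟨C2, h2⟩ := Pq
  obtain ⟨E, hE⟩ : ∃ E, E = 2 * (C1+1) := ⟨_, rfl⟩
  refine ⟨E*(C2+10), fun G _ _ L _ ι κ M hL δ h0 hh hM f0 f1 f2 b0 b1 b2 H Q J hQ hQ0 hJ hQJ => ?_⟩
  have hV := h1 G L ι κ M hL δ h0 hh (powM h0 hh (by rw [hE]; nlinarith) hM) f0 f1 f2 b0 b1 b2 H
  have F1 := FF_le ι κ M f0 f1 b0 b1
  obtain ⟨φ, hφ⟩ := V1inv ι _ F1
  have hM0 : 0 < M := by
    rcases Nat.eq_zero_or_pos M with h | h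
    · subst h; norm_num at hM
    · exact h
  set A : G → ℂ := fun x => 𝔼 n, FF ι κ M f0 f1 (x + ι n) * st (φ x * n) with hA
  have A1 : ∀ x, ‖A x‖ ≤ 1 := fun x => nE_le_one fun n => norm_mul_le1 (F1 _) (st_norm _).le
  set ε := δ^E with hε
  have ε0 : 0 < ε := by positivity
  have ε1 : ε ≤ 1/2 := pow_half h0 hh (by omega)
  have hεC : ∀ j, δ^(E*j) = ε^j := fun j => by rw [hε, ← pow_mul]
  rw [hεC] at hM hQJ hQ
  have e2 : 2 * ε ≤ V ι 1 (FF ι κ M f0 f1) := by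
    refine le_trans ?_ hV
    calc 2 * ε ≤ 2 * δ^(C1+1) := by
          have := pmono h0 hh (show C1 + 1 ≤ E by omega); linarith
      _ = (2 * δ) * δ^C1 := by ring
      _ ≤ 1 * δ^C1 := by gcongr; linarith
      _ = _ := one_mul _
  set β : G → ℝ := fun x => (φ x).val / L with hβ
  have key : ∀ c : G → ℂ, 𝔼 x, c x * A x = 𝔼 n, 𝔼 x, 𝔼 y : Y M, (c x * st (φ x * n) * f0 (x + ι n)) * f1 (x + κ (yy y) + ι n) * ee (β x * (yy y)^2) := by
    intro c
    rw [E_comm (α := ZMod L) (β := G)]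
    refine E_cong fun x => ?_
    simp only [hA, FF, mul_expect, expect_mul]
    rw [E_comm, E_comm (α := ZMod L) (β := Y M)]
    refine E_cong fun y => ?_
    rw [← E_shift (fun n => c x * (f0 (x + ι n - ι ((yy y)^2 : ℤ)) * f1 (x + ι n - ι ((yy y)^2 : ℤ) + κ (yy y)) * st (φ x * n))) (((yy y)^2 : ℤ) : ZMod L)]
    refine E_cong fun n => ?_
    rw [mul_add, st_add, st_ee, map_add, show x + (ι n + ι (((yy y)^2 : ℤ) : ZMod L)) - ι (((yy y)^2 : ℤ) : ZMod L) = x + ι n by abel,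
      show x + ι n + κ (yy y) = x + κ (yy y) + ι n by abel]
    push_cast; ring
  set c1 : G → ℂ := fun x => if Maj ε C2 M (β x) then 0 else conj (A x) with hc1
  set c2 : G → ℂ := fun x => if Maj ε C2 M (β x) then conj (A x) else 0 with hc2
  have c1b : ∀ x, ‖c1 x‖ ≤ 1 := fun x => by
    simp only [hc1]; split_ifs
    · simp
    · rw [RCLike.norm_conj]; exact A1 x
  have c2b : ∀ x, ‖c2 x‖ ≤ 1 := fun x => by
    simp only [hc2]; split_ifs
    · rw [RCLike.norm_conj]; exact A1 x
    · simp
  have t1 : ‖𝔼 x, c1 x * A x‖ ≤ ε := by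
    rw [key]
    refine (nE_le _).trans (E_le_const ε0.le fun n => ?_)
    refine (h2 G κ M ε ε0 ε1 (powM ε0 ε1 (by omega) hM) β (fun x => c1 x * st (φ x * n) * f0 (x + ι n)) (fun x => f1 (x + ι n))
      (fun x => norm_mul_le1 (norm_mul_le1 (c1b _) (st_norm _).le) (b0 _)) (fun x => b1 _)).trans ?_
    have : 𝔼 x, ‖c1 x * st (φ x * n) * f0 (x + ι n)‖ * (if Maj ε C2 M (β x) then 1 else 0) = 0 := by
      rw [← expect_const_zero (univ : Finset G)]
      refine E_congR fun x => ?_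
      simp only [hc1]; split_ifs <;> simp
    rw [this, add_zero]
  have t2 : 2 * ε ≤ ‖𝔼 x, c1 x * A x‖ + ‖𝔼 x, c2 x * A x‖ := by
    refine le_trans ?_ (norm_add_le _ _)
    rw [← expect_add_distrib]
    have : 𝔼 x, (c1 x * A x + c2 x * A x) = ((𝔼 x, ‖A x‖^2 : ℝ) : ℂ) := by
      rw [ofReal_E]; refine E_cong fun x => ?_
      rw [Complex.ofReal_pow, ← Complex.conj_mul']
      simp only [hc1, hc2]; split_ifs <;> ring
    rw [this, Complex.norm_real, Real.norm_eq_abs]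
    exact (e2.trans hφ).trans (le_abs_self _)
  set W := 𝔼 x, ‖𝔼 j : Fin J, f1 (x + κ ((Q * j : ℕ) : ℤ))‖ with hW
  have X1 : 1/ε^C2 * ε^(C2+10) = ε^10 := by
    rw [pow_add]; field_simp
  have t3 : ‖𝔼 x, c2 x * A x‖ ≤ W + (2 * ε^(C2+10) + 77 * ε^10) := by
    rw [key]
    have per : ∀ n x, ‖𝔼 y : Y M, (c2 x * st (φ x * n) * f0 (x + ι n)) * f1 (x + κ (yy y) + ι n) * ee (β x * (yy y)^2)‖ ≤
      𝔼 y : Y M, ‖𝔼 j : Fin J, f1 (x + (κ (yy y) + ι n) + κ ((Q * j : ℕ) : ℤ))‖ + (2 * ε^(C2+10) + 77 * ε^10) := by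
      intro n x
      by_cases hm : Maj ε C2 M (β x)
      · obtain ⟨q, q0, q1, q2⟩ := hm
        have s1 := majShift hM0 hJ (β x) (hQ q q0 (pdown ε0 ε1 (by omega) (by positivity) q1)) hQ0 (B := 1/ε^C2) (τ := ε^(C2+10))
          (by rw [le_div_iff₀ (by positivity)]; exact q2) hQJ (pow_le_one₀ ε0.le (by linarith)) (fun y => f1 (x + κ y + ι n)) (fun _ => b1 _)
        rw [X1] at s1
        have e5 : 𝔼 y : Y M, (c2 x * st (φ x * n) * f0 (x + ι n)) * f1 (x + κ (yy y) + ι n) * ee (β x * (yy y)^2) =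
          (c2 x * st (φ x * n) * f0 (x + ι n)) * 𝔼 y : Y M, f1 (x + κ (yy y) + ι n) * ee (β x * (yy y)^2) := by
          rw [mul_expect]; exact E_cong fun y => by ring
        rw [e5, norm_mul]
        refine (mul_le_of_le_one_left (norm_nonneg _) (norm_mul_le1 (norm_mul_le1 (c2b _) (st_norm _).le) (b0 _))).trans (s1.trans (le_of_eq ?_))
        congr 1
        refine E_congR fun y => ?_
        congr 1
        refine E_cong fun j => ?_
        rw [map_add]; congr 1; abel
      · have : c2 x = 0 := by simp only [hc2, if_neg hm]
        simp only [this, zero_mul, expect_const_zero, norm_zero]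
        have : 0 ≤ 𝔼 y : Y M, ‖𝔼 j : Fin J, f1 (x + (κ (yy y) + ι n) + κ ((Q * j : ℕ) : ℤ))‖ := E_nonneg fun y => norm_nonneg _
        positivity
    have : Nonempty (Y M) := ⟨(⟨0, hM0⟩, ⟨0, hM0⟩, fun _ => ⟨0, hM0⟩)⟩
    have : Nonempty G := ⟨0⟩
    calc _ ≤ 𝔼 n : ZMod L, 𝔼 x : G, (𝔼 y : Y M, ‖𝔼 j : Fin J, f1 (x + (κ (yy y) + ι n) + κ ((Q * j : ℕ) : ℤ))‖ + (2 * ε^(C2+10) + 77 * ε^10)) :=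
          (nE_le _).trans (E_mono fun n => (nE_le _).trans (E_mono fun x => per n x))
      _ = W + (2 * ε^(C2+10) + 77 * ε^10) := by
        simp only [expect_add_distrib, E_constR]
        congr 1
        have : ∀ n : ZMod L, 𝔼 x : G, 𝔼 y : Y M, ‖𝔼 j : Fin J, f1 (x + (κ (yy y) + ι n) + κ ((Q * j : ℕ) : ℤ))‖ = W := by
          intro n
          rw [E_commR]
          have : ∀ y : Y M, 𝔼 x : G, ‖𝔼 j : Fin J, f1 (x + (κ (yy y) + ι n) + κ ((Q * j : ℕ) : ℤ))‖ = W := fun y =>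
            E_shiftR (fun x => ‖𝔼 j : Fin J, f1 (x + κ ((Q * j : ℕ) : ℤ))‖) _
          simp only [this, E_constR]
        simp only [this, E_constR]
  rw [hεC]
  have f1 : ε^(C2+10) ≤ ε^10 := pmono ε0 ε1 (by omega)
  have f2 := cpow ε0 ε1 (c := 160) 8 (by norm_num)
  have f3 : ε^10 = ε^8 * ε * ε := by ring
  have : ε^8 * ε * ε ≤ 1/160 * 1 * ε := by gcongr <;> linarith
  nlinarith

lemma E_val {n : ℕ} [NeZero n] (φ : ℕ → ℝ) : 𝔼 t : ZMod n, φ t.val = (∑ i ∈ range n, φ i) / n := by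
  obtain _ | n := n
  · exact absurd rfl (NeZero.ne 0)
  · rw [Fintype.expect_eq_sum_div_card, ZMod.card, ← Fin.sum_univ_eq_sum_range φ]; rfl

lemma val_add_int {n : ℕ} [NeZero n] (t : ZMod n) (m : ℤ) (h0 : 0 ≤ m) (h : t.val + m < n) : ((t + (m : ZMod n)).val : ℤ) = t.val + m := by
  lift m to ℕ using h0
  have h : t.val + m < n := by exact_mod_cast h
  have : t + ((m:ℤ) : ZMod n) = ((t.val + m : ℕ) : ZMod n) := by push_cast; rw [ZMod.natCast_zmod_val]
  rw [this, ZMod.val_natCast, Nat.mod_eq_of_lt h]; push_cast; rfl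

lemma transf : ∃ C : ℕ, ∀ (G : Type) [AddCommGroup G] [Fintype G] (e : G) (P R M : ℕ) (_ : R ≤ P) (_ : 0 < P)
    (δ : ℝ) (_ : 0 < δ) (_ : δ ≤ 1/2) (_ : 1 ≤ δ^C * M) (f0 f1 f2 : G → ℂ)
    (_ : ∀ x, ‖f0 x‖ ≤ 1) (_ : ∀ x, ‖f1 x‖ ≤ 1) (_ : ∀ x, ‖f2 x‖ ≤ 1)
    (_ : δ ≤ ‖𝔼 x, 𝔼 y : Y M, f0 x * f1 (x + (R * yy y : ℤ) • e) * f2 (x + (P * yy y ^ 2 : ℤ) • e)‖)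
    (Q J : ℕ) (_ : ∀ q : ℕ, 0 < q → q * δ^C ≤ 1 → q ∣ Q) (_ : 0 < Q) (_ : 0 < J)
    (_ : (Q * J : ℝ) ≤ δ^C * M), δ^C ≤ 𝔼 x, ‖𝔼 j : Fin J, f1 (x + (R * (Q * j) : ℤ) • e)‖ := by
  classical
  obtain ⟨C1, h1⟩ := inv
  refine ⟨3*C1+4, fun G _ _ e P R M hRP hP δ h0 hh hM f0 f1 f2 b0 b1 b2 H Q J hQ hQ0 hJ hQJ => ?_⟩
  have hM0 : 0 < M := by
    rcases Nat.eq_zero_or_pos M with h | h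
    · subst h; norm_num at hM
    · exact h
  have : Nonempty G := ⟨0⟩
  have : NeZero J := ⟨hJ.ne'⟩
  have : Nonempty (Y M) := ⟨(⟨0, hM0⟩, ⟨0, hM0⟩, fun _ => ⟨0, hM0⟩)⟩
  obtain ⟨L, hL⟩ : ∃ L, L = 200 * M^2 := ⟨_, rfl⟩
  have hL0 : 0 < L := by rw [hL]; positivity
  have : NeZero L := ⟨hL0.ne'⟩
  obtain ⟨n, hn⟩ : ∃ n, n = P * L := ⟨_, rfl⟩
  have hn0 : 0 < n := by rw [hn]; positivity
  have : NeZero n := ⟨hn0.ne'⟩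
  obtain ⟨h, hh2⟩ : ∃ h, h = 100 * P * M^2 := ⟨_, rfl⟩
  have hnh : n = 2 * h := by rw [hn, hL, hh2]; ring
  have hnz : (n:ℤ) = 2 * h := by exact_mod_cast hnh
  set κ : ℤ →+ ZMod n := (Int.castAddHom (ZMod n)).comp (AddMonoidHom.mulLeft (R:ℤ)) with hκ
  have κa : ∀ m, κ m = ((R * m : ℤ) : ZMod n) := fun m => rfl
  set ι : ZMod L →+ ZMod n := ZMod.lift L ⟨(Int.castAddHom (ZMod n)).comp (AddMonoidHom.mulLeft (P:ℤ)), by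
    change ((P * (L:ℤ) : ℤ) : ZMod n) = 0
    have : (P * (L:ℤ) : ℤ) = ((n:ℕ) : ℤ) := by rw [hn]; push_cast; ring
    rw [this]; simp⟩ with hι
  have ιa : ∀ m, lm ι m = ((P * m : ℤ) : ZMod n) := fun m => by
    rw [lm_apply, hι, ZMod.lift_coe]; rfl
  set F0 : G → ZMod n → ℂ := fun c t => if t.val < h then f0 (c + (t.val : ℤ) • e) else 0 with hF0
  set F1 : G → ZMod n → ℂ := fun c t => f1 (c + (t.val : ℤ) • e) with hF1
  set F2 : G → ZMod n → ℂ := fun c t => f2 (c + (t.val : ℤ) • e) with hF2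
  set Λ := 𝔼 x, 𝔼 y : Y M, f0 x * f1 (x + (R * yy y : ℤ) • e) * f2 (x + (P * yy y ^ 2 : ℤ) • e) with hΛ
  have a1 : 𝔼 c, Lam κ (lm ι) M (F0 c) (F1 c) (F2 c) = Λ / 2 := by
    simp only [Lam]
    rw [E_comm]
    have : ∀ t : ZMod n, 𝔼 c, 𝔼 y : Y M, F0 c t * F1 c (t + κ (yy y)) * F2 c (t + lm ι (yy y ^ 2)) = ((if t.val < h then 1 else 0 : ℝ) : ℂ) * Λ := by
      intro t
      by_cases ht : t.val < h
      · rw [if_pos ht, Complex.ofReal_one, one_mul, hΛ]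
        refine Eq.trans ?_ (E_shift _ ((t.val : ℤ) • e))
        refine E_cong fun c => E_cong fun y => ?_
        simp only [hF0, hF1, hF2, if_pos ht]
        have y1 := yy_bd y
        have w1 : ((t + κ (yy y)).val : ℤ) = t.val + R * yy y := by
          rw [κa]; refine val_add_int _ _ (mul_nonneg (by positivity) (by linarith)) ?_
          have : (R:ℤ) * yy y ≤ h := by
            calc (R:ℤ) * yy y ≤ P * (5 * M) := mul_le_mul (by exact_mod_cast hRP) y1.2 (by linarith) (by positivity)
              _ ≤ h := by
                rw [hh2]; push_cast
                have : (1:ℤ) ≤ M := by exact_mod_cast hM0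
                have hPM : (0:ℤ) ≤ P * M := by positivity
                nlinarith
          have : (t.val:ℤ) < h := by exact_mod_cast ht
          linarith
        have w2 : ((t + lm ι (yy y ^ 2)).val : ℤ) = t.val + P * yy y ^ 2 := by
          rw [ιa]; refine val_add_int _ _ (by positivity) ?_
          have : (P:ℤ) * yy y ^ 2 ≤ h := by
            calc (P:ℤ) * yy y ^ 2 ≤ P * (5 * M)^2 := mul_le_mul_of_nonneg_left (pow_le_pow_left₀ (by linarith) y1.2 _) (by positivity)
              _ ≤ h := by
                rw [hh2]; push_cast
                have hPM : (0:ℤ) ≤ P * M^2 := by positivity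
                nlinarith
          have : (t.val:ℤ) < h := by exact_mod_cast ht
          linarith
        rw [w1, w2, add_smul, add_smul, ← add_assoc, ← add_assoc]
      · rw [if_neg ht]
        simp only [hF0, if_neg ht, zero_mul, expect_const_zero, Complex.ofReal_zero]
    rw [E_cong this, ← expect_mul, ← ofReal_E, E_val (fun i => if i < h then (1:ℝ) else 0)]
    have : ∑ i ∈ range n, (if i < h then (1:ℝ) else 0) = h := by
      rw [← sum_filter, show (range n).filter (fun i => i < h) = range h by ext i; simp; omega]; simp
    have h0' : (h:ℝ) ≠ 0 := by
      have : 0 < h := by omega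
      positivity
    have hnr : (n:ℝ) = 2 * h := by exact_mod_cast hnh
    have h0c : (h:ℂ) ≠ 0 := by exact_mod_cast h0'
    rw [this, hnr]; push_cast; field_simp
  have a2 : δ/2 ≤ 𝔼 c, ‖Lam κ (lm ι) M (F0 c) (F1 c) (F2 c)‖ := by
    refine le_trans ?_ (nE_le _)
    rw [a1, norm_div]; simp; linarith
  have F0b : ∀ c t, ‖F0 c t‖ ≤ 1 := fun c t => by
    simp only [hF0]; split_ifs
    · exact b0 _
    · simp
  have d3 : δ^3 ≤ δ/2/2 := by nlinarith [mul_nonneg h0.le (show 0 ≤ 1/2 - δ by linarith)]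
  have a3 := E_impl (e := (δ^3)^C1) (g := fun c => 𝔼 t, ‖𝔼 j : Fin J, F1 c (t + κ ((Q * j : ℕ) : ℤ))‖) (by positivity) a2
    (fun c => nE_le_one fun t => nE_le_one fun y => norm_mul_le1 (norm_mul_le1 (F0b _ _) (b1 _)) (b2 _)) (by positivity)
    (fun c => E_nonneg fun t => norm_nonneg _) (fun c hc => by
      refine h1 _ L ι κ M hL (δ^3) (by positivity) (pow_half h0 hh (by omega)) ?_ (F0 c) (F1 c) (F2 c) (F0b c) (fun _ => b1 _) (fun _ => b2 _) (d3.trans hc) Q J ?_ hQ0 hJ ?_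
      · rw [← pow_mul]; exact powM h0 hh (by omega) hM
      · intro q q0 q1; rw [← pow_mul] at q1; exact hQ q q0 (pdown h0 hh (by omega) (by positivity) q1)
      · rw [← pow_mul]; refine hQJ.trans (mul_le_mul_of_nonneg_right (pmono h0 hh (by omega)) (by positivity)))
  set W := 𝔼 x, ‖𝔼 j : Fin J, f1 (x + (R * (Q * j) : ℤ) • e)‖ with hW
  have W0 : 0 ≤ W := E_nonneg fun x => norm_nonneg _
  set Bd := R * (Q * J) with hBd
  have a4 : 𝔼 c, 𝔼 t, ‖𝔼 j : Fin J, F1 c (t + κ ((Q * j : ℕ) : ℤ))‖ ≤ W + Bd / n := by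
    rw [E_commR]
    have : ∀ t : ZMod n, 𝔼 c, ‖𝔼 j : Fin J, F1 c (t + κ ((Q * j : ℕ) : ℤ))‖ ≤ W + (if n < t.val + Bd then 1 else 0) := by
      intro t
      split_ifs with ht
      · have : 𝔼 c, ‖𝔼 j : Fin J, F1 c (t + κ ((Q * j : ℕ) : ℤ))‖ ≤ 1 := E_le_const zero_le_one fun c => nE_le_one fun j => b1 _
        linarith
      · rw [add_zero, hW]
        refine le_of_eq (Eq.trans (E_congR fun c => ?_) (E_shiftR _ ((t.val:ℤ) • e)))
        congr 1
        refine E_cong fun j => ?_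
        have w1 : ((t + κ ((Q * j : ℕ) : ℤ)).val : ℤ) = t.val + R * (Q * j) := by
          rw [κa, val_add_int _ _ (by positivity)]
          · push_cast; ring
          · rcases Nat.eq_zero_or_pos R with r0 | r0
            · have := ZMod.val_lt t
              rw [r0]; push_cast; rw [zero_mul, add_zero]; exact_mod_cast this
            · have hj : R * (Q * j) < Bd := by
                rw [hBd]; exact Nat.mul_lt_mul_of_pos_left (Nat.mul_lt_mul_of_pos_left j.2 hQ0) r0
              have : t.val + R * (Q * j) < n := by omega
              exact_mod_cast this
        simp only [hF1]
        rw [w1, add_smul, ← add_assoc]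
    refine (E_mono this).trans ?_
    rw [expect_add_distrib, E_constR, E_val (fun i => if n < i + Bd then (1:ℝ) else 0)]
    refine add_le_add le_rfl (div_le_div_of_nonneg_right ?_ (by positivity))
    rw [← sum_filter, sum_const, nsmul_eq_mul, mul_one]
    have : (range n).filter (fun i => n < i + Bd) ⊆ Ico (n - Bd) n := by
      intro i; simp; omega
    have := card_le_card this
    rw [Nat.card_Ico] at this
    exact_mod_cast this.trans (by omega)
  have a5 : (Bd:ℝ) / n ≤ δ^(3*C1+4) := by
    have hnr : (n:ℝ) = P * (200 * M^2) := by rw [hn, hL]; push_cast; ring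
    rw [hnr, div_le_iff₀ (by positivity), hBd]; push_cast
    have hR : (R:ℝ) ≤ P := by exact_mod_cast hRP
    have hM1 : (1:ℝ) ≤ M := by exact_mod_cast hM0
    have hp : 0 ≤ δ^(3*C1+4) * M := by positivity
    calc (R:ℝ) * (Q * J) ≤ P * (δ^(3*C1+4) * M) := mul_le_mul hR hQJ (by positivity) (by positivity)
      _ ≤ P * ((δ^(3*C1+4) * M) * (200 * M)) := by
        refine mul_le_mul_of_nonneg_left (le_mul_of_one_le_right hp (by linarith)) (by positivity)
      _ = _ := by ring
  have a6 : 2 * δ^(3*C1+4) ≤ δ/2/2 * (δ^3)^C1 := by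
    calc 2 * δ^(3*C1+4) = (2 * δ) * (δ^3 * (δ^3)^C1) := by rw [← pow_mul]; ring
      _ ≤ 1 * (δ^3 * (δ^3)^C1) := by gcongr; linarith
      _ ≤ _ := by rw [one_mul]; gcongr
  linarith

set_option maxHeartbeats 1000000 in
lemma lemW {G : Type} [AddCommGroup G] [Fintype G] (e : G) (P M D J : ℕ) (hD : 0 < D) (hJ : 0 < J) (hM : 0 < M)
    (g h : G → ℂ) (hg : ∀ x, ‖g x‖ ≤ 1) (hh : ∀ x, ‖h x‖ ≤ 1) :
    ‖𝔼 x, g x * 𝔼 y : Y M, h (x + (P * yy y ^ 2 : ℤ) • e)‖ ≤ 2 * D / M +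
      √(1 / D + 𝔼 x, ‖𝔼 j : Fin J, h (x + (2 * P * D.factorial * j : ℤ) • e)‖ + 2 * (D.factorial * J : ℕ) / M) := by
  classical
  have : Nonempty G := ⟨0⟩
  have : NeZero D := ⟨hD.ne'⟩
  have : NeZero J := ⟨hJ.ne'⟩
  have : Nonempty (Y M) := ⟨(⟨0, hM⟩, ⟨0, hM⟩, fun _ => ⟨0, hM⟩)⟩
  set τ := 𝔼 x, ‖𝔼 j : Fin J, h (x + (2 * P * D.factorial * j : ℤ) • e)‖ with hτ
  set er : ℝ := 2 * (D.factorial * J : ℕ) / M with her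
  have τ0 : 0 ≤ τ := E_nonneg fun _ => norm_nonneg _
  have er0 : 0 ≤ er := by positivity
  have s1 : ‖𝔼 x, g x * 𝔼 y : Y M, h (x + (P * yy y ^ 2 : ℤ) • e) -
      𝔼 x, g x * 𝔼 y : Y M, 𝔼 i : Fin D, h (x + (P * (yy y + (i:ℕ)) ^ 2 : ℤ) • e)‖ ≤ 2 * D / M := by
    rw [← expect_sub_distrib]
    refine (nE_le _).trans (E_le_const (by positivity) fun x => ?_)
    rw [← mul_sub, norm_mul]
    have := yshift (M := M) (J := D) (S := Fin D) (fun i => (i:ℕ)) (fun i => i.2.le) (fun b => h (x + (P * b ^ 2 : ℤ) • e)) (fun _ => hh _)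
    exact (mul_le_of_le_one_left (norm_nonneg _) (hg x)).trans this
  set Φ : Fin D → Fin D → ℂ := fun i i' => 𝔼 z : G × Y M, h (z.1 + (P * (yy z.2 + (i:ℕ)) ^ 2 : ℤ) • e) * conj (h (z.1 + (P * (yy z.2 + (i':ℕ)) ^ 2 : ℤ) • e)) with hΦ
  have Φc : ∀ i i', ‖Φ i i'‖ = ‖Φ i' i‖ := fun i i' => by
    have : Φ i i' = conj (Φ i' i) := by
      simp only [hΦ]; rw [map_expect]; refine E_cong fun z => ?_
      rw [map_mul, Complex.conj_conj, mul_comm]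
    rw [this, RCLike.norm_conj]
  have Φ1 : ∀ i i', ‖Φ i i'‖ ≤ 1 := fun i i' => nE_le_one fun z => norm_mul_le1 (hh _) (by rw [RCLike.norm_conj]; exact hh _)
  have Φ2 : ∀ i i' : Fin D, i' < i → ‖Φ i i'‖ ≤ τ + er := by
    intro i i' hi
    obtain ⟨d, hd⟩ : ∃ d : ℕ, (i:ℕ) = i' + d := ⟨i - i', by have : (i':ℕ) < i := hi; omega⟩
    have d0 : 0 < d := by have : (i':ℕ) < i := hi; omega
    obtain ⟨m, hm⟩ : d ∣ D.factorial := Nat.dvd_factorial d0 (by have := i.2; omega)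
    have e1 : Φ i i' = 𝔼 x, conj (h x) * 𝔼 y : Y M, h (x + (P * d * (2 * yy y + i + i') : ℤ) • e) := by
      simp only [hΦ]
      rw [E_prod, E_comm]
      have : ∀ y : Y M, 𝔼 x, h (x + (P * (yy y + (i:ℕ)) ^ 2 : ℤ) • e) * conj (h (x + (P * (yy y + (i':ℕ)) ^ 2 : ℤ) • e)) =
          𝔼 x, h (x + (P * d * (2 * yy y + i + i') : ℤ) • e) * conj (h x) := by
        intro y
        refine Eq.trans (E_cong fun x => ?_) (E_shift _ ((P * (yy y + (i':ℕ)) ^ 2 : ℤ) • e))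
        rw [add_assoc, ← add_smul]
        congr 4; rw [hd]; push_cast; ring
      rw [E_cong this, E_comm]
      refine E_cong fun x => ?_
      rw [mul_expect]; refine E_cong fun y => mul_comm _ _
    have e2 : ∀ x, ‖conj (h x) * 𝔼 y : Y M, h (x + (P * d * (2 * yy y + i + i') : ℤ) • e)‖ ≤
        𝔼 y : Y M, ‖𝔼 j : Fin J, h (x + (P * d * (2 * (yy y + (m * j : ℕ)) + i + i') : ℤ) • e)‖ + er := by
      intro x
      have := yshift (M := M) (J := D.factorial * J) (S := Fin J) (fun j => m * j) (fun j => by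
        rw [hm]; exact Nat.mul_le_mul (Nat.le_mul_of_pos_left _ d0) j.2.le) (fun b => h (x + (P * d * (2 * b + i + i') : ℤ) • e)) (fun _ => hh _)
      rw [norm_mul, RCLike.norm_conj]
      refine (mul_le_of_le_one_left (norm_nonneg _) (hh x)).trans ?_
      have h2 := norm_le_norm_add_norm_sub' (𝔼 y : Y M, h (x + (P * d * (2 * yy y + i + i') : ℤ) • e)) (𝔼 y : Y M, 𝔼 j : Fin J, h (x + (P * d * (2 * (yy y + (m * j : ℕ)) + i + i') : ℤ) • e))
      refine h2.trans (add_le_add (nE_le _) this)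
    rw [e1]
    refine ((nE_le _).trans (E_mono e2)).trans ?_
    rw [expect_add_distrib, E_constR]
    refine add_le_add ?_ le_rfl
    rw [E_commR]
    refine E_le_const τ0 fun y => le_of_eq ?_
    rw [hτ]
    refine Eq.trans (E_congR fun x => ?_) (E_shiftR _ ((P * d * (2 * yy y + i + i') : ℤ) • e))
    congr 1; refine E_cong fun j => ?_
    rw [add_assoc x, ← add_smul]
    congr 3; rw [hm]; push_cast; ring
  have s2 : ‖𝔼 x, g x * 𝔼 y : Y M, 𝔼 i : Fin D, h (x + (P * (yy y + (i:ℕ)) ^ 2 : ℤ) • e)‖^2 ≤ 1 / D + τ + er := by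
    have r1 : 𝔼 x, g x * 𝔼 y : Y M, 𝔼 i : Fin D, h (x + (P * (yy y + (i:ℕ)) ^ 2 : ℤ) • e) =
        𝔼 z : G × Y M, g z.1 * 𝔼 i : Fin D, h (z.1 + (P * (yy z.2 + (i:ℕ)) ^ 2 : ℤ) • e) := by
      rw [E_prod]; refine E_cong fun x => ?_
      rw [mul_expect]
    rw [r1]
    refine (cs_dup (fun z : G × Y M => g z.1) (fun z (i : Fin D) => h (z.1 + (P * (yy z.2 + (i:ℕ)) ^ 2 : ℤ) • e)) fun z => hg z.1).trans ?_
    rw [E_comm]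
    have : ∀ i : Fin D, 𝔼 z : G × Y M, 𝔼 i' : Fin D, h (z.1 + (P * (yy z.2 + (i:ℕ)) ^ 2 : ℤ) • e) * conj (h (z.1 + (P * (yy z.2 + (i':ℕ)) ^ 2 : ℤ) • e)) = 𝔼 i', Φ i i' := fun i => E_comm (α := G × Y M) (β := Fin D) _
    rw [E_cong this]
    have b : ∀ i i' : Fin D, ‖Φ i i'‖ ≤ (if i = i' then 1 else 0) + (τ + er) := by
      intro i i'
      rcases lt_trichotomy i i' with hlt | heq | hgt
      · rw [if_neg hlt.ne, Φc]; linarith [Φ2 _ _ hlt]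
      · rw [if_pos heq]; linarith [Φ1 i i']
      · rw [if_neg hgt.ne']; linarith [Φ2 _ _ hgt]
    refine ((nE_le _).trans (E_mono fun i => (nE_le _).trans (E_mono fun i' => b i i'))).trans ?_
    have : ∀ i : Fin D, 𝔼 i' : Fin D, ((if i = i' then (1:ℝ) else 0) + (τ + er)) = 1 / D + (τ + er) := by
      intro i
      rw [expect_add_distrib, E_constR, Fintype.expect_eq_sum_div_card]; simp
    rw [E_congR this, E_constR]; linarith
  have s3 := Real.le_sqrt_of_sq_le s2
  have := norm_le_norm_add_norm_sub' (𝔼 x, g x * 𝔼 y : Y M, h (x + (P * yy y ^ 2 : ℤ) • e)) (𝔼 x, g x * 𝔼 y : Y M, 𝔼 i : Fin D, h (x + (P * (yy y + (i:ℕ)) ^ 2 : ℤ) • e))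
  linarith

noncomputable def T {G : Type} [AddCommGroup G] (s : G) (J : ℕ) (f : G → ℝ) (x : G) : ℝ := 𝔼 j : Fin J, f (x + (j:ℤ) • s)

def AI {G : Type} [AddCommGroup G] (s : G) (κ : ℝ) (g : G → ℝ) : Prop := ∀ x (i : ℕ), |g (x + (i:ℤ) • s) - g x| ≤ κ * i

section
variable {G : Type} [AddCommGroup G] {s t : G} {J : ℕ} {κ : ℝ} {f g : G → ℝ}

lemma abs_E {α : Type} [Fintype α] (f : α → ℝ) : |𝔼 x, f x| ≤ 𝔼 x, |f x| := abs_expect_le _ _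

lemma T_AI (hf : ∀ x, |f x| ≤ 1) : AI s (2 / J) (T s J f) := by
  intro x i
  have h := shift_sum (M := J) (s := i) (fun b => ((f (x + (b:ℤ) • s) : ℝ) : ℂ)) (fun b => by rw [Complex.norm_real]; exact hf _)
  have h2 : |∑ b ∈ range J, f (x + ((b+i : ℕ):ℤ) • s) - ∑ b ∈ range J, f (x + (b:ℤ) • s)| ≤ 2 * i := by
    rw [← Real.norm_eq_abs, ← Complex.norm_real]; push_cast at h ⊢; exact h
  simp only [T]
  have e1 : 𝔼 j : Fin J, f (x + (i:ℤ) • s + (j:ℤ) • s) = (∑ b ∈ range J, f (x + ((b+i : ℕ):ℤ) • s)) / J := by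
    rw [Fintype.expect_eq_sum_div_card, Fintype.card_fin, ← Fin.sum_univ_eq_sum_range (fun b => f (x + ((b+i : ℕ):ℤ) • s))]
    congr 1; refine sum_congr rfl fun j _ => ?_
    rw [add_assoc, ← add_smul]; congr 3; push_cast; ring
  have e2 : 𝔼 j : Fin J, f (x + (j:ℤ) • s) = (∑ b ∈ range J, f (x + (b:ℤ) • s)) / J := by
    rw [Fintype.expect_eq_sum_div_card, Fintype.card_fin, ← Fin.sum_univ_eq_sum_range (fun b => f (x + (b:ℤ) • s))]
  rw [e1, e2, ← sub_div, abs_div, Nat.abs_cast, div_mul_eq_mul_div]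
  exact div_le_div_of_nonneg_right h2 (by positivity)

lemma T_le {B : ℝ} (hB : 0 ≤ B) (hf : ∀ x, f x ≤ B) (x) : T s J f x ≤ B := E_le_const hB fun _ => hf _
lemma T_nn (hf : ∀ x, 0 ≤ f x) (x) : 0 ≤ T s J f x := E_nonneg fun _ => hf _
lemma T_sub (x) : T s J (fun x => f x - g x) x = T s J f x - T s J g x := expect_sub_distrib ..
lemma T_comm (K : ℕ) (x) : T s J (T t K f) x = T t K (T s J f) x := by
  simp only [T]; rw [E_commR]
  refine E_congR fun i => E_congR fun j => ?_
  congr 1; abel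

lemma AI_neg (h : AI s κ g) : AI (-s) κ g := by
  intro x i
  have := h (x + (i:ℤ) • (-s)) i
  rw [abs_sub_comm]
  simpa using this

lemma AI_smul (h : AI s κ g) (m : ℕ) : AI ((m:ℤ) • s) (κ * m) g := by
  intro x i
  have := h x (i * m)
  rw [← mul_smul]; push_cast at this ⊢
  rw [show κ * (i * m) = κ * m * i by ring] at this
  exact this

lemma AI_T (h : AI s κ g) (hκ : 0 ≤ κ) : AI s κ (T t J g) := by
  intro x i
  simp only [T]
  rw [← expect_sub_distrib]
  refine (abs_E _).trans (E_le_const (by positivity) fun j => ?_)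
  have := h (x + (j:ℤ) • t) i
  rwa [add_right_comm] at this

lemma AI_near (h : AI s κ g) (hκ : 0 ≤ κ) (hJ : 0 < J) (x) : |T s J g x - g x| ≤ κ * J := by
  have : NeZero J := ⟨hJ.ne'⟩
  have : g x = 𝔼 _j : Fin J, g x := by rw [E_constR]
  rw [this, T, ← expect_sub_distrib]
  refine (abs_E _).trans (E_le_const (by positivity) fun j => ?_)
  refine (h x j).trans (mul_le_mul_of_nonneg_left ?_ hκ)
  exact_mod_cast j.2.le

lemma T_split (q : ℕ) (x) : T s (J * q) f x = 𝔼 r : Fin q, T ((q:ℤ) • s) J f (x + (r:ℤ) • s) := by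
  simp only [T]
  rw [E_commR, ← E_prodR (fun p : Fin J × Fin q => f (x + (p.2:ℤ) • s + (p.1:ℤ) • (q:ℤ) • s))]
  refine (Fintype.expect_equiv finProdFinEquiv _ _ fun p => ?_).symm
  rw [add_assoc, ← mul_smul, ← add_smul]; congr 3
  simp [finProdFinEquiv]; ring

variable [Fintype G]

lemma T_adj : 𝔼 x, T s J f x * g x = 𝔼 x, f x * T (-s) J g x := by
  simp only [T]
  simp_rw [expect_mul, mul_expect]
  rw [E_commR, E_commR (α := G)]
  refine E_congR fun j => ?_
  refine Eq.trans (E_congR fun x => ?_) (E_shiftR _ ((j:ℤ) • s))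
  congr 2; simp

lemma E_T (hJ : 0 < J) : 𝔼 x, T s J f x = 𝔼 x, f x := by
  have : NeZero J := ⟨hJ.ne'⟩
  simp only [T]; rw [E_commR, E_congR fun j : Fin J => E_shiftR f ((j:ℤ) • s), E_constR]

lemma E_Tsq (hJ : 0 < J) : 𝔼 x, T s J f x ^ 2 ≤ 𝔼 x, f x ^ 2 := by
  refine (E_mono fun x => E_sq_le _).trans (le_of_eq ?_)
  exact E_T (f := fun x => f x ^ 2) hJ

lemma E_near {κ : ℝ} {a b c : G → ℝ} (hκ : 0 ≤ κ) (ha : ∀ x, |a x| ≤ 1) (h : ∀ x, |b x - c x| ≤ κ) : |𝔼 x, a x * b x - 𝔼 x, a x * c x| ≤ κ := by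
  rw [← expect_sub_distrib]
  refine (abs_E _).trans (E_le_const hκ fun x => ?_)
  rw [← mul_sub, abs_mul]
  exact (mul_le_of_le_one_left (abs_nonneg _) (ha x)).trans (h x)

end

lemma bd01 {a : ℝ} (h0 : 0 ≤ a) (h1 : a ≤ 1) : |a| ≤ 1 := abs_le.2 ⟨by linarith, h1⟩
lemma bdsub {a b : ℝ} (h0 : 0 ≤ a) (h1 : a ≤ 1) (h2 : 0 ≤ b) (h3 : b ≤ 1) : |a - b| ≤ 1 := abs_le.2 ⟨by linarith, by linarith⟩

set_option maxHeartbeats 2000000 in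
lemma core : ∃ C : ℕ, ∀ (G : Type) [AddCommGroup G] [Fintype G] (e : G) (f : G → ℝ) (q R Z n M J' J1 : ℕ) (ε : ℝ),
    0 < q → 0 < R → 0 < Z → 0 < n → 0 < J1 → 0 < ε → ε ≤ 1/4 → 1 ≤ ε^C * Z →
    (∀ x, 0 ≤ f x) → (∀ x, f x ≤ 1) → M = Z * (Z.factorial * J1) → J' * q = Z * M →
    2 * (q * R * Z.factorial * n * Z) ≤ Z * M → Z.factorial * (Z * (Z * n)) * Z ≤ M →
    3.96 * ε ≤ 𝔼 x, f x →
    (∀ x, T ((q * R : ℤ) • e) J' f x ≤ 6 * ε) →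
    (∀ x, T ((2 * (q * R^2 : ℕ) * Z.factorial : ℤ) • e) n f x ≤ 6 * ε) →
    (∀ x, T ((2 * (q * R^2 : ℕ) * Z.factorial : ℤ) • e) (Z * n) f x ≤ 6 * ε) →
    𝔼 x, T ((R * Z.factorial : ℤ) • e) J1 f x ^ 2 ≤ 𝔼 x, T ((R : ℤ) • e) (Z * M) f x ^ 2 + 1 / Z →
    𝔼 x, 𝔼 y : Y M, f x * f (x + (R * yy y : ℤ) • e) * f (x + ((q * R^2 : ℕ) * yy y ^ 2 : ℤ) • e) = 0 → False := by
  obtain ⟨C1, h1⟩ := transf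
  refine ⟨8*C1+20, fun G _ _ e f q R Z n M J' J1 ε q0 R0 Z0 n0 J10 ε0 ε1 hZ f0 f1 hM hJ' hs1 hs2 hμ b1 b2 b3 hE H2 => ?_⟩
  have : Nonempty G := ⟨0⟩
  have fb : ∀ x, |f x| ≤ 1 := fun x => bd01 (f0 x) (f1 x)
  obtain ⟨Q, hQ⟩ : ∃ Q, Q = Z.factorial := ⟨_, rfl⟩
  have Q0 : 0 < Q := hQ ▸ Nat.factorial_pos _
  obtain ⟨P, hP⟩ : ∃ P, P = q * R^2 := ⟨_, rfl⟩
  have P0 : 0 < P := by rw [hP]; positivity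
  rw [← hQ] at hM hs1 hs2 b2 b3 hE
  rw [← hP] at b2 b3 H2
  have M0 : 0 < M := by rw [hM]; positivity
  have : Nonempty (Y M) := ⟨(⟨0, M0⟩, ⟨0, M0⟩, fun _ => ⟨0, M0⟩)⟩
  obtain ⟨J, hJ⟩ : ∃ J, J = Z * M := ⟨_, rfl⟩
  rw [← hJ] at hJ' hs1 hE
  have J0 : 0 < J := by rw [hJ]; positivity
  have Zr : (0:ℝ) < Z := by exact_mod_cast Z0
  have Z1 : (1:ℝ) ≤ Z := by exact_mod_cast Z0
  have Mr : (0:ℝ) < M := by exact_mod_cast M0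
  have Jr : (0:ℝ) < J := by exact_mod_cast J0
  have Qr : (1:ℝ) ≤ Q := by exact_mod_cast Q0
  have nr : (1:ℝ) ≤ n := by exact_mod_cast n0
  have J1r : (0:ℝ) < J1 := by exact_mod_cast J10
  have hJr : (J:ℝ) = Z * M := by rw [hJ]; push_cast; ring
  have hMr : (M:ℝ) = Z * (Q * J1) := by rw [hM]; push_cast; ring
  have hs1r : 2 * ((q:ℝ) * R * Q * n * Z) ≤ J := by exact_mod_cast hs1
  have hs2r : (Q:ℝ) * (Z * (Z * n)) * Z ≤ M := by exact_mod_cast hs2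
  obtain ⟨a, ha⟩ : ∃ a, a = (ε^4)^C1 := ⟨_, rfl⟩
  have a0 : 0 < a := by rw [ha]; positivity
  have a1 : a ≤ 1 := by rw [ha]; exact pow_le_one₀ (by positivity) (pow_le_one₀ ε0.le (by linarith))
  obtain ⟨ζ, hζ⟩ : ∃ ζ : ℝ, ζ = 1 / Z := ⟨_, rfl⟩
  have ζ0 : 0 < ζ := by rw [hζ]; positivity
  have e14 : ε^14 ≤ (1/4)^14 := pow_le_pow_left₀ ε0.le ε1 _
  have ζa : ζ ≤ a^2 * ε^6 / 10000 := by
    have : ζ ≤ ε^(8*C1+20) := by rw [hζ, div_le_iff₀ Zr]; exact hZ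
    have e2 : ε^(8*C1+20) = a^2 * ε^6 * ε^14 := by rw [ha, ← pow_mul, ← pow_mul, ← pow_add, ← pow_add]; congr 1; ring
    have : a^2 * ε^6 * ε^14 ≤ a^2 * ε^6 * (1/10000) := mul_le_mul_of_nonneg_left (e14.trans (by norm_num)) (by positivity)
    linarith
  have e6 : ε^6 ≤ 1 := pow_le_one₀ ε0.le (by linarith)
  have ζ1 : ζ ≤ a^2 / 10000 := by
    have : a^2 * ε^6 ≤ a^2 * 1 := mul_le_mul_of_nonneg_left e6 (by positivity)
    linarith
  have ζ2 : ζ ≤ ε^6 / 10000 := by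
    have : a^2 * ε^6 ≤ 1 * ε^6 := mul_le_mul_of_nonneg_right (pow_le_one₀ a0.le a1) (by positivity)
    linarith
  have ζZ : ζ * Z = 1 := by rw [hζ]; field_simp
  rw [← hζ] at hE
  obtain ⟨r, hr⟩ : ∃ r : G, r = (R:ℤ) • e := ⟨_, rfl⟩
  obtain ⟨s, hs⟩ : ∃ s : G, s = (2 * P * Q : ℤ) • e := ⟨_, rfl⟩
  obtain ⟨r', hr'⟩ : ∃ r' : G, r' = (R * Q : ℤ) • e := ⟨_, rfl⟩
  rw [← hs] at b2 b3
  rw [← hr, ← hr'] at hE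
  have rr' : r' = (Q:ℤ) • r := by rw [hr', hr, ← mul_smul]; congr 1; ring
  have rs : s = ((2 * (q * R * Q) : ℕ):ℤ) • r := by rw [hs, hr, ← mul_smul, hP]; congr 1; push_cast; ring
  set F := T r J f with hF
  set S := T (-r) J F with hS
  have F0 : ∀ x, 0 ≤ F x := T_nn f0
  have F1 : ∀ x, F x ≤ 1 := T_le zero_le_one f1
  have F2 : ∀ x, F x ≤ 6 * ε := by
    intro x; rw [hF, ← hJ', T_split]
    refine E_le_const (by positivity) fun i => ?_
    rw [hr, ← mul_smul]; exact b1 _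
  have S0 : ∀ x, 0 ≤ S x := T_nn F0
  have S1 : ∀ x, S x ≤ 1 := T_le zero_le_one F1
  have S2 : ∀ x, S x ≤ 6 * ε := T_le (by positivity) F2
  have Sb : ∀ x, |S x| ≤ 1 := fun x => bd01 (S0 x) (S1 x)
  have SA : AI r (2 / J) S := AI_T (T_AI fb) (by positivity)
  have SA' : AI r' (2 / J * Q) S := by rw [rr']; exact AI_smul SA Q
  have ω : 2 / J * Q * J1 ≤ 2 * ζ := by
    have : 2 / (J:ℝ) * Q * J1 = 2 * ζ * ζ := by
      rw [hJr, hMr, hζ]; field_simp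
    have z1 : ζ ≤ 1 := by rw [hζ, div_le_one Zr]; exact Z1
    rw [this]; nlinarith
  have fS : 𝔼 x, f x * S x = 𝔼 x, F x ^ 2 := by
    rw [hS, ← T_adj]; exact E_congR fun x => (pow_two _).symm
  set F' := T r' J1 f with hF'
  have d1 : |𝔼 x, f x * T (-r') J1 S x - 𝔼 x, f x * S x| ≤ 2 * ζ :=
    E_near (by positivity) fb fun x => (AI_near (AI_neg SA') (by positivity) J10 x).trans ω
  rw [← T_adj, fS] at d1
  have d2 : 𝔼 x, S x ^ 2 ≤ 𝔼 x, F x ^ 2 := E_Tsq J0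
  have d3 : 𝔼 x, (F' x - S x)^2 ≤ 5 * ζ := by
    have : 𝔼 x, (F' x - S x)^2 = 𝔼 x, F' x ^ 2 - 2 * 𝔼 x, F' x * S x + 𝔼 x, S x ^ 2 := by
      rw [mul_expect, ← expect_sub_distrib, ← expect_add_distrib]
      refine E_congR fun x => by ring
    have := (abs_le.1 d1).1
    linarith
  have d4 : (𝔼 x, |F' x - S x|)^2 ≤ 5 * ζ := (E_sq_le _).trans (by simpa only [sq_abs] using d3)
  have d5 : 𝔼 x, |T r' J1 (fun x => f x - S x) x| ≤ 𝔼 x, |F' x - S x| + 2 * ζ := by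
    have : ∀ x, |T r' J1 (fun x => f x - S x) x| ≤ |F' x - S x| + 2 * ζ := by
      intro x
      rw [T_sub]
      have := (AI_near SA' (by positivity) J10 x).trans ω
      have t := abs_sub_le (F' x) (S x) (T r' J1 S x)
      rw [abs_sub_comm (S x)] at t
      linarith
    refine (E_mono this).trans ?_
    rw [expect_add_distrib, E_constR]
  have d6 : 𝔼 x, |T r' J1 (fun x => f x - S x) x| < a := by
    have : 𝔼 x, |F' x - S x| ≤ a / 4 := by
      refine abs_le_of_sq_le_sq' ?_ (by positivity) |>.2
      have : 5 * ζ ≤ (a/4)^2 := by rw [div_pow]; linarith [sq_nonneg a]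
      linarith
    have : a^2 ≤ a := by nlinarith
    linarith
  have d7 : |𝔼 x, 𝔼 y : Y M, f x * (f (x + (R * yy y : ℤ) • e) - S (x + (R * yy y : ℤ) • e)) * f (x + (P * yy y ^ 2 : ℤ) • e)| < ε^4 := by
    by_contra hcon
    push Not at hcon
    have hε4 : ε^4 ≤ 1/2 := (pow_le_pow_left₀ ε0.le ε1 4).trans (by norm_num)
    have aZ : 1 ≤ a * Z := by
      have : ζ ≤ a := by nlinarith
      calc (1:ℝ) = ζ * Z := ζZ.symm
        _ ≤ _ := by gcongr
    have := h1 G e P R M (by rw [hP]; nlinarith [Nat.mul_le_mul q0 R0]) P0 (ε^4) (by positivity) hε4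
      (by rw [← ha]; refine aZ.trans ?_; gcongr; rw [hM]; exact Nat.le_mul_of_pos_right _ (by positivity))
      (fun x => (f x : ℂ)) (fun x => ((f x - S x : ℝ) : ℂ)) (fun x => (f x : ℂ))
      (fun x => by rw [Complex.norm_real]; exact fb x)
      (fun x => by rw [Complex.norm_real]; exact bdsub (f0 x) (f1 x) (S0 x) (S1 x))
      (fun x => by rw [Complex.norm_real]; exact fb x)
      (by
        simp only [← Complex.ofReal_mul, ← ofReal_E]
        rw [Complex.norm_real]; exact hcon) Q J1
      (by
        intro p p0 hp
        rw [hQ]; refine Nat.dvd_factorial p0 ?_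
        rw [← ha] at hp
        have : (p:ℝ) * a ≤ Z * a := by linarith
        exact_mod_cast le_of_mul_le_mul_right this a0) Q0 J10
      (by
        rw [← ha, hMr, ← mul_assoc]
        exact le_mul_of_one_le_left (by positivity) aZ)
    rw [← ha] at this
    refine absurd (this.trans (le_of_eq (E_congR fun x => ?_))) (not_le.2 d6)
    rw [← ofReal_E, Complex.norm_real, Real.norm_eq_abs]
    congr 1
    refine E_congR fun j => ?_
    simp only [hr', ← mul_smul]
    rw [show (R:ℤ) * (Q * (j:ℕ)) = (j:ℕ) * (R * Q) by ring]
  have d8 : |𝔼 x, 𝔼 y : Y M, f x * S (x + (R * yy y : ℤ) • e) * f (x + (P * yy y ^ 2 : ℤ) • e)| < ε^4 := by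
    have : 𝔼 x, 𝔼 y : Y M, f x * S (x + (R * yy y : ℤ) • e) * f (x + (P * yy y ^ 2 : ℤ) • e) =
      - 𝔼 x, 𝔼 y : Y M, f x * (f (x + (R * yy y : ℤ) • e) - S (x + (R * yy y : ℤ) • e)) * f (x + (P * yy y ^ 2 : ℤ) • e) := by
      rw [eq_neg_iff_add_eq_zero, ← expect_add_distrib, ← H2]
      refine E_congR fun x => ?_
      rw [← expect_add_distrib]
      refine E_congR fun y => by ring
    rw [this, abs_neg]; exact d7
  set k : G → ℝ := fun x => f x * S x with hk
  have kb : ∀ x, |k x| ≤ 1 := fun x => by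
    rw [hk, abs_mul]; exact mul_le_one₀ (fb x) (abs_nonneg _) (Sb x)
  have d9 : |𝔼 x, k x * 𝔼 y : Y M, f (x + (P * yy y ^ 2 : ℤ) • e)| ≤ ε^4 + 10 * ζ := by
    have : |𝔼 x, k x * 𝔼 y : Y M, f (x + (P * yy y ^ 2 : ℤ) • e) - 𝔼 x, 𝔼 y : Y M, f x * S (x + (R * yy y : ℤ) • e) * f (x + (P * yy y ^ 2 : ℤ) • e)| ≤ 10 * ζ := by
      rw [← expect_sub_distrib]
      refine (abs_E _).trans (E_le_const (by positivity) fun x => ?_)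
      rw [mul_expect, ← expect_sub_distrib]
      refine (abs_E _).trans (E_le_const (by positivity) fun y => ?_)
      have yb := yy_bd y
      obtain ⟨w, hw⟩ : ∃ w : ℕ, yy y = w := ⟨(yy y).toNat, by omega⟩
      have wM : (w:ℝ) ≤ 5 * M := by
        have : (w:ℤ) ≤ 5 * M := by rw [← hw]; exact yb.2
        exact_mod_cast this
      have e1 : k x * f (x + (P * yy y ^ 2 : ℤ) • e) - f x * S (x + (R * yy y : ℤ) • e) * f (x + (P * yy y ^ 2 : ℤ) • e) =
        (f x * f (x + (P * yy y ^ 2 : ℤ) • e)) * (S x - S (x + (w:ℤ) • r)) := by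
        rw [hk, hr, ← mul_smul, hw, mul_comm (w:ℤ)]; ring
      rw [e1, abs_mul, abs_mul, abs_sub_comm (S x)]
      have := SA x w
      refine (mul_le_of_le_one_left (abs_nonneg _) (mul_le_one₀ (fb _) (abs_nonneg _) (fb _))).trans (this.trans ?_)
      calc 2 / (J:ℝ) * w ≤ 2 / J * (5 * M) := by gcongr
        _ = 10 * ζ := by rw [hJr, hζ]; field_simp; norm_num
    have := abs_sub_abs_le_abs_sub (𝔼 x, k x * 𝔼 y : Y M, f (x + (P * yy y ^ 2 : ℤ) • e)) (𝔼 x, 𝔼 y : Y M, f x * S (x + (R * yy y : ℤ) • e) * f (x + (P * yy y ^ 2 : ℤ) • e))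
    linarith
  set V := T s (Z * n) f with hV
  have V0 : ∀ x, 0 ≤ V x := T_nn f0
  have V1 : ∀ x, V x ≤ 1 := T_le zero_le_one f1
  have Zn0 : 0 < Z * n := by positivity
  have d10 : |𝔼 x, k x * 𝔼 y : Y M, (f (x + (P * yy y ^ 2 : ℤ) • e) - V (x + (P * yy y ^ 2 : ℤ) • e))| ≤ 2 * ζ + ε^3/4 := by
    have := lemW e P M Z (Z * (Z * n)) Z0 (by positivity) M0 (fun x => (k x : ℂ)) (fun x => ((f x - V x : ℝ) : ℂ))
      (fun x => by rw [Complex.norm_real]; exact kb x)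
      (fun x => by rw [Complex.norm_real]; exact bdsub (f0 x) (f1 x) (V0 x) (V1 x))
    simp only [← Complex.ofReal_mul, ← ofReal_E] at this
    simp only [Complex.norm_real] at this
    refine this.trans ?_
    rw [← hQ]
    have t1 : 2 * (Z:ℝ) / M ≤ 2 * ζ := by
      rw [div_le_iff₀ Mr]
      have : (Z:ℝ) * 1 ≤ Z * (Z * (Q * (Z * n)) * ζ) := by
        rw [show (Z:ℝ) * (Q * (Z * n)) * ζ = (ζ * Z) * (Q * (Z * n)) by ring, ζZ, one_mul]
        have : 1 ≤ (Q:ℝ) * (Z * n) := one_le_mul_of_one_le_of_one_le Qr (one_le_mul_of_one_le_of_one_le Z1 nr)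
        gcongr
      have : ζ * (Q * (Z * (Z * n)) * Z) ≤ ζ * M := by gcongr
      linarith
    refine add_le_add t1 ?_
    rw [Real.sqrt_le_left (by positivity)]
    have t2 : 𝔼 x, ‖𝔼 j : Fin (Z * (Z * n)), (f (x + (2 * P * Q * j : ℤ) • e) - V (x + (2 * P * Q * j : ℤ) • e))‖ ≤ 2 * ζ := by
      refine E_le_const (by positivity) fun x => ?_
      have : 𝔼 j : Fin (Z * (Z * n)), (f (x + (2 * P * Q * j : ℤ) • e) - V (x + (2 * P * Q * j : ℤ) • e)) = T s (Z * (Z * n)) (fun x => f x - V x) x := by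
        refine E_congR fun j => ?_
        simp only [hs, ← mul_smul]
        rw [mul_comm (j:ℤ)]
      rw [this, T_sub, hV, T_comm, Real.norm_eq_abs, abs_sub_comm]
      refine (AI_near (T_AI fb) (by positivity) Zn0 x).trans (le_of_eq ?_)
      push_cast; rw [hζ]; field_simp
    have t3 : 2 * ((Q * (Z * (Z * n)) : ℕ) : ℝ) / M ≤ 2 * ζ := by
      rw [div_le_iff₀ Mr]; push_cast
      have : ζ * (Q * (Z * (Z * n)) * Z) ≤ ζ * M := by gcongr
      have e2 : ζ * ((Q:ℝ) * (Z * (Z * n)) * Z) = (ζ * Z) * (Q * (Z * (Z * n))) := by ring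
      rw [e2, ζZ] at this; linarith
    rw [← hζ]
    have : (ε^3/4)^2 = ε^6/16 := by ring
    have : 0 < ε^6 := by positivity
    linarith
  set U : G → ℝ := fun x => 6 * ε - V x with hU
  have U0 : ∀ x, 0 ≤ U x := fun x => by simp only [hU]; linarith [b3 x]
  have U1 : ∀ x, U x ≤ 3/2 := fun x => by simp only [hU]; linarith [V0 x]
  set H : G → ℝ := fun x => 𝔼 y : Y M, U (x + (P * yy y ^ 2 : ℤ) • e) with hH
  have H0 : ∀ x, 0 ≤ H x := fun x => E_nonneg fun y => U0 _
  have H1 : ∀ x, H x ≤ 3/2 := fun x => E_le_const (by norm_num) fun y => U1 _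
  have UA : AI s (2 / (Z * n : ℕ)) U := by
    intro x i
    have := T_AI (s := s) (J := Z * n) fb x i
    simp only [hU, sub_sub_sub_cancel_left]; rw [abs_sub_comm]; exact this
  have HA : AI s (2 / (Z * n : ℕ)) H := by
    intro x i
    simp only [hH]; rw [← expect_sub_distrib]
    refine (abs_E _).trans (E_le_const (by positivity) fun y => ?_)
    have := UA (x + (P * yy y ^ 2 : ℤ) • e) i
    rwa [add_right_comm] at this
  have SA2 : AI s (2 / J * (2 * (q * R * Q) : ℕ)) S := by rw [rs]; exact AI_smul SA _
  set B : G → ℝ := fun x => S x * H x with hB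
  have B0 : ∀ x, 0 ≤ B x := fun x => mul_nonneg (S0 x) (H0 x)
  obtain ⟨κ, hκ⟩ : ∃ κ : ℝ, κ = 2 / (Z * n : ℕ) + 3/2 * (2 / J * (2 * (q * R * Q) : ℕ)) := ⟨_, rfl⟩
  have κ0 : 0 ≤ κ := by rw [hκ]; positivity
  have BA : AI s κ B := by
    intro x i
    have h3 := HA x i
    have h4 := SA2 x i
    have : B (x + (i:ℤ) • s) - B x = S x * (H (x + (i:ℤ) • s) - H x) + H (x + (i:ℤ) • s) * (S (x + (i:ℤ) • s) - S x) := by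
      simp only [hB]; ring
    rw [this]
    refine (abs_add_le _ _).trans ?_
    rw [abs_mul, abs_mul, abs_of_nonneg (H0 _), hκ]
    have p1 := mul_le_of_le_one_left (abs_nonneg (H (x + (i:ℤ) • s) - H x)) (Sb x)
    have p2 := mul_le_mul (H1 (x + (i:ℤ) • s)) h4 (abs_nonneg _) (by norm_num)
    linarith
  have κn : κ * n ≤ 5 * ζ := by
    have p1 : 2 / ((Z * n : ℕ):ℝ) * n = 2 * ζ := by push_cast; rw [hζ]; field_simp
    have p2 : 3/2 * (2 / (J:ℝ) * (2 * (q * R * Q) : ℕ)) * n ≤ 3 * ζ := by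
      rw [show 3/2 * (2 / (J:ℝ) * (2 * (q * R * Q) : ℕ)) * n = 3 * ((2 * ((q:ℝ) * R * Q * n)) / J) by push_cast; ring]
      have : (2 * ((q:ℝ) * R * Q * n)) / J ≤ ζ := by
        rw [hζ, div_le_div_iff₀ Jr Zr]; linarith
      linarith
    rw [hκ, add_mul]; linarith
  have g1 : 𝔼 x, f x * B x ≤ 6 * ε * 𝔼 x, B x + 5 * ζ := by
    have : |𝔼 x, f x * T (-s) n B x - 𝔼 x, f x * B x| ≤ 5 * ζ :=
      E_near (by positivity) fb fun x => (AI_near (AI_neg BA) κ0 n0 x).trans κn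
    rw [← T_adj] at this
    have p := (abs_le.1 this).1
    have p2 : 𝔼 x, T s n f x * B x ≤ 6 * ε * 𝔼 x, B x := by
      rw [mul_expect]; exact E_mono fun x => mul_le_mul_of_nonneg_right (b2 x) (B0 x)
    linarith
  obtain ⟨μ, hμe⟩ : ∃ μ, μ = 𝔼 x, f x := ⟨_, rfl⟩
  rw [← hμe] at hμ
  have EU : 𝔼 x, U x = 6 * ε - μ := by
    simp only [hU]; rw [expect_sub_distrib, E_constR, hV, E_T Zn0, hμe]
  have EH : 𝔼 x, H x = 6 * ε - μ := by
    simp only [hH]; rw [E_commR, E_congR fun y : Y M => E_shiftR U ((P * yy y ^ 2 : ℤ) • e), E_constR, EU]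
  have g2 : 𝔼 x, B x ≤ 6 * ε * (6 * ε - μ) := by
    rw [← EH, mul_expect]; exact E_mono fun x => mul_le_mul_of_nonneg_right (S2 x) (H0 x)
  have g3 : μ^2 ≤ 𝔼 x, k x := by
    rw [fS, hμe, ← E_T (s := r) J0]; exact E_sq_le _
  have g4 : 𝔼 x, k x * 𝔼 y : Y M, V (x + (P * yy y ^ 2 : ℤ) • e) = 6 * ε * 𝔼 x, k x - 𝔼 x, f x * B x := by
    rw [mul_expect, ← expect_sub_distrib]
    refine E_congR fun x => ?_
    have : 𝔼 y : Y M, V (x + (P * yy y ^ 2 : ℤ) • e) = 6 * ε - H x := by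
      simp only [hH, hU]; rw [expect_sub_distrib, E_constR]; ring
    rw [this]; simp only [hB, hk]; ring
  have g5 : 𝔼 x, k x * 𝔼 y : Y M, V (x + (P * yy y ^ 2 : ℤ) • e) = 𝔼 x, k x * 𝔼 y : Y M, f (x + (P * yy y ^ 2 : ℤ) • e) -
      𝔼 x, k x * 𝔼 y : Y M, (f (x + (P * yy y ^ 2 : ℤ) • e) - V (x + (P * yy y ^ 2 : ℤ) • e)) := by
    rw [← expect_sub_distrib]
    refine E_congR fun x => ?_
    rw [expect_sub_distrib]; ring
  have g6 := (abs_le.1 d9).2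
  have g7 := (abs_le.1 d10).1
  have g8 : 6 * ε * 𝔼 x, B x ≤ 6 * ε * (6 * ε * (6 * ε - μ)) := by gcongr
  have g9 : 6 * ε * μ^2 ≤ 6 * ε * 𝔼 x, k x := by gcongr
  have g10 : 6 * ε * μ^2 - 6 * ε * (6 * ε * (6 * ε - μ)) ≤ ε^4 + 17 * ζ + ε^3/4 := by linarith
  have g11 : ε^4 ≤ ε^3/4 := by
    rw [pow_succ]; have : 0 ≤ ε^3 := by positivity
    nlinarith
  have g12 : ε^6 ≤ ε^3 := pow_le_pow_of_le_one ε0.le (by linarith) (by norm_num)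
  have e3 : 0 < ε^3 := by positivity
  have g13 : 6 * ε * (3.96 * ε)^2 ≤ 6 * ε * μ^2 := by gcongr
  have g14 : 6 * ε * (6 * ε * (6 * ε - μ)) ≤ 6 * ε * (6 * ε * (6 * ε - 3.96 * ε)) := by gcongr
  have g15 : 6 * ε * (3.96 * ε)^2 - 6 * ε * (6 * ε * (6 * ε - 3.96 * ε)) = (6 * 3.96^2 - 36 * 2.04) * ε^3 := by ring
  have g16 : ((6:ℝ) * 3.96^2 - 36 * 2.04) * ε^3 ≥ 20 * ε^3 := by gcongr; norm_num
  linarith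

lemma pigeon (E : ℕ → ℝ) (h0 : ∀ k, 0 ≤ E k) (h1 : ∀ k, E k ≤ 1) (Z : ℕ) (hZ : 0 < Z) : ∃ k < Z, E (k+1) ≤ E k + 1 / Z := by
  by_contra hcon
  push Not at hcon
  have h : ∀ m ≤ Z, 0 < m → E 0 + m / Z < E m := by
    intro m
    induction m with
    | zero => intro _ h; omega
    | succ m ih =>
      intro hm _
      have h2 := hcon m (by omega)
      rcases Nat.eq_zero_or_pos m with rfl | hm0
      · simpa using h2
      · have := ih (by omega) hm0
        push_cast; rw [add_div]; linarith
  have h2 := h Z le_rfl hZ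
  rw [div_self (by positivity)] at h2
  linarith [h0 0, h1 Z]

def Jf (n Z k : ℕ) : ℕ := n * (2 * Z.factorial^(Z+1) * Z^3 * (Z^2 * Z.factorial)^(Z-k))

lemma core2 : ∃ C : ℕ, ∀ (G : Type) [AddCommGroup G] [Fintype G] (e : G) (f : G → ℝ) (q Z n : ℕ) (ε : ℝ),
    0 < q → 0 < Z → 0 < n → 0 < ε → ε ≤ 1/4 → 1 ≤ ε^C * Z →
    (∀ x, 0 ≤ f x) → (∀ x, f x ≤ 1) → 3.96 * ε ≤ 𝔼 x, f x →
    (∀ k < Z, ∀ x, T (((q * Z.factorial^k : ℕ) : ℤ) • e) (Jf n Z k) f x ≤ 6 * ε) →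
    (∀ k < Z, ∀ x, T (((q * (2 * (Z.factorial^k)^2 * Z.factorial) : ℕ) : ℤ) • e) n f x ≤ 6 * ε) →
    (∀ k < Z, ∀ x, T (((q * (2 * (Z.factorial^k)^2 * Z.factorial) : ℕ) : ℤ) • e) (Z * n) f x ≤ 6 * ε) →
    (∀ k < Z, ∀ y : ℤ, 1 ≤ y → y ≤ 5 * (Z * (Z.factorial * (Jf n Z (k+1) * q)) : ℕ) → ∀ x,
      f x * f (x + ((Z.factorial^k : ℕ) * y : ℤ) • e) * f (x + ((q * (Z.factorial^k)^2 : ℕ) * y ^ 2 : ℤ) • e) = 0) → False := by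
  obtain ⟨C, h⟩ := core
  refine ⟨C, fun G _ _ e f q Z n ε q0 Z0 n0 ε0 ε1 hZ f0 f1 hμ b1 b2 b3 hv => ?_⟩
  have : Nonempty G := ⟨0⟩
  have Q0 : 0 < Z.factorial := Nat.factorial_pos _
  have Jp : ∀ k, 0 < Jf n Z k := fun k => by unfold Jf; positivity
  obtain ⟨k, hk, hE⟩ := pigeon (fun k => 𝔼 x, T (((Z.factorial^k : ℕ):ℤ) • e) (Jf n Z k * q) f x ^ 2) (fun k => E_nonneg fun x => sq_nonneg _)
    (fun k => E_le_const zero_le_one fun x => pow_le_one₀ (T_nn f0 x) (T_le zero_le_one f1 x)) Z Z0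
  have hJ : Jf n Z k * q = Z * (Z * (Z.factorial * (Jf n Z (k+1) * q))) := by
    unfold Jf
    rw [show Z - k = Z - (k+1) + 1 by omega, pow_succ]; ring
  have hge : 2 * Z.factorial^(Z+1) * Z^3 * n ≤ Jf n Z (k+1) := by
    unfold Jf
    rw [mul_comm]; refine Nat.mul_le_mul_left _ (Nat.le_mul_of_pos_right _ (by positivity))
  have hQk : Z.factorial^k ≤ Z.factorial^Z := Nat.pow_le_pow_right Q0 hk.le
  refine h G e f q (Z.factorial^k) Z n (Z * (Z.factorial * (Jf n Z (k+1) * q))) (Jf n Z k) (Jf n Z (k+1) * q) ε q0 (by positivity) Z0 n0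
    (Nat.mul_pos (Jp _) q0) ε0 ε1 hZ f0 f1 rfl hJ ?_ ?_ hμ ?_ ?_ ?_ ?_ ?_
  · calc 2 * (q * Z.factorial^k * Z.factorial * n * Z) ≤ 2 * (q * Z.factorial^Z * Z.factorial * n * Z) := by gcongr
      _ = (2 * Z.factorial^(Z+1) * Z * n) * q := by ring
      _ ≤ (2 * Z.factorial^(Z+1) * Z^3 * n) * q := by gcongr; exact Nat.le_self_pow (by norm_num) Z
      _ ≤ Jf n Z (k+1) * q := by gcongr
      _ ≤ _ := by
        rw [← mul_assoc, ← mul_assoc]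
        exact Nat.le_mul_of_pos_left _ (by positivity)
  · calc Z.factorial * (Z * (Z * n)) * Z = Z * (Z.factorial * (Z * Z * n)) := by ring
      _ ≤ Z * (Z.factorial * (Jf n Z (k+1) * q)) := by
        refine Nat.mul_le_mul_left _ (Nat.mul_le_mul_left _ ?_)
        refine le_trans ?_ (Nat.le_mul_of_pos_right _ q0)
        refine le_trans ?_ hge
        refine Nat.mul_le_mul_right _ ?_
        calc Z * Z = 1 * Z^2 := by ring
          _ ≤ (2 * Z.factorial^(Z+1)) * Z^3 := Nat.mul_le_mul (Nat.succ_le_of_lt (by positivity)) (Nat.pow_le_pow_right Z0 (by norm_num))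
  · intro x; have := b1 k hk x; push_cast at this ⊢; exact this
  · intro x; have := b2 k hk x; push_cast at this ⊢
    rwa [show (q:ℤ) * (2 * ((Z.factorial:ℤ)^k)^2 * Z.factorial) = 2 * (q * ((Z.factorial:ℤ)^k)^2) * Z.factorial by ring] at this
  · intro x; have := b3 k hk x; push_cast at this ⊢
    rwa [show (q:ℤ) * (2 * ((Z.factorial:ℤ)^k)^2 * Z.factorial) = 2 * (q * ((Z.factorial:ℤ)^k)^2) * Z.factorial by ring] at this
  · rw [← hJ]; push_cast [pow_succ] at hE ⊢; exact hE
  · refine Eq.trans (E_congR fun x => Eq.trans (E_congR fun y => hv k hk (yy y) (yy_bd y).1 (yy_bd y).2 x) (expect_const_zero _)) (expect_const_zero _)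

noncomputable def fA (A : Finset ℤ) (n : ℕ) (x : ZMod n) : ℝ := if (x.val : ℤ) ∈ A then 1 else 0

lemma fA_nn (A n x) : 0 ≤ fA A n x := by unfold fA; split_ifs <;> norm_num
lemma fA_le (A n x) : fA A n x ≤ 1 := by unfold fA; split_ifs <;> norm_num

lemma ap_count (N Δ S L : ℕ) (hS : 0 < S) (hSL : S * L ≤ Δ) (A : Finset ℤ) (hA : A ⊆ Icc (1:ℤ) N) [NeZero (N+Δ)] (x : ZMod (N+Δ)) :
    ∃ a : ℤ, L * T ((S:ℤ) • (1 : ZMod (N+Δ))) L (fA A (N+Δ)) x ≤ ((A ∩ (Icc (1:ℤ) L).image (fun k => a + S * k)).card : ℝ) := by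
  classical
  suffices h : ∃ a : ℤ, ∀ j : Fin L, ((x + (j:ℤ) • (S:ℤ) • (1 : ZMod (N+Δ))).val : ℤ) ∈ A → a + S * (j + 1) ∈ A by
    obtain ⟨a, ha⟩ := h
    refine ⟨a, ?_⟩
    rcases Nat.eq_zero_or_pos L with L0 | L0
    · subst L0; simp
    unfold T
    rw [Fintype.expect_eq_sum_div_card, Fintype.card_fin, mul_div_cancel₀ _ (by positivity)]
    unfold fA
    rw [← sum_filter, sum_const, nsmul_eq_mul, mul_one]
    norm_cast
    refine card_le_card_of_injOn (fun j => a + S * (((j:ℕ):ℤ) + 1)) ?_ ?_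
    · intro j hj
      have hj := (mem_filter.1 hj).2
      refine mem_inter.2 ⟨ha j (by exact_mod_cast hj), mem_image.2 ⟨((j:ℕ):ℤ)+1, ?_, rfl⟩⟩
      have := j.2; rw [mem_Icc]; omega
    · intro i _ j _ hij
      have hS' : (S:ℤ) ≠ 0 := by positivity
      have h := mul_left_cancel₀ hS' (add_left_cancel hij)
      ext; omega
  have jb : ∀ j : Fin L, S * (j+1) ≤ Δ := fun j => (Nat.mul_le_mul_left _ j.2).trans hSL
  have ev : ∀ j : Fin L, x + (j:ℤ) • (S:ℤ) • (1 : ZMod (N+Δ)) = x + ((j * S : ℤ) : ZMod (N+Δ)) := fun j => by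
    rw [← mul_smul, zsmul_one]
  have xl := ZMod.val_lt x
  by_cases hx : x.val ≤ N
  · refine ⟨x.val - S, fun j hj => ?_⟩
    have := jb j
    rw [Nat.mul_add] at this
    rw [ev, val_add_int x _ (by positivity) (by
      have : x.val + j * S < N + Δ := by rw [mul_comm]; omega
      exact_mod_cast this)] at hj
    convert hj using 1; ring
  · refine ⟨x.val - (N+Δ : ℕ) - S, fun j hj => ?_⟩
    have := jb j
    rw [Nat.mul_add, mul_comm S] at this
    by_cases hlt : x.val + j * S < N + Δ
    · rw [ev, val_add_int x _ (by positivity) (by exact_mod_cast hlt)] at hj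
      have := (mem_Icc.1 (hA hj)).2
      have : x.val + j * S ≤ N := by exact_mod_cast this
      omega
    · have e1 : x + ((j * S : ℤ) : ZMod (N+Δ)) = ((x.val + j * S - (N+Δ) : ℕ) : ZMod (N+Δ)) := by
        rw [Nat.cast_sub (by omega), ZMod.natCast_self]; push_cast; rw [ZMod.natCast_zmod_val]; ring
      rw [ev, e1, ZMod.val_natCast, Nat.mod_eq_of_lt (by omega), Nat.cast_sub (by omega)] at hj
      convert hj using 1; push_cast; ring

lemma E_fA (N Δ : ℕ) (A : Finset ℤ) (hA : A ⊆ Icc (1:ℤ) N) (hΔ : 0 < Δ) [NeZero (N+Δ)] : 𝔼 x, fA A (N+Δ) x = A.card / ((N:ℝ) + Δ) := by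
  classical
  unfold fA
  rw [E_val (fun i => if (i:ℤ) ∈ A then (1:ℝ) else 0), ← sum_filter, sum_const, nsmul_eq_mul, mul_one]
  push_cast; congr 2
  refine card_nbij' (fun i => (i:ℤ)) Int.toNat ?_ ?_ ?_ ?_
  · intro i hi; exact (mem_filter.1 hi).2
  · intro z hz
    have := mem_Icc.1 (hA hz)
    refine mem_filter.2 ⟨mem_range.2 (by omega), ?_⟩
    rwa [Int.toNat_of_nonneg (by omega)]
  · intro i _; simp
  · intro z hz
    have := mem_Icc.1 (hA hz)
    exact Int.toNat_of_nonneg (by omega)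

def XX (Z : ℕ) : ℕ := 2 * Z.factorial^(2*Z+1) * Z^3 * (Z^2 * Z.factorial)^Z

lemma XX_le (Z : ℕ) (hZ : 0 < Z) : (XX Z : ℝ) ≤ Real.exp (10 * Z^3) := by
  have Z1 : (1:ℝ) ≤ Z := by exact_mod_cast hZ
  have hz : (Z:ℝ) ≤ Real.exp Z := by linarith [Real.add_one_le_exp (Z:ℝ)]
  have h2 : (2:ℝ) ≤ Real.exp Z := by linarith [Real.add_one_le_exp (Z:ℝ)]
  have hQ : (Z.factorial : ℝ) ≤ Real.exp (Z * Z) := by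
    rw [Real.exp_nat_mul]
    calc (Z.factorial:ℝ) ≤ (Z:ℝ)^Z := by exact_mod_cast Nat.factorial_le_pow Z
      _ ≤ _ := pow_le_pow_left₀ (by positivity) hz _
  have Z3 : (Z:ℝ) ≤ Z^3 := le_self_pow₀ Z1 (by norm_num)
  have Z2 : (Z:ℝ)^2 ≤ Z^3 := pow_le_pow_right₀ Z1 (by norm_num)
  unfold XX; push_cast
  calc (2:ℝ) * (Z.factorial:ℝ)^(2*Z+1) * Z^3 * (Z^2 * Z.factorial)^Z
      ≤ Real.exp Z * (Real.exp (Z*Z))^(2*Z+1) * (Real.exp Z)^3 * ((Real.exp Z)^2 * Real.exp (Z*Z))^Z := by gcongr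
    _ = Real.exp (Z + (2*Z+1) * (Z*Z) + 3 * Z + Z * (2 * Z + Z * Z)) := by
      simp only [← Real.exp_nat_mul, ← Real.exp_add]
      congr 1; push_cast; ring
    _ ≤ _ := Real.exp_le_exp.2 (by nlinarith)

lemma core3 : ∃ C : ℕ, ∀ (q N Z n : ℕ) (δ : ℝ) (A : Finset ℤ), 0 < q → 0 < N → 0 < Z → 0 < n → 0 < δ → δ ≤ 1 → 1 ≤ (δ/4)^C * Z →
    A ⊆ Icc (1:ℤ) N → 26 * (q^3 * n^2 * XX Z^2) * 100 ≤ N → δ * N ≤ A.card →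
    (¬ ∃ x y : ℤ, y ≠ 0 ∧ x ∈ A ∧ x + y ∈ A ∧ x + (q : ℤ) * y ^ 2 ∈ A) →
    ∃ (q' N' : ℕ) (a : ℤ), 0 < q' ∧ q' ≤ XX Z ∧ n ≤ N' ∧
      (1 + 1/200) * δ * N' ≤ ((A ∩ (Icc (1:ℤ) N').image (fun k => a + (q:ℤ) * q' * k)).card : ℝ) := by
  obtain ⟨C, h⟩ := core2
  refine ⟨C, fun q N Z n δ A q0 N0 Z0 n0 δ0 δ1 hZ hA hN hd hc => ?_⟩
  by_contra hcon
  push Not at hcon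
  have Q0 : 0 < Z.factorial := Nat.factorial_pos _
  have X0 : 0 < XX Z := by unfold XX; positivity
  obtain ⟨Δ, hΔ⟩ : ∃ Δ, Δ = 26 * (q^3 * n^2 * XX Z^2) := ⟨_, rfl⟩
  rw [← hΔ] at hN
  have Δ0 : 0 < Δ := by rw [hΔ]; positivity
  have : NeZero (N+Δ) := ⟨by omega⟩
  have qn0 : 0 < q * n * XX Z := by positivity
  have hΔ1 : 26 * (q * (q * n * XX Z)^2) = Δ := by rw [hΔ]; ring
  have hsm : 5 * (q * n * XX Z) < Δ := by
    have : 1 * (q * n * XX Z)^2 ≤ q * (q * n * XX Z)^2 := Nat.mul_le_mul_right _ q0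
    nlinarith
  have hk1 : ∀ k < Z, Z.factorial^k * Jf n Z k ≤ n * XX Z := by
    intro k hk
    unfold Jf XX
    calc Z.factorial^k * (n * (2 * Z.factorial^(Z+1) * Z^3 * (Z^2 * Z.factorial)^(Z-k)))
        ≤ Z.factorial^Z * (n * (2 * Z.factorial^(Z+1) * Z^3 * (Z^2 * Z.factorial)^Z)) := by
          gcongr
          · exact Nat.succ_le_of_lt (by positivity)
          · exact Nat.sub_le _ _
      _ = _ := by rw [show 2 * Z + 1 = Z + (Z + 1) by ring, pow_add _ Z (Z+1)]; ring
  have hk2 : ∀ k < Z, 2 * (Z.factorial^k)^2 * Z.factorial * Z ≤ XX Z := by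
    intro k hk
    unfold XX
    calc 2 * (Z.factorial^k)^2 * Z.factorial * Z ≤ 2 * (Z.factorial^Z)^2 * Z.factorial * Z^3 := by
          gcongr
          · exact Nat.le_self_pow (by norm_num) Z
      _ = 2 * Z.factorial^(2*Z+1) * Z^3 := by rw [← pow_mul, mul_comm Z 2, pow_succ]; ring
      _ ≤ _ := Nat.le_mul_of_pos_right _ (by positivity)
  have hk3 : ∀ k < Z, 2 * (Z.factorial^k)^2 * Z.factorial ≤ XX Z := fun k hk => (Nat.le_mul_of_pos_right _ Z0).trans (hk2 k hk)
  have hk4 : ∀ k < Z, Z.factorial^k ≤ XX Z := fun k hk => by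
    refine le_trans ?_ (hk3 k hk)
    calc Z.factorial^k ≤ (Z.factorial^k)^2 := Nat.le_self_pow (by norm_num) _
      _ ≤ 2 * (Z.factorial^k)^2 * Z.factorial := by
        rw [mul_assoc, mul_comm ((Z.factorial^k)^2), ← mul_assoc]; exact Nat.le_mul_of_pos_left _ (by positivity)
  have hJn : ∀ k, n ≤ Jf n Z k := fun k => by unfold Jf; exact Nat.le_mul_of_pos_right _ (by positivity)
  have key : ∀ p L : ℕ, 0 < p → p ≤ XX Z → n ≤ L → p * L ≤ n * XX Z → ∀ x, T (((q * p : ℕ):ℤ) • (1 : ZMod (N+Δ))) L (fA A (N+Δ)) x ≤ 6 * (δ/4) := by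
    intro p L p0 pX nL hpL x
    obtain ⟨a, ha⟩ := ap_count N Δ (q * p) L (by positivity) (by
      calc q * p * L = q * (p * L) := by ring
        _ ≤ q * (n * XX Z) := Nat.mul_le_mul_left _ hpL
        _ = q * n * XX Z := by ring
        _ ≤ Δ := by omega) A hA x
    have h2 := hcon p L a p0 pX nL
    push_cast at ha
    have L0 : (0:ℝ) < L := by exact_mod_cast (by omega : 0 < L)
    have : (L:ℝ) * T (((q * p : ℕ):ℤ) • (1 : ZMod (N+Δ))) L (fA A (N+Δ)) x ≤ L * ((1 + 1/200) * δ) := by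
      push_cast; linarith
    have := le_of_mul_le_mul_left this L0
    linarith
  refine h (ZMod (N+Δ)) 1 (fA A (N+Δ)) q Z n (δ/4) q0 Z0 n0 (by linarith) (by linarith) hZ (fA_nn A _) (fA_le A _) ?_ ?_ ?_ ?_ ?_
  · rw [E_fA N Δ A hA Δ0, le_div_iff₀ (by positivity)]
    have : (Δ:ℝ) * 100 ≤ N := by exact_mod_cast hN
    nlinarith
  · exact fun k hk => key _ _ (by positivity) (hk4 k hk) (hJn k) (hk1 k hk)
  · refine fun k hk => key _ _ (by positivity) (hk3 k hk) le_rfl ?_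
    rw [mul_comm]; exact Nat.mul_le_mul_left _ (hk3 k hk)
  · refine fun k hk => key _ _ (by positivity) (hk3 k hk) (Nat.le_mul_of_pos_left _ Z0) ?_
    calc _ = n * (2 * (Z.factorial^k)^2 * Z.factorial * Z) := by ring
      _ ≤ _ := Nat.mul_le_mul_left _ (hk2 k hk)
  · intro k hk y y1 y2 x
    have hJ : Z * (Z.factorial * (Jf n Z (k+1) * q)) ≤ q * Jf n Z k := by
      have : q * Jf n Z k = Z * (Z * (Z.factorial * (Jf n Z (k+1) * q))) := by
        unfold Jf
        rw [show Z - k = Z - (k+1) + 1 by omega, pow_succ]; ring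
      rw [this]; exact Nat.le_mul_of_pos_left _ Z0
    lift y to ℕ using by omega
    have y3 : Z.factorial^k * y ≤ 5 * (q * n * XX Z) := by
      have : y ≤ 5 * (q * Jf n Z k) := by
        have : y ≤ 5 * (Z * (Z.factorial * (Jf n Z (k+1) * q))) := by exact_mod_cast y2
        omega
      calc Z.factorial^k * y ≤ Z.factorial^k * (5 * (q * Jf n Z k)) := Nat.mul_le_mul_left _ this
        _ = 5 * (q * (Z.factorial^k * Jf n Z k)) := by ring
        _ ≤ 5 * (q * (n * XX Z)) := Nat.mul_le_mul_left _ (Nat.mul_le_mul_left _ (hk1 k hk))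
        _ = _ := by ring
    obtain ⟨w, hw⟩ : ∃ w, w = Z.factorial^k * y := ⟨_, rfl⟩
    have w0 : 0 < w := by rw [hw]; exact Nat.mul_pos (by positivity) (by exact_mod_cast y1)
    rw [← hw] at y3
    have w2 : q * w^2 < Δ := by
      have : q * w^2 ≤ q * (5 * (q * n * XX Z))^2 := by gcongr
      have : 0 < q * (q * n * XX Z)^2 := by positivity
      nlinarith
    have e1 : ((Z.factorial^k : ℕ) * (y:ℤ) : ℤ) • (1 : ZMod (N+Δ)) = ((w:ℤ) : ZMod (N+Δ)) := by
      rw [zsmul_one, hw]; push_cast; rfl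
    have e2 : ((q * (Z.factorial^k)^2 : ℕ) * (y:ℤ)^2 : ℤ) • (1 : ZMod (N+Δ)) = (((q * w^2 : ℕ):ℤ) : ZMod (N+Δ)) := by
      rw [zsmul_one, hw]; push_cast; ring
    rw [e1, e2]
    by_contra hne
    have n1 : ∀ z, fA A (N+Δ) z ≠ 0 → (z.val : ℤ) ∈ A := fun z hz => by
      by_contra hz'; exact hz (if_neg hz')
    have m0 := n1 _ (left_ne_zero_of_mul (left_ne_zero_of_mul hne))
    have m1 := n1 _ (right_ne_zero_of_mul (left_ne_zero_of_mul hne))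
    have m2 := n1 _ (right_ne_zero_of_mul hne)
    have xN := (mem_Icc.1 (hA m0)).2
    rw [val_add_int x _ (by positivity) (by push_cast; omega)] at m1
    rw [val_add_int x _ (by positivity) (by
      have : (((q * w^2 : ℕ)):ℤ) < Δ := by exact_mod_cast w2
      push_cast at this ⊢; omega)] at m2
    exact hc ⟨x.val, w, by positivity, m0, m1, by push_cast at m2; exact m2⟩

end NR

theorem density_increment_lemma :
    ∃ C c : ℝ, 0 < C ∧ 0 < c ∧
      ∀ (q N : ℕ), 0 < q → q ≤ N → ∀ δ : ℝ, 0 < δ →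
        ∀ A : Finset ℤ, A ⊆ Finset.Icc (1 : ℤ) (N : ℤ) →
          δ * N ≤ (A.card : ℝ) →
          (¬ ∃ x y : ℤ, y ≠ 0 ∧ x ∈ A ∧ x + y ∈ A ∧ x + (q : ℤ) * y ^ 2 ∈ A) →
          ((N : ℝ) ≤ C * ((q : ℝ) / δ) ^ C ∨
            ∃ (q' N' : ℕ) (a : ℤ), 0 < q' ∧ 0 < N' ∧
              (q' : ℝ) ≤ Real.exp (C * δ ^ (-C)) ∧
              c * (q : ℝ) ^ (-C) * Real.exp (-C * δ ^ (-C)) * Real.sqrt N ≤ (N' : ℝ) ∧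
              (1 + c) * δ * N' ≤
                ((A ∩ (Finset.Icc (1 : ℤ) (N' : ℤ)).image
                    (fun k => a + (q : ℤ) * (q' : ℤ) * k)).card : ℝ)) := by
  obtain ⟨C0, hcore⟩ := NR.core3
  obtain ⟨K, hK⟩ : ∃ K : ℝ, K = 80 * (4:ℝ)^(3*C0) := ⟨_, rfl⟩
  have K0 : 0 < K := by rw [hK]; positivity
  obtain ⟨E, hE⟩ : ∃ E : ℝ, E = Real.exp (K * 2^(3*C0)) := ⟨_, rfl⟩
  have E0 : 0 < E := by rw [hE]; positivity
  obtain ⟨C, hC⟩ : ∃ C : ℝ, C = K + 3*C0 + 3 + 2600 * E^2 := ⟨_, rfl⟩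
  have CK : K ≤ C := by rw [hC]; have := sq_nonneg E; have : (0:ℝ) ≤ 3 * C0 := by positivity
                        linarith
  have C3 : (3:ℝ) ≤ C := by rw [hC]; have := sq_nonneg E; have : (0:ℝ) ≤ 3 * C0 := by positivity
                            linarith
  have CC : ((3*C0:ℕ):ℝ) ≤ C := by rw [hC]; have := sq_nonneg E; push_cast; linarith
  have CE : 2600 * E^2 ≤ C := by rw [hC]; have : (0:ℝ) ≤ 3 * C0 := by positivity
                                 linarith
  refine ⟨C, 1/200, by linarith, by norm_num, fun q N q0 hqN δ δ0 A hA hd hc => ?_⟩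
  have N0 : 0 < N := by omega
  have Nr : (0:ℝ) < N := by exact_mod_cast N0
  have qr : (1:ℝ) ≤ q := by exact_mod_cast q0
  have δ1 : δ ≤ 1 := by
    have := Finset.card_le_card hA
    rw [Int.card_Icc] at this
    have : (A.card:ℝ) ≤ N := by exact_mod_cast (by omega : A.card ≤ N)
    have : δ * N ≤ 1 * N := by linarith
    exact le_of_mul_le_mul_right this Nr
  obtain ⟨Z, hZ⟩ : ∃ Z, Z = ⌈(4/δ)^C0⌉₊ := ⟨_, rfl⟩
  have p0 : 1 ≤ (4/δ)^C0 := one_le_pow₀ (by rw [le_div_iff₀ δ0]; linarith)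
  have Z1 : (4/δ)^C0 ≤ Z := by rw [hZ]; exact Nat.le_ceil _
  have Z2 : (Z:ℝ) ≤ 2 * (4/δ)^C0 := by
    have := (Nat.ceil_lt_add_one (by linarith : 0 ≤ (4/δ)^C0)).le
    rw [← hZ] at this; linarith
  have Z0 : 0 < Z := by
    have : (0:ℝ) < Z := by linarith
    exact_mod_cast this
  have Z3 : 1 ≤ (δ/4)^C0 * Z := by
    calc (1:ℝ) = (δ/4)^C0 * (4/δ)^C0 := by rw [← mul_pow]; field_simp; simp
      _ ≤ _ := by gcongr
  have X0 : 0 < NR.XX Z := by unfold NR.XX; have := Nat.factorial_pos Z; positivity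
  have Xr : (1:ℝ) ≤ NR.XX Z := by exact_mod_cast X0
  have X1 : (NR.XX Z : ℝ) ≤ Real.exp (K * (1/δ)^(3*C0)) := by
    refine (NR.XX_le Z Z0).trans (Real.exp_le_exp.2 ?_)
    calc 10 * (Z:ℝ)^3 ≤ 10 * (2 * (4/δ)^C0)^3 := by gcongr
      _ = K * (1/δ)^(3*C0) := by
        rw [hK, mul_pow, ← pow_mul, mul_comm C0 3, div_pow, div_pow, one_pow]; ring
  have X2 : (NR.XX Z : ℝ) ≤ Real.exp (C * δ^(-C)) := by
    refine X1.trans (Real.exp_le_exp.2 ?_)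
    have : (1/δ)^(3*C0) ≤ δ^(-C) := by
      rw [Real.rpow_neg δ0.le, ← Real.inv_rpow δ0.le, one_div, ← Real.rpow_natCast]
      exact Real.rpow_le_rpow_of_exponent_le ((one_le_inv₀ δ0).2 δ1) CC
    exact mul_le_mul CK this (by positivity) (by linarith)
  obtain ⟨X, hX⟩ : ∃ X, X = NR.XX Z := ⟨_, rfl⟩
  rw [← hX] at X0 Xr X1 X2
  have qC : (q:ℝ)^(-C) ≤ 1 / (q:ℝ)^2 := by
    rw [Real.rpow_neg (by positivity), ← one_div]
    refine one_div_le_one_div_of_le (by positivity) ?_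
    rw [← Real.rpow_natCast]
    exact Real.rpow_le_rpow_of_exponent_le qr (by push_cast; linarith)
  have eC : Real.exp (-C * δ^(-C)) ≤ 1 / X := by
    rw [neg_mul, Real.exp_neg, ← one_div]
    exact one_div_le_one_div_of_le (by linarith) X2
  have low : ∀ N' : ℝ, Real.sqrt N ≤ 200 * (q^2 * X) * N' → 1/200 * (q:ℝ)^(-C) * Real.exp (-C * δ^(-C)) * Real.sqrt N ≤ N' := by
    intro N' h
    calc 1/200 * (q:ℝ)^(-C) * Real.exp (-C * δ^(-C)) * Real.sqrt N ≤ 1/200 * (1 / (q:ℝ)^2) * (1 / X) * (200 * (q^2 * X) * N') := by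
          gcongr
      _ = N' := by field_simp
  have sq : ∀ m : ℕ, N ≤ 26 * (q^3 * m^2 * X^2) * 100 → Real.sqrt N ≤ 51 * (q^2 * X) * m := by
    intro m hm
    rw [Real.sqrt_le_left (by positivity)]
    have h1 : (N:ℝ) ≤ 26 * (q^3 * m^2 * X^2) * 100 := by exact_mod_cast hm
    have h2 : (q:ℝ)^3 ≤ q^4 := pow_le_pow_right₀ qr (by norm_num)
    have h3 : (q:ℝ)^3 * (m^2 * X^2) ≤ q^4 * (m^2 * X^2) := by gcongr
    have h4 : 0 ≤ (q:ℝ)^4 * (m^2 * X^2) := by positivity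
    calc (N:ℝ) ≤ 2600 * (q^3 * (m^2 * X^2)) := by linarith
      _ ≤ 2601 * (q^4 * (m^2 * X^2)) := by linarith
      _ = _ := by ring
  by_cases hsmall : N < 26 * (q^3 * 1^2 * X^2) * 100
  · by_cases hδ : δ ≤ 1/2
    · right
      have : (0:ℝ) < A.card := lt_of_lt_of_le (by positivity) hd
      obtain ⟨x, hx⟩ := Finset.card_pos.1 (by exact_mod_cast this : 0 < A.card)
      refine ⟨1, 1, x - q, one_pos, one_pos, ?_, low _ ?_, ?_⟩
      · rw [Nat.cast_one]; linarith
      · have := sq 1 hsmall.le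
        have : (0:ℝ) < q^2 * X := by positivity
        push_cast at *; linarith
      · have : x ∈ A ∩ (Finset.Icc (1 : ℤ) ((1:ℕ) : ℤ)).image (fun k => x - q + (q : ℤ) * ((1:ℕ) : ℤ) * k) := by
          refine Finset.mem_inter.2 ⟨hx, Finset.mem_image.2 ⟨1, by simp, by push_cast; ring⟩⟩
        have := Finset.card_pos.2 ⟨x, this⟩
        have : (1:ℝ) ≤ (A ∩ (Finset.Icc (1 : ℤ) ((1:ℕ) : ℤ)).image (fun k => x - q + (q : ℤ) * ((1:ℕ) : ℤ) * k)).card := by exact_mod_cast this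
        refine le_trans ?_ this
        push_cast; linarith
    · left
      push Not at hδ
      have XE : (X:ℝ) ≤ E := by
        rw [hE]; refine X1.trans (Real.exp_le_exp.2 ?_)
        have : 1/δ ≤ 2 := by rw [div_le_iff₀ δ0]; linarith
        gcongr
      have h1 : (N:ℝ) ≤ 26 * (q^3 * 1^2 * X^2) * 100 := by exact_mod_cast hsmall.le
      have h2 : (q:ℝ)^3 ≤ (q/δ)^C := by
        rw [← Real.rpow_natCast]
        calc (q:ℝ)^((3:ℕ):ℝ) ≤ (q:ℝ)^C := Real.rpow_le_rpow_of_exponent_le qr (by push_cast; exact C3)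
          _ ≤ _ := Real.rpow_le_rpow (by positivity) (by rw [le_div_iff₀ δ0]; nlinarith) (by linarith)
      calc (N:ℝ) ≤ (2600 * X^2) * q^3 := by linarith
        _ ≤ (2600 * E^2) * (q/δ)^C := by gcongr
        _ ≤ _ := by gcongr
  · right
    push Not at hsmall
    have hY : 0 < 26 * (q^3 * X^2) * 100 := by positivity
    obtain ⟨n, hn⟩ : ∃ n, n = Nat.sqrt (N / (26 * (q^3 * X^2) * 100)) := ⟨_, rfl⟩
    have n0 : 0 < n := by
      rw [hn, Nat.sqrt_pos]; refine Nat.div_pos ?_ hY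
      simpa using hsmall
    have n1 : 26 * (q^3 * n^2 * X^2) * 100 ≤ N := by
      have : n * n ≤ N / (26 * (q^3 * X^2) * 100) := by rw [hn]; exact Nat.sqrt_le _
      have := (Nat.le_div_iff_mul_le hY).1 this
      calc _ = n * n * (26 * (q^3 * X^2) * 100) := by ring
        _ ≤ N := this
    have n2 : N ≤ 26 * (q^3 * (n+1)^2 * X^2) * 100 := by
      have : N / (26 * (q^3 * X^2) * 100) < (n+1) * (n+1) := by rw [hn]; exact Nat.lt_succ_sqrt _
      have := (Nat.div_lt_iff_lt_mul hY).1 this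
      calc N ≤ (n+1) * (n+1) * (26 * (q^3 * X^2) * 100) := this.le
        _ = _ := by ring
    subst hX
    obtain ⟨q', N', a, h1, h2, h3, h4⟩ := hcore q N Z n δ A q0 N0 Z0 n0 δ0 δ1 Z3 hA n1 hd hc
    refine ⟨q', N', a, h1, by omega, le_trans (by exact_mod_cast h2) X2, low _ ?_, h4⟩
    have := sq (n+1) n2
    refine this.trans ?_
    have h5 : ((n+1:ℕ):ℝ) ≤ 2 * N' := by
      have : n + 1 ≤ 2 * N' := by omega
      exact_mod_cast this
    have h6 : (0:ℝ) ≤ q^2 * NR.XX Z := by positivity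
    have h7 := mul_le_mul_of_nonneg_left h5 h6
    have h8 : (0:ℝ) ≤ q^2 * NR.XX Z * N' := by positivity
    linarith
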